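/- Let C be an algebraic curve in ℂ² of degree d, and let S ⊆ C be a finite set of n points. Then there exists a constant c, depending only on d, such that the number of four-point circles spanned by S — circles in ℂ² containing at least four points of S — is at most c·n^{8/3}, unless C contains an irreducible algebraic curve of degree at most four. -/

import Mathlib

open MvPolynomial

noncomputable section

def ev2 (g : MvPolynomial (Fin 2) ℂ) (p : ℂ × ℂ) : ℂ := eval ![p.1, p.2] g

/-- The polynomial `x² + y² + a·x + b·y + c ∈ ℂ[x,y]`. -/
def circlePoly (a b c : ℂ) : MvPolynomial (Fin 2) ℂ :=
  X 0 ^ 2 + X 1 ^ 2 + C a * X 0 + C b * X 1 + C c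

/-- A circle in `ℂ²`: the zero set of an irreducible polynomial `x² + y² + a·x + b·y + c`. -/
def IsCircle (γ : Set (ℂ × ℂ)) : Prop :=
  ∃ a b c : ℂ, Irreducible (circlePoly a b c) ∧ γ = {p : ℂ × ℂ | ev2 (circlePoly a b c) p = 0}

/-- Index of the half-open dyadic square of side `2 ^ i` containing `x`. -/
noncomputable def sqKey (i : ℤ) (x : ℂ) : ℤ × ℤ := (⌊x.re / 2 ^ i⌋, ⌊x.im / 2 ^ i⌋)

lemma floor_dyadic_succ (i : ℤ) (r : ℝ) : ⌊r / 2 ^ (i + 1)⌋ = ⌊r / 2 ^ i⌋ / 2 := by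
  have h := Int.floor_div_natCast (r / 2 ^ i) 2
  rw [← show r / 2 ^ i / ((2 : ℕ) : ℝ) = r / 2 ^ (i + 1) by
    rw [zpow_add_one₀ (by norm_num), div_div]; norm_num]
  simpa using h

lemma sqKey_succ (i : ℤ) (x : ℂ) :
    sqKey (i + 1) x = ((sqKey i x).1 / 2, (sqKey i x).2 / 2) := by
  simp [sqKey, floor_dyadic_succ]

lemma sqKey_eq_of_le {i j : ℤ} (hij : i ≤ j) {x y : ℂ} (h : sqKey i x = sqKey i y) :
    sqKey j x = sqKey j y := by
  induction j, hij using Int.leInduction with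
  | base => exact h
  | succ k _ ih => rw [sqKey_succ, sqKey_succ, ih]

lemma abs_sub_lt_of_floor_eq {i : ℤ} {r s : ℝ} (h : ⌊r / 2 ^ i⌋ = ⌊s / 2 ^ i⌋) :
    |r - s| < 2 ^ i := by
  have h1 := Int.abs_sub_lt_one_of_floor_eq_floor h
  rwa [← sub_div, abs_div, abs_of_pos (by positivity : (0 : ℝ) < 2 ^ i),
    div_lt_one (by positivity)] at h1

lemma norm_sub_le_of_sqKey_eq {i : ℤ} {x y : ℂ} (h : sqKey i x = sqKey i y) :
    ‖x - y‖ ≤ 2 * 2 ^ i := by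
  have h1 := abs_sub_lt_of_floor_eq (congrArg Prod.fst h)
  have h2 := abs_sub_lt_of_floor_eq (congrArg Prod.snd h)
  have h3 := Complex.norm_le_abs_re_add_abs_im (x - y)
  simp only [Complex.sub_re, Complex.sub_im] at h3
  linarith

lemma floor_mem_Icc_of_abs_sub_le {i : ℤ} {r s : ℝ} {m : ℕ} (h : |r - s| ≤ m * 2 ^ i) :
    ⌊r / 2 ^ i⌋ ∈ Finset.Icc (⌊s / 2 ^ i⌋ - (m + 1)) (⌊s / 2 ^ i⌋ + (m + 1)) := by
  have h2 : (0 : ℝ) < 2 ^ i := by positivity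
  have h1 : |r / 2 ^ i - s / 2 ^ i| ≤ m := by
    rw [← sub_div, abs_div, abs_of_pos h2, div_le_iff₀ h2]; exact h
  rw [abs_le] at h1
  have := Int.floor_le (r / 2 ^ i)
  have := Int.floor_le (s / 2 ^ i)
  have := Int.lt_floor_add_one (r / 2 ^ i)
  have := Int.lt_floor_add_one (s / 2 ^ i)
  rw [Finset.mem_Icc]
  constructor
  · have : (⌊s / 2 ^ i⌋ : ℝ) < ⌊r / 2 ^ i⌋ + (m + 1) := by linarith
    have : ⌊s / 2 ^ i⌋ < ⌊r / 2 ^ i⌋ + (m + 1) := by exact_mod_cast this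
    omega
  · have : (⌊r / 2 ^ i⌋ : ℝ) < ⌊s / 2 ^ i⌋ + (m + 1) := by linarith
    have : ⌊r / 2 ^ i⌋ < ⌊s / 2 ^ i⌋ + (m + 1) := by exact_mod_cast this
    omega

/-- The squares of level `i` meeting a disc of radius `m * 2 ^ i` lie in a set of bounded size. -/
lemma exists_finset_sqKey (i : ℤ) (y : ℂ) (m : ℕ) : ∃ T : Finset (ℤ × ℤ),
    T.card ≤ (2 * m + 3) ^ 2 ∧ ∀ x : ℂ, ‖x - y‖ ≤ m * 2 ^ i → sqKey i x ∈ T := by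
  refine ⟨Finset.Icc (⌊y.re / 2 ^ i⌋ - (m + 1)) (⌊y.re / 2 ^ i⌋ + (m + 1)) ×ˢ
    Finset.Icc (⌊y.im / 2 ^ i⌋ - (m + 1)) (⌊y.im / 2 ^ i⌋ + (m + 1)), ?_, fun x hx => ?_⟩
  · rw [Finset.card_product, Int.card_Icc, Int.card_Icc, sq]
    gcongr <;> omega
  · have h1 := (Complex.abs_re_le_norm (x - y)).trans hx
    have h2 := (Complex.abs_im_le_norm (x - y)).trans hx
    exact Finset.mem_product.2 ⟨floor_mem_Icc_of_abs_sub_le h1, floor_mem_Icc_of_abs_sub_le h2⟩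

/-- `P` is the smallest member of `Q` of level at least `s` that contains `x`. -/
def IsCellFrom (Q : Finset (ℤ × ℤ × ℤ)) (s : ℤ) (P : ℤ × ℤ × ℤ) (x : ℂ) : Prop :=
  P ∈ Q ∧ sqKey P.1 x = P.2 ∧ s ≤ P.1 ∧
    ∀ R ∈ Q, sqKey R.1 x = R.2 → s ≤ R.1 → P.1 ≤ R.1

/-- `P` is the smallest member of `Q` that contains `x`. -/
def IsCell (Q : Finset (ℤ × ℤ × ℤ)) (P : ℤ × ℤ × ℤ) (x : ℂ) : Prop :=
  P ∈ Q ∧ sqKey P.1 x = P.2 ∧ ∀ P' ∈ Q, sqKey P'.1 x = P'.2 → P.1 ≤ P'.1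

lemma IsCell.isCellFrom {Q : Finset (ℤ × ℤ × ℤ)} {P : ℤ × ℤ × ℤ} {x : ℂ} (h : IsCell Q P x)
    {s : ℤ} (hs : s ≤ P.1) : IsCellFrom Q s P x :=
  ⟨h.1, h.2.1, hs, fun P' h1 h2 _ => h.2.2 P' h1 h2⟩

lemma IsCellFrom.mono {Q : Finset (ℤ × ℤ × ℤ)} {P : ℤ × ℤ × ℤ} {x : ℂ} {s t : ℤ}
    (h : IsCellFrom Q s P x) (hst : s ≤ t) (ht : t ≤ P.1) : IsCellFrom Q t P x :=
  ⟨h.1, h.2.1, ht, fun P' h1 h2 h3 => h.2.2.2 P' h1 h2 (hst.trans h3)⟩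

lemma IsCellFrom.eq {Q : Finset (ℤ × ℤ × ℤ)} {P P' : ℤ × ℤ × ℤ} {x x' : ℂ} {s : ℤ}
    (h : IsCellFrom Q s P x) (h' : IsCellFrom Q s P' x') (hk : sqKey s x = sqKey s x') :
    P = P' := by
  have e1 : P.1 = P'.1 := le_antisymm
    (h.2.2.2 P' h'.1 ((sqKey_eq_of_le h'.2.2.1 hk).trans h'.2.1) h'.2.2.1)
    (h'.2.2.2 P h.1 ((sqKey_eq_of_le h.2.2.1 hk).symm.trans h.2.1) h.2.2.1)
  refine Prod.ext e1 ?_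
  rw [← h.2.1, ← h'.2.1, e1]
  exact sqKey_eq_of_le h'.2.2.1 hk

lemma IsCell.eq {Q : Finset (ℤ × ℤ × ℤ)} {P P' : ℤ × ℤ × ℤ} {x : ℂ}
    (h : IsCell Q P x) (h' : IsCell Q P' x) : P = P' :=
  (h.isCellFrom (min_le_left P.1 P'.1)).eq (h'.isCellFrom (min_le_right P.1 P'.1)) rfl

lemma exists_isCell {Q : Finset (ℤ × ℤ × ℤ)} {x : ℂ} (h : ∃ P ∈ Q, sqKey P.1 x = P.2) :
    ∃ P, IsCell Q P x := by
  obtain ⟨P, hP, hx⟩ := h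
  obtain ⟨P0, h0, hmin⟩ := Finset.exists_min_image (Q.filter fun P => sqKey P.1 x = P.2)
    (fun P => P.1) ⟨P, by simp [hP, hx]⟩
  simp only [Finset.mem_filter] at h0 hmin
  exact ⟨P0, h0.1, h0.2, fun P' h1 h2 => hmin P' ⟨h1, h2⟩⟩

/-- Boundedly many cells of level at least `s` meet a disc of radius comparable to `2 ^ s`. -/
lemma exists_finset_isCellFrom (Q : Finset (ℤ × ℤ × ℤ)) (s : ℤ) (y : ℂ) (m : ℕ) :
    ∃ T : Finset (ℤ × ℤ × ℤ), T.card ≤ (2 * m + 3) ^ 2 ∧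
      ∀ P x, IsCellFrom Q s P x → ‖x - y‖ ≤ m * 2 ^ s → P ∈ T := by
  classical
  obtain ⟨K, hK, hKx⟩ := exists_finset_sqKey s y m
  set T := Q.filter fun P => ∃ x, IsCellFrom Q s P x ∧ ‖x - y‖ ≤ m * 2 ^ s
  refine ⟨T, le_trans ?_ hK, fun P x h hx => Finset.mem_filter.2 ⟨h.1, x, h, hx⟩⟩
  have hT : ∀ P ∈ T, ∃ x, IsCellFrom Q s P x ∧ ‖x - y‖ ≤ m * 2 ^ s :=
    fun P hP => (Finset.mem_filter.1 hP).2
  choose! f hf using hT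
  exact Finset.card_le_card_of_injOn (fun P => sqKey s (f P)) (fun P hP => hKx _ (hf P hP).2)
    (fun P hP P' hP' he => (hf P hP).1.eq (hf P' hP').1 he)

lemma exists_sqKey_injOn (A : Finset ℂ) : ∃ i : ℤ, ∀ x ∈ A, ∀ y ∈ A,
    sqKey i x = sqKey i y → x = y := by
  have h : ∀ p ∈ A ×ˢ A, ∃ n : ℕ, ∀ i : ℤ, i ≤ -n → sqKey i p.1 = sqKey i p.2 → p.1 = p.2 := by
    rintro ⟨x, y⟩ -
    by_cases hxy : x = y
    · exact ⟨0, fun _ _ _ => hxy⟩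
    · have h1 : 0 < ‖x - y‖ := norm_pos_iff.2 (sub_ne_zero.2 hxy)
      obtain ⟨n, hn⟩ := exists_pow_lt_of_lt_one (by positivity : 0 < ‖x - y‖ / 2)
        (by norm_num : (1 / 2 : ℝ) < 1)
      refine ⟨n, fun i hi he => absurd (norm_sub_le_of_sqKey_eq he) ?_⟩
      have : (2 : ℝ) ^ i ≤ 2 ^ (-n : ℤ) := zpow_le_zpow_right₀ (by norm_num) hi
      rw [zpow_neg, zpow_natCast] at this
      rw [one_div, inv_pow] at hn
      simp only at *
      linarith
  choose! f hf using h
  refine ⟨-((A ×ˢ A).sup f : ℕ), fun x hx y hy he => ?_⟩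
  have hm : (x, y) ∈ A ×ˢ A := Finset.mem_product.2 ⟨hx, hy⟩
  refine hf (x, y) hm _ ?_ he
  have := Finset.le_sup (f := f) hm
  omega

lemma exists_sqKey_coarse (A : Finset ℂ) : ∃ i : ℤ, ∀ j, i ≤ j → ∀ x ∈ A,
    sqKey j x ∈ (({-1, 0} : Finset ℤ) ×ˢ ({-1, 0} : Finset ℤ)) := by
  have h : ∀ x ∈ A, ∃ n : ℕ, ‖x‖ < 2 ^ n := fun x _ =>
    (pow_unbounded_of_one_lt ‖x‖ (by norm_num : (1 : ℝ) < 2))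
  choose! f hf using h
  have key : ∀ (r : ℝ) (j : ℤ), |r| < 2 ^ j → ⌊r / 2 ^ j⌋ ∈ ({-1, 0} : Finset ℤ) := by
    intro r j hr
    have h2 : (0 : ℝ) < 2 ^ j := by positivity
    rw [abs_lt] at hr
    have h3 : r / 2 ^ j < 1 := by rw [div_lt_one h2]; exact hr.2
    have h4 : -1 < r / 2 ^ j := by rw [lt_div_iff₀ h2]; linarith
    have h5 : ⌊r / 2 ^ j⌋ < 1 := Int.floor_lt.2 (by exact_mod_cast h3)
    have h6 : -1 ≤ ⌊r / 2 ^ j⌋ := Int.le_floor.2 (by push_cast; linarith)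
    simp only [Finset.mem_insert, Finset.mem_singleton]
    omega
  refine ⟨(A.sup f : ℕ), fun j hj x hx => ?_⟩
  have hx' : ‖x‖ < 2 ^ j := by
    refine (hf x hx).trans_le ?_
    rw [← zpow_natCast]
    refine zpow_le_zpow_right₀ (by norm_num) (le_trans ?_ hj)
    exact_mod_cast Finset.le_sup (f := f) hx
  exact Finset.mem_product.2 ⟨key _ _ ((Complex.abs_re_le_norm x).trans_lt hx'),
    key _ _ ((Complex.abs_im_le_norm x).trans_lt hx')⟩

open Classical in
/-- The points of `A` not contained in any square of `Q`. -/
noncomputable def uncovered (A : Finset ℂ) (Q : Finset (ℤ × ℤ × ℤ)) : Finset ℂ :=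
  A.filter fun x => ∀ P ∈ Q, sqKey P.1 x ≠ P.2

open Classical in
/-- Adding the squares of level `i` with keys in `N` to a family of smaller squares. -/
lemma card_isCell_union_le {A : Finset ℂ} {Q : Finset (ℤ × ℤ × ℤ)} {i : ℤ} {m : ℕ}
    (hlev : ∀ P ∈ Q, P.1 < i) (hcell : ∀ P ∈ Q, (A.filter fun x => IsCell Q P x).card ≤ m)
    (N : Finset (ℤ × ℤ))
    (hN : ∀ k ∈ N, ((uncovered A Q).filter fun x => sqKey i x = k).card ≤ m) :
    ∀ P ∈ Q ∪ N.image fun k => (i, k),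
      (A.filter fun x => IsCell (Q ∪ N.image fun k => (i, k)) P x).card ≤ m := by
  intro P hP
  rcases Finset.mem_union.1 hP with hP | hP
  · refine (Finset.card_le_card fun x hx => ?_).trans (hcell P hP)
    simp only [Finset.mem_filter] at hx ⊢
    exact ⟨hx.1, hP, hx.2.2.1, fun P' h1 h2 => hx.2.2.2 P' (Finset.mem_union_left _ h1) h2⟩
  · obtain ⟨k, hk, rfl⟩ := Finset.mem_image.1 hP
    refine (Finset.card_le_card fun x hx => ?_).trans (hN k hk)
    simp only [Finset.mem_filter, uncovered] at hx ⊢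
    refine ⟨⟨hx.1, fun P' h1 h2 => ?_⟩, hx.2.2.1⟩
    have := hx.2.2.2 P' (Finset.mem_union_left _ h1) h2
    have := hlev P' h1
    simp only at *
    omega

open Classical in
lemma exists_partition_step (A : Finset ℂ) (m : ℕ) (i : ℤ) (Q : Finset (ℤ × ℤ × ℤ))
    (hlev : ∀ P ∈ Q, P.1 < i) (hcell : ∀ P ∈ Q, (A.filter fun x => IsCell Q P x).card ≤ m)
    (hcard : m * Q.card + 4 * (uncovered A Q).card ≤ 4 * A.card)
    (hunc : ∀ k, ((uncovered A Q).filter fun x => sqKey i x = k).card ≤ m) :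
    ∃ Q' : Finset (ℤ × ℤ × ℤ), (∀ P ∈ Q', P.1 < i + 1) ∧
      (∀ P ∈ Q', (A.filter fun x => IsCell Q' P x).card ≤ m) ∧
      m * Q'.card + 4 * (uncovered A Q').card ≤ 4 * A.card ∧
      ∀ k, ((uncovered A Q').filter fun x => sqKey (i + 1) x = k).card ≤ m := by
  set U := uncovered A Q with hU
  set B := (U.image (sqKey (i + 1))).filter fun k => m < (U.filter fun x => sqKey (i + 1) x = k).card
    with hB
  set N : Finset (ℤ × ℤ) := B.biUnion fun k =>
    {(2 * k.1, 2 * k.2), (2 * k.1 + 1, 2 * k.2), (2 * k.1, 2 * k.2 + 1),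
      (2 * k.1 + 1, 2 * k.2 + 1)} with hNdef
  have hNcard : N.card ≤ B.card * 4 := Finset.card_biUnion_le_card_mul _ _ _ fun k _ =>
    (Finset.card_insert_le _ _).trans (Nat.succ_le_succ <| (Finset.card_insert_le _ _).trans <|
      Nat.succ_le_succ <| Finset.card_le_two)
  have hNmem : ∀ x, sqKey (i + 1) x ∈ B → sqKey i x ∈ N := by
    intro x hx
    refine Finset.mem_biUnion.2 ⟨_, hx, ?_⟩
    rw [sqKey_succ]
    simp only [Finset.mem_insert, Finset.mem_singleton, Prod.ext_iff]
    omega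
  set Q' := Q ∪ N.image fun k => (i, k) with hQ'
  have hU' : uncovered A Q' ⊆ U.filter fun x => sqKey (i + 1) x ∉ B := by
    intro x hx
    simp only [uncovered, hU, Finset.mem_filter] at hx ⊢
    refine ⟨⟨hx.1, fun P hP => hx.2 P (Finset.mem_union_left _ hP)⟩, fun hb => ?_⟩
    exact hx.2 (i, sqKey i x) (Finset.mem_union_right _ (Finset.mem_image.2 ⟨_, hNmem x hb, rfl⟩)) rfl
  refine ⟨Q', ?_, card_isCell_union_le hlev hcell N fun k _ => hunc k, ?_, fun k => ?_⟩
  · intro P hP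
    rcases Finset.mem_union.1 hP with hP | hP
    · have := hlev P hP; omega
    · obtain ⟨k, _, rfl⟩ := Finset.mem_image.1 hP
      simp
  · have h1 : Q'.card ≤ Q.card + N.card := (Finset.card_union_le _ _).trans
      (Nat.add_le_add_left Finset.card_image_le _)
    have h2 : (uncovered A Q').card + (U.filter fun x => sqKey (i + 1) x ∈ B).card ≤ U.card := by
      rw [← Finset.card_filter_add_card_filter_not (s := U) (fun x => sqKey (i + 1) x ∈ B), add_comm]
      exact Nat.add_le_add_left (Finset.card_le_card hU') _
    have h3 : B.card * m ≤ (U.filter fun x => sqKey (i + 1) x ∈ B).card := by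
      have hmaps : ∀ x ∈ U.filter fun x => sqKey (i + 1) x ∈ B, sqKey (i + 1) x ∈ B :=
        fun x hx => (Finset.mem_filter.1 hx).2
      rw [Finset.card_eq_sum_card_fiberwise hmaps, ← smul_eq_mul]
      refine Finset.card_nsmul_le_sum _ _ _ fun k hk => ?_
      refine (Finset.mem_filter.1 hk).2.le.trans (Finset.card_le_card fun x hx => ?_)
      simp only [Finset.mem_filter] at hx ⊢
      exact ⟨⟨hx.1, hx.2 ▸ hk⟩, hx.2⟩
    nlinarith [Nat.mul_le_mul_left m h1, Nat.mul_le_mul_left m hNcard]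
  · by_cases hk : k ∈ B
    · rw [Finset.card_eq_zero.2]
      · exact Nat.zero_le _
      · refine Finset.filter_eq_empty_iff.2 fun x hx he => ?_
        exact (Finset.mem_filter.1 (hU' hx)).2 (he ▸ hk)
    · have h4 : (uncovered A Q').filter (fun x => sqKey (i + 1) x = k) ⊆
          U.filter fun x => sqKey (i + 1) x = k :=
        Finset.filter_subset_filter _ (hU'.trans (Finset.filter_subset _ _))
      by_contra! hlt
      have h5 := hlt.trans_le (Finset.card_le_card h4)
      obtain ⟨x, hx⟩ := Finset.card_pos.1 ((Nat.zero_le m).trans_lt h5)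
      refine hk (Finset.mem_filter.2 ⟨Finset.mem_image.2 ⟨x, ?_⟩, h5⟩)
      exact Finset.mem_filter.1 hx

open Classical in
/-- A finite set of complex numbers can be split into few dyadic cells, each with few points. -/
theorem exists_dyadic_partition (A : Finset ℂ) (m : ℕ) (hm : 1 ≤ m) :
    ∃ Q : Finset (ℤ × ℤ × ℤ), m * Q.card ≤ 4 * A.card + 4 * m ∧
      (∀ x ∈ A, ∃ P, IsCell Q P x) ∧ ∀ P ∈ Q, (A.filter fun x => IsCell Q P x).card ≤ m := by
  obtain ⟨i₀, h0⟩ := exists_sqKey_injOn A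
  obtain ⟨i₁, h1⟩ := exists_sqKey_coarse A
  have main : ∀ i, i₀ ≤ i → ∃ Q : Finset (ℤ × ℤ × ℤ), (∀ P ∈ Q, P.1 < i) ∧
      (∀ P ∈ Q, (A.filter fun x => IsCell Q P x).card ≤ m) ∧
      m * Q.card + 4 * (uncovered A Q).card ≤ 4 * A.card ∧
      ∀ k, ((uncovered A Q).filter fun x => sqKey i x = k).card ≤ m := by
    intro i hi
    induction i, hi using Int.leInduction with
    | base =>
      refine ⟨∅, by simp, by simp, by simp [uncovered], fun k => le_trans ?_ hm⟩
      refine Finset.card_le_one.2 fun x hx y hy => ?_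
      simp only [uncovered, Finset.mem_filter] at hx hy
      exact h0 x hx.1.1 y hy.1.1 (hx.2.trans hy.2.symm)
    | succ k _ ih =>
      obtain ⟨Q, a, b, c, d⟩ := ih
      exact exists_partition_step A m k Q a b c d
  obtain ⟨Q, a, b, c, d⟩ := main (max i₀ i₁) (le_max_left _ _)
  set i := max i₀ i₁
  set N := (({-1, 0} : Finset ℤ) ×ˢ ({-1, 0} : Finset ℤ))
  refine ⟨Q ∪ N.image fun k => (i, k), ?_, fun x hx => exists_isCell
    ⟨(i, sqKey i x), Finset.mem_union_right _ (Finset.mem_image.2 ⟨_, h1 i (le_max_right _ _) x hx,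
      rfl⟩), rfl⟩, card_isCell_union_le a b N fun k _ => d k⟩
  have h2 : (Q ∪ N.image fun k => (i, k)).card ≤ Q.card + 4 :=
    (Finset.card_union_le _ _).trans (Nat.add_le_add_left (Finset.card_image_le.trans (by decide)) _)
  nlinarith [Nat.mul_le_mul_left m h2]

lemma exists_finset_linear_near {b : ℤ} (hb : b ≠ 0) (c : ℤ) (κ : ℕ) :
    ∃ J : Finset ℤ, J.card ≤ 2 * κ + 1 ∧ ∀ j, |b * j - c| ≤ κ → j ∈ J := by
  refine ⟨(Finset.Icc (c - κ) (c + κ)).image fun z => z / b, Finset.card_image_le.trans ?_,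
    fun j hj => Finset.mem_image.2 ⟨b * j, ?_, Int.mul_ediv_cancel_left j hb⟩⟩
  · rw [Int.card_Icc]; omega
  · rw [Finset.mem_Icc]
    rw [abs_le] at hj
    omega

lemma exists_finset_exit {r : ℤ → Prop} {b : ℤ} (hb : ∀ j, r j → j ≤ b)
    (hup : ∀ i j, r i → i ≤ j → j ≤ b → r j) {δ : ℤ} {D : ℕ} (hδ : |δ| ≤ D) (hδ0 : δ ≠ 0) :
    ∃ E : Finset ℤ, E.card ≤ 2 * D + 1 ∧ ∀ j, r j → ¬ r (j + δ) → j ∈ E := by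
  by_cases h : ∃ j, r j ∧ ¬ r (j + δ)
  · obtain ⟨j0, h0, h0'⟩ := h
    refine ⟨Finset.Icc (j0 - D) (j0 + D), by rw [Int.card_Icc]; omega, fun j hj hj' => ?_⟩
    have key : ∀ i j, r i → ¬ r (i + δ) → r j → ¬ r (j + δ) → j ≤ i + D := by
      intro i j hi hi' hj hj'
      by_contra! hlt
      rw [abs_le] at hδ
      rcases lt_or_gt_of_ne hδ0 with hneg | hpos
      · exact hj' (hup i _ hi (by omega) (by have := hb j hj; omega))
      · exact hi' (hup i _ hi (by omega) (by have := hb j hj; omega))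
    have := key j0 j h0 h0' hj hj'
    have := key j j0 hj hj' h0 h0'
    exact Finset.mem_Icc.2 ⟨by omega, by omega⟩
  · push Not at h
    exact ⟨∅, by simp, fun j hj hj' => absurd (h j hj) hj'⟩

open Classical in
/-- A pair of families of nested windows meets a strip in boundedly many pairs per member. -/
theorem card_strip_le {A B : Type*} (Q : Finset A) (Q' : Finset B)
    (p : ℤ → A → Prop) (r : ℤ → B → Prop) (a : A → ℤ) (b : B → ℤ)
    (hpa : ∀ i P, p i P → i ≤ a P) (hrb : ∀ i R, r i R → i ≤ b R)
    (hpu : ∀ i j P, p i P → i ≤ j → j ≤ a P → p j P)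
    (hru : ∀ i j R, r i R → i ≤ j → j ≤ b R → r j R)
    (T : ℤ → Finset A) (T' : ℤ → Finset B) (M : ℕ)
    (hT : ∀ i, (T i).card ≤ M) (hT' : ∀ i, (T' i).card ≤ M)
    (hpT : ∀ i P, p i P → P ∈ T i) (hrT : ∀ i R, r i R → R ∈ T' i)
    (α β c : ℤ) (D κ : ℕ) (hα : |α| ≤ D) (hβ : |β| ≤ D) (hαβ : α ≠ 0 ∨ β ≠ 0) :
    ((Q ×ˢ Q').filter fun z => ∃ i j, p i z.1 ∧ r j z.2 ∧ |α * i + β * j - c| ≤ κ).card ≤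
      (2 * D + 1) * ((2 * κ + 1) * M) * (Q.card + Q'.card) := by
  have h1 : (2 * κ + 1) * M ≤ (2 * D + 1) * ((2 * κ + 1) * M) :=
    Nat.le_mul_of_pos_left _ (by omega)
  set Z := (Q ×ˢ Q').filter fun z => ∃ i j, p i z.1 ∧ r j z.2 ∧ |α * i + β * j - c| ≤ κ with hZ
  by_cases hα0 : α = 0
  · have hβ0 : β ≠ 0 := by tauto
    obtain ⟨J, hJ, hJm⟩ := exists_finset_linear_near hβ0 c κ
    have hsub : Z ⊆ Q ×ˢ J.biUnion T' := by
      rintro ⟨P, R⟩ hz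
      simp only [hZ, Finset.mem_filter, Finset.mem_product] at hz
      obtain ⟨⟨hP, hR⟩, i, j, -, hr, hs⟩ := hz
      refine Finset.mem_product.2 ⟨hP, Finset.mem_biUnion.2 ⟨j, hJm j ?_, hrT j R hr⟩⟩
      simpa [hα0] using hs
    have h2 : (J.biUnion T').card ≤ (2 * κ + 1) * M :=
      (Finset.card_biUnion_le_card_mul _ _ M fun j _ => hT' j).trans (Nat.mul_le_mul_right _ hJ)
    have h3 := Finset.card_le_card hsub
    rw [Finset.card_product] at h3
    calc Z.card ≤ Q.card * ((2 * D + 1) * ((2 * κ + 1) * M)) :=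
          h3.trans (Nat.mul_le_mul_left _ (h2.trans h1))
      _ ≤ _ := by rw [mul_comm]; exact Nat.mul_le_mul_left _ (Nat.le_add_right _ _)
  by_cases hβ0 : β = 0
  · obtain ⟨J, hJ, hJm⟩ := exists_finset_linear_near hα0 c κ
    have hsub : Z ⊆ J.biUnion T ×ˢ Q' := by
      rintro ⟨P, R⟩ hz
      simp only [hZ, Finset.mem_filter, Finset.mem_product] at hz
      obtain ⟨⟨hP, hR⟩, i, j, hp, -, hs⟩ := hz
      refine Finset.mem_product.2 ⟨Finset.mem_biUnion.2 ⟨i, hJm i ?_, hpT i P hp⟩, hR⟩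
      simpa [hβ0] using hs
    have h2 : (J.biUnion T).card ≤ (2 * κ + 1) * M :=
      (Finset.card_biUnion_le_card_mul _ _ M fun j _ => hT j).trans (Nat.mul_le_mul_right _ hJ)
    have h3 := Finset.card_le_card hsub
    rw [Finset.card_product] at h3
    calc Z.card ≤ ((2 * D + 1) * ((2 * κ + 1) * M)) * Q'.card :=
          h3.trans (Nat.mul_le_mul_right _ (h2.trans h1))
      _ ≤ _ := Nat.mul_le_mul_left _ (Nat.le_add_left _ _)
  set δ := -α * β.sign with hδ
  have hsign : β.sign = 1 ∨ β.sign = -1 := by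
    rcases lt_or_gt_of_ne hβ0 with h | h
    · exact Or.inr (Int.sign_eq_neg_one_of_neg h)
    · exact Or.inl (Int.sign_eq_one_of_pos h)
  have hδD : |δ| ≤ D := by
    rcases hsign with h | h <;> simpa [hδ, h] using hα
  have hδ0 : δ ≠ 0 := by
    rcases hsign with h | h <;> simpa [hδ, h] using hα0
  have habs : |(|β|)| ≤ (D : ℤ) := by rwa [abs_abs]
  have hEP : ∀ P, ∃ E : Finset ℤ, E.card ≤ 2 * D + 1 ∧ ∀ j, p j P → ¬ p (j + |β|) P → j ∈ E :=
    fun P => exists_finset_exit (fun j => hpa j P) (fun i j => hpu i j P) habs (abs_ne_zero.2 hβ0)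
  have hER : ∀ R, ∃ E : Finset ℤ, E.card ≤ 2 * D + 1 ∧ ∀ j, r j R → ¬ r (j + δ) R → j ∈ E :=
    fun R => exists_finset_exit (fun j => hrb j R) (fun i j => hru i j R) hδD hδ0
  have hJβ : ∀ i, ∃ J : Finset ℤ, J.card ≤ 2 * κ + 1 ∧ ∀ j, |α * i + β * j - c| ≤ κ → j ∈ J := by
    intro i
    obtain ⟨J, h, h'⟩ := exists_finset_linear_near hβ0 (c - α * i) κ
    exact ⟨J, h, fun j hj => h' j (by convert hj using 2; ring)⟩
  have hJα : ∀ j, ∃ J : Finset ℤ, J.card ≤ 2 * κ + 1 ∧ ∀ i, |α * i + β * j - c| ≤ κ → i ∈ J := by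
    intro j
    obtain ⟨J, h, h'⟩ := exists_finset_linear_near hα0 (c - β * j) κ
    exact ⟨J, h, fun i hi => h' i (by convert hi using 2; ring)⟩
  choose EP hEPc hEP using hEP
  choose ER hERc hER using hER
  choose Jβ hJβc hJβ using hJβ
  choose Jα hJαc hJα using hJα
  set XP := Q.biUnion fun P => (EP P).biUnion fun i => (Jβ i).biUnion fun j =>
    (T' j).image fun R => (P, R)
  set XR := Q'.biUnion fun R => (ER R).biUnion fun j => (Jα j).biUnion fun i =>
    (T i).image fun P => (P, R)
  have hsub : Z ⊆ XP ∪ XR := by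
    rintro ⟨P, R⟩ hz
    simp only [hZ, Finset.mem_filter, Finset.mem_product] at hz
    obtain ⟨⟨hP, hR⟩, hex⟩ := hz
    obtain ⟨i, ⟨j, hp, hr, hs⟩, hmax⟩ := Int.exists_greatest_of_bdd
      (P := fun i => ∃ j, p i P ∧ r j R ∧ |α * i + β * j - c| ≤ κ)
      ⟨a P, fun i ⟨j, hp, _⟩ => hpa i P hp⟩ hex
    by_cases h1 : p (i + |β|) P
    · have h2 : ¬ r (j + δ) R := by
        intro h2
        have h3 := hmax (i + |β|) ⟨j + δ, h1, h2, ?_⟩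
        · have := abs_pos.2 hβ0
          omega
        · have : β * β.sign = |β| := by rw [Int.mul_sign_self, Int.abs_eq_natAbs]
          rw [show α * (i + |β|) + β * (j + δ) - c = α * i + β * j - c by
            rw [← this, hδ]; ring]
          exact hs
      refine Finset.mem_union_right _ (Finset.mem_biUnion.2 ⟨R, hR, Finset.mem_biUnion.2
        ⟨j, hER R j hr h2, Finset.mem_biUnion.2 ⟨i, hJα j i hs, Finset.mem_image.2
          ⟨P, hpT i P hp, rfl⟩⟩⟩⟩)
    · refine Finset.mem_union_left _ (Finset.mem_biUnion.2 ⟨P, hP, Finset.mem_biUnion.2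
        ⟨i, hEP P i hp h1, Finset.mem_biUnion.2 ⟨j, hJβ i j hs, Finset.mem_image.2
          ⟨R, hrT j R hr, rfl⟩⟩⟩⟩)
  have hXP : XP.card ≤ Q.card * ((2 * D + 1) * ((2 * κ + 1) * M)) :=
    Finset.card_biUnion_le_card_mul _ _ _ fun P _ =>
      (Finset.card_biUnion_le_card_mul _ _ _ fun i _ =>
        (Finset.card_biUnion_le_card_mul _ _ _ fun j _ =>
          Finset.card_image_le.trans (hT' j)).trans (Nat.mul_le_mul_right _ (hJβc i))).trans
      (Nat.mul_le_mul_right _ (hEPc P))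
  have hXR : XR.card ≤ Q'.card * ((2 * D + 1) * ((2 * κ + 1) * M)) :=
    Finset.card_biUnion_le_card_mul _ _ _ fun P _ =>
      (Finset.card_biUnion_le_card_mul _ _ _ fun i _ =>
        (Finset.card_biUnion_le_card_mul _ _ _ fun j _ =>
          Finset.card_image_le.trans (hT j)).trans (Nat.mul_le_mul_right _ (hJαc i))).trans
      (Nat.mul_le_mul_right _ (hERc P))
  calc Z.card ≤ XP.card + XR.card := (Finset.card_le_card hsub).trans (Finset.card_union_le _ _)
    _ ≤ _ := (add_le_add hXP hXR).trans_eq (by ring)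

section Evaluation

@[simp] lemma ev2_add (f g : MvPolynomial (Fin 2) ℂ) (p : ℂ × ℂ) :
    ev2 (f + g) p = ev2 f p + ev2 g p := by simp [ev2]

@[simp] lemma ev2_sub (f g : MvPolynomial (Fin 2) ℂ) (p : ℂ × ℂ) :
    ev2 (f - g) p = ev2 f p - ev2 g p := by simp [ev2]

@[simp] lemma ev2_neg (f : MvPolynomial (Fin 2) ℂ) (p : ℂ × ℂ) :
    ev2 (-f) p = - ev2 f p := by simp [ev2]

@[simp] lemma ev2_mul (f g : MvPolynomial (Fin 2) ℂ) (p : ℂ × ℂ) :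
    ev2 (f * g) p = ev2 f p * ev2 g p := by simp [ev2]

@[simp] lemma ev2_pow (f : MvPolynomial (Fin 2) ℂ) (n : ℕ) (p : ℂ × ℂ) :
    ev2 (f ^ n) p = ev2 f p ^ n := by simp [ev2]

@[simp] lemma ev2_C (a : ℂ) (p : ℂ × ℂ) : ev2 (C a) p = a := by simp [ev2]

@[simp] lemma ev2_X_zero (p : ℂ × ℂ) : ev2 (X 0) p = p.1 := by simp [ev2]

@[simp] lemma ev2_X_one (p : ℂ × ℂ) : ev2 (X 1) p = p.2 := by simp [ev2]

@[simp] lemma ev2_zero (p : ℂ × ℂ) : ev2 0 p = 0 := by simp [ev2]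

lemma ev2_sum {ι : Type*} (s : Finset ι) (f : ι → MvPolynomial (Fin 2) ℂ) (p : ℂ × ℂ) :
    ev2 (∑ i ∈ s, f i) p = ∑ i ∈ s, ev2 (f i) p := by simp [ev2]

lemma eq_zero_of_ev2 {g : MvPolynomial (Fin 2) ℂ} (h : ∀ p, ev2 g p = 0) : g = 0 := by
  refine MvPolynomial.funext fun x => ?_
  have := h (x 0, x 1)
  rw [map_zero, ← this, ev2]
  have hx : x = ![x 0, x 1] := by ext i; fin_cases i <;> rfl
  exact congrArg (fun y => eval y g) hx

lemma ev2_eq_zero_of_dvd {f g : MvPolynomial (Fin 2) ℂ} (h : f ∣ g) {p : ℂ × ℂ}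
    (hp : ev2 f p = 0) : ev2 g p = 0 := by
  obtain ⟨k, rfl⟩ := h
  simp [hp]

lemma ev2_aeval (f₀ f₁ g : MvPolynomial (Fin 2) ℂ) (p : ℂ × ℂ) :
    ev2 (aeval ![f₀, f₁] g) p = ev2 g (ev2 f₀ p, ev2 f₁ p) := by
  induction g using MvPolynomial.induction_on with
  | C a => simp [algebraMap_eq]
  | add f g hf hg => rw [map_add, ev2_add, ev2_add, hf, hg]
  | mul_X f i hf =>
    rw [map_mul, ev2_mul, ev2_mul, hf]
    congr 1
    fin_cases i <;> simp

lemma totalDegree_aeval_le {σ τ R : Type*} [CommSemiring R] (f : σ → MvPolynomial τ R) (e : ℕ)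
    (hf : ∀ i, (f i).totalDegree ≤ e) (p : MvPolynomial σ R) :
    (aeval f p).totalDegree ≤ p.totalDegree * e := by
  rw [aeval_def, eval₂_eq]
  refine totalDegree_finsetSum_le fun d hd => ?_
  refine (totalDegree_mul _ _).trans ?_
  rw [algebraMap_eq, totalDegree_C, zero_add]
  refine (totalDegree_finsetProd _ _).trans ?_
  calc ∑ i ∈ d.support, (f i ^ d i).totalDegree ≤ ∑ i ∈ d.support, d i * e :=
        Finset.sum_le_sum fun i _ => (totalDegree_pow _ _).trans (Nat.mul_le_mul_left _ (hf i))
    _ = (∑ i ∈ d.support, d i) * e := by rw [Finset.sum_mul]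
    _ ≤ _ := Nat.mul_le_mul_right _ (le_totalDegree hd)

/-- The exponent vector `(a, b)`. -/
def expo (a b : ℕ) : Fin 2 →₀ ℕ := Finsupp.single 0 a + Finsupp.single 1 b

@[simp] lemma expo_zero (a b : ℕ) : expo a b 0 = a := by simp [expo]

@[simp] lemma expo_one (a b : ℕ) : expo a b 1 = b := by simp [expo]

lemma expo_eta (s : Fin 2 →₀ ℕ) : expo (s 0) (s 1) = s := by
  ext i; fin_cases i <;> simp

lemma le_totalDegree_fin_two {g : MvPolynomial (Fin 2) ℂ} {s : Fin 2 →₀ ℕ} (hs : s ∈ g.support) :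
    s 0 + s 1 ≤ g.totalDegree := by
  have := le_totalDegree hs
  rwa [Finsupp.sum_fintype _ _ (fun _ => rfl), Fin.sum_univ_two] at this

lemma eq_sum_expo {g : MvPolynomial (Fin 2) ℂ} {D : ℕ} (hg : g.totalDegree ≤ D) :
    g = ∑ z ∈ Finset.range (D + 1) ×ˢ Finset.range (D + 1),
      C (g.coeff (expo z.1 z.2)) * X 0 ^ z.1 * X 1 ^ z.2 := by
  have hm : ∀ z : ℕ × ℕ, C (g.coeff (expo z.1 z.2)) * X 0 ^ z.1 * X 1 ^ z.2 =
      monomial (expo z.1 z.2) (g.coeff (expo z.1 z.2)) := by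
    intro z
    rw [monomial_eq, Finsupp.prod_fintype _ _ (fun _ => pow_zero _), Fin.prod_univ_two]
    simp [mul_assoc]
  simp only [hm]
  ext s
  rw [coeff_sum, Finset.sum_eq_single (s 0, s 1)]
  · simp [expo_eta]
  · intro z _ hz
    rw [coeff_monomial, if_neg]
    rintro rfl
    simp at hz
  · intro h
    rw [coeff_monomial, expo_eta, if_pos rfl]
    by_contra h0
    have := le_totalDegree_fin_two (mem_support_iff.2 h0)
    simp only [Finset.mem_product, Finset.mem_range] at h
    omega

/-- The polynomial with its two variables exchanged. -/
def swapVars : MvPolynomial (Fin 2) ℂ ≃ₐ[ℂ] MvPolynomial (Fin 2) ℂ :=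
  renameEquiv ℂ (Equiv.swap 0 1)

lemma ev2_swapVars (g : MvPolynomial (Fin 2) ℂ) (p : ℂ × ℂ) :
    ev2 (swapVars g) p = ev2 g (p.2, p.1) := by
  rw [ev2, swapVars, renameEquiv_apply, eval_rename, ev2]
  congr 2
  ext i; fin_cases i <;> simp

lemma totalDegree_swapVars (g : MvPolynomial (Fin 2) ℂ) :
    (swapVars g).totalDegree = g.totalDegree := totalDegree_renameEquiv _ g

/-- Expansion of a polynomial around a point. -/
lemma exists_shift_expansion {g : MvPolynomial (Fin 2) ℂ} (hg : g ≠ 0) {D : ℕ}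
    (hD : g.totalDegree ≤ D) (v w : ℂ) : ∃ c : ℕ × ℕ → ℂ,
      (∃ z ∈ Finset.range (D + 1) ×ˢ Finset.range (D + 1), c z ≠ 0) ∧
      ∀ x y, ev2 g (v + x, w + y) =
        ∑ z ∈ Finset.range (D + 1) ×ˢ Finset.range (D + 1), c z * x ^ z.1 * y ^ z.2 := by
  set f : MvPolynomial (Fin 2) ℂ := aeval ![C v + X 0, C w + X 1] g with hf
  have hfd : f.totalDegree ≤ D := by
    refine (totalDegree_aeval_le _ 1 (fun i => ?_) g).trans (by simpa using hD)
    fin_cases i <;> exact (totalDegree_add _ _).trans (by simp)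
  have hev : ∀ x y, ev2 g (v + x, w + y) = ∑ z ∈ Finset.range (D + 1) ×ˢ Finset.range (D + 1),
      f.coeff (expo z.1 z.2) * x ^ z.1 * y ^ z.2 := by
    intro x y
    have h1 : ev2 f (x, y) = ev2 g (v + x, w + y) := by rw [hf, ev2_aeval]; simp
    rw [← h1, eq_sum_expo hfd, ev2_sum, ← eq_sum_expo hfd]
    simp
  refine ⟨fun z => f.coeff (expo z.1 z.2), ?_, hev⟩
  by_contra! h0
  refine hg (eq_zero_of_ev2 fun p => ?_)
  have := hev (p.1 - v) (p.2 - w)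
  rw [Finset.sum_eq_zero fun z hz => by rw [h0 z hz]; ring] at this
  simpa using this

end Evaluation

section FewPairs

variable {A B : Type*}

open Classical in
/-- A relation between two finite sets with linearly many related pairs. -/
def FewPairs (c : ℕ) (Q : Finset A) (Q' : Finset B) (ρ : A → B → Prop) : Prop :=
  ((Q ×ˢ Q').filter fun z => ρ z.1 z.2).card ≤ c * (Q.card + Q'.card)

lemma FewPairs.mono {c c' : ℕ} {Q : Finset A} {Q' : Finset B} {ρ ρ' : A → B → Prop}
    (h : FewPairs c Q Q' ρ) (hc : c ≤ c') (hρ : ∀ P ∈ Q, ∀ R ∈ Q', ρ' P R → ρ P R) :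
    FewPairs c' Q Q' ρ' := by
  classical
  refine le_trans (Finset.card_le_card fun z hz => ?_) (h.trans (Nat.mul_le_mul_right _ hc))
  simp only [Finset.mem_filter, Finset.mem_product] at hz ⊢
  exact ⟨hz.1, hρ _ hz.1.1 _ hz.1.2 hz.2⟩

lemma FewPairs.or {c c' : ℕ} {Q : Finset A} {Q' : Finset B} {ρ ρ' : A → B → Prop}
    (h : FewPairs c Q Q' ρ) (h' : FewPairs c' Q Q' ρ') :
    FewPairs (c + c') Q Q' fun P R => ρ P R ∨ ρ' P R := by
  classical
  rw [FewPairs, add_mul]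
  refine le_trans (Finset.card_le_card fun z hz => ?_)
    ((Finset.card_union_le _ _).trans (add_le_add h h'))
  simp only [Finset.mem_filter, Finset.mem_union] at hz ⊢
  tauto

lemma FewPairs.exists {ι : Type*} {c : ℕ} {Q : Finset A} {Q' : Finset B} (I : Finset ι)
    {ρ : ι → A → B → Prop} (h : ∀ i ∈ I, FewPairs c Q Q' (ρ i)) :
    FewPairs (I.card * c) Q Q' fun P R => ∃ i ∈ I, ρ i P R := by
  classical
  rw [FewPairs, mul_assoc]
  refine le_trans (Finset.card_le_card fun z hz => ?_)
    (Finset.card_biUnion_le_card_mul I (fun i => (Q ×ˢ Q').filter fun z : A × B => ρ i z.1 z.2)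
      _ h)
  simp only [Finset.mem_filter, Finset.mem_biUnion] at hz ⊢
  obtain ⟨hz, i, hi, hr⟩ := hz
  exact ⟨i, hi, hz, hr⟩

lemma fewPairs_of_left {c : ℕ} {Q : Finset A} {Q' : Finset B} {ρ : A → B → Prop}
    (h : ∀ P ∈ Q, ∃ T : Finset B, T.card ≤ c ∧ ∀ R ∈ Q', ρ P R → R ∈ T) :
    FewPairs c Q Q' ρ := by
  classical
  choose! T hT hR using h
  have h1 : ((Q ×ˢ Q').filter fun z => ρ z.1 z.2) ⊆
      Q.biUnion fun P => (T P).image fun R => (P, R) := by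
    rintro ⟨P, R⟩ hz
    simp only [Finset.mem_filter, Finset.mem_product] at hz
    exact Finset.mem_biUnion.2 ⟨P, hz.1.1, Finset.mem_image.2 ⟨R, hR P hz.1.1 R hz.1.2 hz.2, rfl⟩⟩
  have h2 := (Finset.card_le_card h1).trans (Finset.card_biUnion_le_card_mul _ _ c fun P hP =>
    Finset.card_image_le.trans (hT P hP))
  rw [FewPairs]
  nlinarith

lemma FewPairs.flip {c : ℕ} {Q : Finset A} {Q' : Finset B} {ρ : B → A → Prop}
    (h : FewPairs c Q' Q ρ) : FewPairs c Q Q' fun P R => ρ R P := by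
  classical
  rw [FewPairs, add_comm Q.card]
  refine le_trans (Finset.card_le_card_of_injOn Prod.swap (fun z hz => ?_)
    (Prod.swap_injective.injOn)) h
  simp only [Finset.coe_filter, Set.mem_ofPred_eq, Finset.mem_product, Prod.fst_swap,
    Prod.snd_swap] at hz ⊢
  exact ⟨⟨hz.1.2, hz.1.1⟩, hz.2⟩

lemma fewPairs_of_right {c : ℕ} {Q : Finset A} {Q' : Finset B} {ρ : A → B → Prop}
    (h : ∀ R ∈ Q', ∃ T : Finset A, T.card ≤ c ∧ ∀ P ∈ Q, ρ P R → P ∈ T) :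
    FewPairs c Q Q' ρ :=
  (fewPairs_of_left (ρ := fun R P => ρ P R) h).flip

end FewPairs

/-- In a vanishing sum, two different terms are comparable in size. -/
lemma exists_comparable_terms {ι : Type*} [DecidableEq ι] {I : Finset ι} {t : ι → ℂ}
    (h0 : ∑ i ∈ I, t i = 0) (hne : ∃ i ∈ I, t i ≠ 0) :
    ∃ i ∈ I, ∃ j ∈ I, i ≠ j ∧ t i ≠ 0 ∧ t j ≠ 0 ∧ ‖t i‖ ≤ I.card * ‖t j‖ ∧ ‖t j‖ ≤ ‖t i‖ := by
  obtain ⟨i0, hi0, hne⟩ := hne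
  obtain ⟨i, hi, hmax⟩ := Finset.exists_max_image I (fun i => ‖t i‖) ⟨i0, hi0⟩
  have hti : 0 < ‖t i‖ := (norm_pos_iff.2 hne).trans_le (hmax i0 hi0)
  have h1 : ‖t i‖ ≤ ∑ j ∈ I.erase i, ‖t j‖ := by
    have : t i = - ∑ j ∈ I.erase i, t j := by
      rw [← Finset.add_sum_erase _ _ hi] at h0
      exact eq_neg_of_add_eq_zero_left h0
    rw [this, norm_neg]
    exact norm_sum_le _ _
  by_contra! hcon
  have hcard : 0 < (I.card : ℝ) := by exact_mod_cast Finset.card_pos.2 ⟨i, hi⟩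
  have h2 : ∀ j ∈ I.erase i, ‖t j‖ < ‖t i‖ / I.card := by
    intro j hj
    rw [lt_div_iff₀ hcard]
    by_contra! hle
    have hj' := Finset.mem_erase.1 hj
    have htj : t j ≠ 0 := by
      rintro h
      rw [h, norm_zero, zero_mul] at hle
      linarith
    exact absurd (hmax j hj'.2) (not_le.2 (hcon i hi j hj'.2 hj'.1.symm (norm_pos_iff.1 hti) htj
      (by rw [mul_comm]; exact hle)))
  have h3 : (I.erase i).Nonempty := by
    by_contra h
    rw [Finset.not_nonempty_iff_eq_empty] at h
    rw [h, Finset.sum_empty] at h1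
    linarith
  have h4 := Finset.sum_lt_sum_of_nonempty h3 h2
  rw [Finset.sum_const, nsmul_eq_mul, Finset.card_erase_of_mem hi] at h4
  have h5 : ((I.card - 1 : ℕ) : ℝ) * (‖t i‖ / I.card) ≤ I.card * (‖t i‖ / I.card) := by
    gcongr
    omega
  rw [mul_div_cancel₀ _ hcard.ne'] at h5
  linarith

lemma exists_dyadic_log {r : ℝ} (hr : 0 < r) : ∃ i : ℤ, r ≤ 2 ^ i ∧ |Real.logb 2 r - i| ≤ 1 := by
  refine ⟨⌈Real.logb 2 r⌉, ?_, ?_⟩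
  · rw [← Real.rpow_intCast, ← Real.logb_le_iff_le_rpow (by norm_num) hr]
    exact Int.le_ceil _
  · rw [abs_le]
    have := Int.le_ceil (Real.logb 2 r)
    have := Int.ceil_lt_add_one (Real.logb 2 r)
    constructor <;> linarith

/-- Comparability of two monomials, on a logarithmic scale. -/
lemma exists_strip {c c' X Y : ℝ} (hc : 0 < c) (hc' : 0 < c') (hX : 0 < X) (hY : 0 < Y)
    {a b a' b' D : ℕ} (ha : a ≤ D) (hb : b ≤ D) (ha' : a' ≤ D) (hb' : b' ≤ D) {N : ℕ}
    (h1 : c * X ^ a * Y ^ b ≤ N * (c' * X ^ a' * Y ^ b'))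
    (h2 : c' * X ^ a' * Y ^ b' ≤ c * X ^ a * Y ^ b) {i j : ℤ}
    (hi : |Real.logb 2 X - i| ≤ 1) (hj : |Real.logb 2 Y - j| ≤ 1) :
    |((a : ℤ) - a') * i + ((b : ℤ) - b') * j - ⌊Real.logb 2 (c' / c)⌋| ≤ (N + 2 * D + 1 : ℕ) := by
  have hN : 0 < (N : ℝ) := by
    by_contra! h
    have : 0 < c * X ^ a * Y ^ b := by positivity
    have : 0 < c' * X ^ a' * Y ^ b' := by positivity
    nlinarith
  set x := Real.logb 2 X
  set y := Real.logb 2 Y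
  have e1 : Real.logb 2 (c * X ^ a * Y ^ b) = Real.logb 2 c + a * x + b * y := by
    rw [Real.logb_mul (by positivity) (by positivity), Real.logb_mul (by positivity) (by positivity),
      Real.logb_pow, Real.logb_pow]
  have e2 : Real.logb 2 (c' * X ^ a' * Y ^ b') = Real.logb 2 c' + a' * x + b' * y := by
    rw [Real.logb_mul (by positivity) (by positivity), Real.logb_mul (by positivity) (by positivity),
      Real.logb_pow, Real.logb_pow]
  have l1 := Real.logb_le_logb_of_le (by norm_num : (1 : ℝ) < 2) (by positivity) h1
  have l2 := Real.logb_le_logb_of_le (by norm_num : (1 : ℝ) < 2) (by positivity) h2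
  rw [Real.logb_mul hN.ne' (by positivity)] at l1
  rw [e1, e2] at l1 l2
  have hlogN : Real.logb 2 N ≤ N := by
    rw [Real.logb_le_iff_le_rpow (by norm_num) hN, Real.rpow_natCast]
    exact_mod_cast (Nat.lt_two_pow_self).le
  have e3 : Real.logb 2 (c' / c) = Real.logb 2 c' - Real.logb 2 c :=
    Real.logb_div hc'.ne' hc.ne'
  have f1 := Int.floor_le (Real.logb 2 (c' / c))
  have f2 := Int.lt_floor_add_one (Real.logb 2 (c' / c))
  set z := ⌊Real.logb 2 (c' / c)⌋
  have hα : |((a : ℝ) - a')| ≤ D := by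
    rw [abs_le]
    have : (a : ℝ) ≤ D := by exact_mod_cast ha
    have : (a' : ℝ) ≤ D := by exact_mod_cast ha'
    have : (0 : ℝ) ≤ a := by positivity
    have : (0 : ℝ) ≤ a' := by positivity
    constructor <;> linarith
  have hβ : |((b : ℝ) - b')| ≤ D := by
    rw [abs_le]
    have : (b : ℝ) ≤ D := by exact_mod_cast hb
    have : (b' : ℝ) ≤ D := by exact_mod_cast hb'
    have : (0 : ℝ) ≤ b := by positivity
    have : (0 : ℝ) ≤ b' := by positivity
    constructor <;> linarith
  have g1 : |((a : ℝ) - a') * (x - i)| ≤ D := by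
    rw [abs_mul]
    calc _ ≤ (D : ℝ) * 1 := mul_le_mul hα hi (abs_nonneg _) (by positivity)
      _ = D := mul_one _
  have g2 : |((b : ℝ) - b') * (y - j)| ≤ D := by
    rw [abs_mul]
    calc _ ≤ (D : ℝ) * 1 := mul_le_mul hβ hj (abs_nonneg _) (by positivity)
      _ = D := mul_one _
  rw [abs_le] at g1 g2
  have : |((a : ℝ) - a') * i + ((b : ℝ) - b') * j - z| ≤ N + 2 * D + 1 := by
    rw [abs_le]
    constructor <;> nlinarith
  exact_mod_cast this

/-- `P` is a cell, from level `i - K` on, of a point at distance at most `2 ^ i` from `v`. -/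
def CellNear (Q : Finset (ℤ × ℤ × ℤ)) (K : ℕ) (v : ℂ) (i : ℤ) (P : ℤ × ℤ × ℤ) : Prop :=
  ∃ x, ‖x - v‖ ≤ 2 ^ i ∧ IsCellFrom Q (i - K) P x

lemma CellNear.le {Q : Finset (ℤ × ℤ × ℤ)} {K : ℕ} {v : ℂ} {i : ℤ} {P : ℤ × ℤ × ℤ}
    (h : CellNear Q K v i P) : i ≤ P.1 + K := by
  obtain ⟨x, _, h⟩ := h
  have := h.2.2.1
  omega

lemma CellNear.up {Q : Finset (ℤ × ℤ × ℤ)} {K : ℕ} {v : ℂ} {i j : ℤ} {P : ℤ × ℤ × ℤ}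
    (h : CellNear Q K v i P) (hij : i ≤ j) (hj : j ≤ P.1 + K) : CellNear Q K v j P := by
  obtain ⟨x, hx, h⟩ := h
  exact ⟨x, hx.trans (zpow_le_zpow_right₀ (by norm_num) hij), h.mono (by omega) (by omega)⟩

lemma exists_finset_cellNear (Q : Finset (ℤ × ℤ × ℤ)) (K : ℕ) (v : ℂ) (i : ℤ) :
    ∃ T : Finset (ℤ × ℤ × ℤ), T.card ≤ (2 * 2 ^ K + 3) ^ 2 ∧ ∀ P, CellNear Q K v i P → P ∈ T := by
  obtain ⟨T, hT, h⟩ := exists_finset_isCellFrom Q (i - K) v (2 ^ K)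
  refine ⟨T, hT, fun P ⟨x, hx, hc⟩ => h P x hc (hx.trans_eq ?_)⟩
  push_cast
  rw [← zpow_natCast, ← zpow_add₀ (by norm_num)]
  congr 1
  ring

lemma cellNear_of_isCell {Q : Finset (ℤ × ℤ × ℤ)} {K : ℕ} {v x : ℂ} {P : ℤ × ℤ × ℤ}
    (hP : IsCell Q P x) (hx : ‖x - v‖ ≤ 2 ^ K * 2 ^ P.1) (hne : x ≠ v) :
    ∃ i : ℤ, |Real.logb 2 ‖x - v‖ - i| ≤ 1 ∧ CellNear Q (K + 1) v i P := by
  have hpos : 0 < ‖x - v‖ := norm_pos_iff.2 (sub_ne_zero.2 hne)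
  obtain ⟨i, hi, hlog⟩ := exists_dyadic_log hpos
  refine ⟨i, hlog, x, hi, hP.isCellFrom ?_⟩
  have h1 : Real.logb 2 ‖x - v‖ ≤ K + P.1 := by
    rw [Real.logb_le_iff_le_rpow (by norm_num) hpos]
    refine hx.trans_eq ?_
    rw [Real.rpow_add (by norm_num), Real.rpow_natCast, Real.rpow_intCast]
  rw [abs_le] at hlog
  have : (i : ℝ) ≤ K + P.1 + 1 := by linarith
  have : i ≤ K + P.1 + 1 := by exact_mod_cast this
  push_cast
  omega

/-- Few pairs of cells on the curve are large compared with the distance to a fixed point. -/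
theorem fewPairs_near_point (D K : ℕ) : ∃ c : ℕ, ∀ (g : MvPolynomial (Fin 2) ℂ), g ≠ 0 →
    g.totalDegree ≤ D → ∀ (v w : ℂ) (Q Q' : Finset (ℤ × ℤ × ℤ)),
    FewPairs c Q Q' fun P R => ∃ x y, IsCell Q P x ∧ IsCell Q' R y ∧ ev2 g (x, y) = 0 ∧
      ‖x - v‖ ≤ 2 ^ K * 2 ^ P.1 ∧ ‖y - w‖ ≤ 2 ^ K * 2 ^ R.1 := by
  classical
  set I := Finset.range (D + 1) ×ˢ Finset.range (D + 1)
  set κ := I.card + 2 * D + 1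
  set M := (2 * 2 ^ (K + 1) + 3) ^ 2
  refine ⟨1 + 1 + (I ×ˢ I).card * ((2 * D + 1) * ((2 * κ + 1) * M)), fun g hg hD v w Q Q' => ?_⟩
  obtain ⟨c, hc, hexp⟩ := exists_shift_expansion hg hD v w
  have hv : FewPairs 1 Q Q' fun P _ => IsCell Q P v := by
    refine fewPairs_of_right fun R _ => ⟨Q.filter fun P => IsCell Q P v, ?_, fun P hP h =>
      Finset.mem_filter.2 ⟨hP, h⟩⟩
    exact Finset.card_le_one.2 fun P hP P' hP' =>
      (Finset.mem_filter.1 hP).2.eq (Finset.mem_filter.1 hP').2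
  have hw : FewPairs 1 Q Q' fun _ R => IsCell Q' R w := by
    refine fewPairs_of_left fun R _ => ⟨Q'.filter fun P => IsCell Q' P w, ?_, fun P hP h =>
      Finset.mem_filter.2 ⟨hP, h⟩⟩
    exact Finset.card_le_one.2 fun P hP P' hP' =>
      (Finset.mem_filter.1 hP).2.eq (Finset.mem_filter.1 hP').2
  choose T hT hTm using exists_finset_cellNear Q (K + 1) v
  choose T' hT' hTm' using exists_finset_cellNear Q' (K + 1) w
  have hs : ∀ u ∈ I ×ˢ I, FewPairs ((2 * D + 1) * ((2 * κ + 1) * M)) Q Q' fun P R =>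
      u.1 ≠ u.2 ∧ ∃ i j, CellNear Q (K + 1) v i P ∧ CellNear Q' (K + 1) w j R ∧
        |((u.1.1 : ℤ) - u.2.1) * i + ((u.1.2 : ℤ) - u.2.2) * j -
          ⌊Real.logb 2 (‖c u.2‖ / ‖c u.1‖)⌋| ≤ κ := by
    rintro ⟨⟨a, b⟩, ⟨a', b'⟩⟩ hu
    simp only [I, Finset.mem_product, Finset.mem_range] at hu
    by_cases hne : (a, b) = (a', b')
    · simp [FewPairs, hne]
    · simp only [ne_eq, hne, not_false_eq_true, true_and]
      refine card_strip_le Q Q' _ _ (fun P => P.1 + (K + 1 : ℕ)) (fun P => P.1 + (K + 1 : ℕ))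
        (fun i P h => h.le) (fun i P h => h.le) (fun i j P h => h.up) (fun i j P h => h.up) T T' M
        hT hT' hTm hTm' _ _ _ D κ ?_ ?_ ?_
      · rw [abs_le]; omega
      · rw [abs_le]; omega
      · rw [Prod.ext_iff] at hne
        simp only at hne
        omega
  refine ((hv.or hw).or (FewPairs.exists _ hs)).mono le_rfl ?_
  rintro P - R - ⟨x, y, hP, hR, h0, hx, hy⟩
  by_cases hxv : x = v
  · exact Or.inl (Or.inl (hxv ▸ hP))
  by_cases hyw : y = w
  · exact Or.inl (Or.inr (hyw ▸ hR))
  refine Or.inr ?_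
  obtain ⟨i, hi, hiP⟩ := cellNear_of_isCell hP hx hxv
  obtain ⟨j, hj, hjR⟩ := cellNear_of_isCell hR hy hyw
  have hX : 0 < ‖x - v‖ := norm_pos_iff.2 (sub_ne_zero.2 hxv)
  have hY : 0 < ‖y - w‖ := norm_pos_iff.2 (sub_ne_zero.2 hyw)
  have hsum := hexp (x - v) (y - w)
  rw [add_sub_cancel, add_sub_cancel, h0] at hsum
  obtain ⟨z0, hz0, hcz0⟩ := hc
  obtain ⟨z, hz, z', hz', hzz, h1, h2, h3, h4⟩ := exists_comparable_terms hsum.symm ⟨z0, hz0,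
    mul_ne_zero (mul_ne_zero hcz0 (pow_ne_zero _ (sub_ne_zero.2 hxv)))
      (pow_ne_zero _ (sub_ne_zero.2 hyw))⟩
  have hcz : 0 < ‖c z‖ := norm_pos_iff.2 (left_ne_zero_of_mul (left_ne_zero_of_mul h1))
  have hcz' : 0 < ‖c z'‖ := norm_pos_iff.2 (left_ne_zero_of_mul (left_ne_zero_of_mul h2))
  simp only [norm_mul, norm_pow] at h3 h4
  refine ⟨(z, z'), Finset.mem_product.2 ⟨hz, hz'⟩, hzz, i, j, hiP, hjR, ?_⟩
  simp only [Finset.mem_product, Finset.mem_range, Nat.lt_succ_iff] at hz hz'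
  exact exists_strip hcz hcz' hX hY hz.1 hz.2 hz'.1 hz'.2 h3 h4 hi hj

section Walk

open Filter Topology

lemma hasStrictFDerivAt_ev2 (F : MvPolynomial (Fin 2) ℂ) (p : ℂ × ℂ) :
    HasStrictFDerivAt (ev2 F) (ev2 (pderiv 0 F) p • ContinuousLinearMap.fst ℂ ℂ ℂ +
      ev2 (pderiv 1 F) p • ContinuousLinearMap.snd ℂ ℂ ℂ) p := by
  induction F using MvPolynomial.induction_on with
  | C a =>
    have h : ev2 (C a) = Function.const _ a := by
      funext q
      rw [ev2_C, Function.const_apply]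
    rw [h, pderiv_C, pderiv_C, ev2_zero]
    refine (hasStrictFDerivAt_const a p).congr_fderiv ?_
    module
  | add f g hf hg =>
    have h : ev2 (f + g) = ev2 f + ev2 g := by
      funext q
      rw [ev2_add, Pi.add_apply]
    rw [h, map_add, map_add, ev2_add, ev2_add]
    refine (hf.add hg).congr_fderiv ?_
    module
  | mul_X f i hf =>
    have h : ev2 (f * X i) = ev2 f * ev2 (X i) := by
      funext q
      rw [ev2_mul, Pi.mul_apply]
    rw [h]
    fin_cases i
    · have h1 : HasStrictFDerivAt (ev2 (X 0)) (ContinuousLinearMap.fst ℂ ℂ ℂ) p := by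
        have : ev2 (X 0) = Prod.fst := funext ev2_X_zero
        rw [this]; exact hasStrictFDerivAt_fst
      refine (hf.mul h1).congr_fderiv ?_
      simp only [Fin.zero_eta, Derivation.leibniz, pderiv_X_self, smul_eq_mul, mul_one,
        pderiv_X_of_ne (show (0 : Fin 2) ≠ 1 by decide), mul_zero, ev2_add, ev2_mul, zero_add]
      module
    · have h1 : HasStrictFDerivAt (ev2 (X 1)) (ContinuousLinearMap.snd ℂ ℂ ℂ) p := by
        have : ev2 (X 1) = Prod.snd := funext ev2_X_one
        rw [this]; exact hasStrictFDerivAt_snd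
      refine (hf.mul h1).congr_fderiv ?_
      simp only [Fin.mk_one, Derivation.leibniz, pderiv_X_self, smul_eq_mul, mul_one,
        pderiv_X_of_ne (show (1 : Fin 2) ≠ 0 by decide), mul_zero, ev2_add, ev2_mul, zero_add]
      module

lemma continuous_ev2 (F : MvPolynomial (Fin 2) ℂ) : Continuous (ev2 F) :=
  continuous_iff_continuousAt.2 fun p => (hasStrictFDerivAt_ev2 F p).continuousAt

lemma exists_local_branch {F : MvPolynomial (Fin 2) ℂ} {u v : ℂ} (h0 : ev2 F (u, v) = 0)
    (h2 : ev2 (pderiv 1 F) (u, v) ≠ 0) : ∃ (φ : ℂ → ℂ) (m : ℂ), φ u = v ∧ HasDerivAt φ m u ∧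
      (∀ᶠ x in 𝓝 u, ev2 F (x, φ x) = 0) ∧
      ev2 (pderiv 0 F) (u, v) + m * ev2 (pderiv 1 F) (u, v) = 0 := by
  have hF := hasStrictFDerivAt_ev2 F (u, v)
  set F' := ev2 (pderiv 0 F) (u, v) • ContinuousLinearMap.fst ℂ ℂ ℂ +
      ev2 (pderiv 1 F) (u, v) • ContinuousLinearMap.snd ℂ ℂ ℂ with hF'
  have hinv : (F' ∘L .inr ℂ ℂ ℂ).IsInvertible := by
    refine ⟨ContinuousLinearEquiv.unitsEquivAut ℂ (Units.mk0 _ h2), ?_⟩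
    ext
    simp [hF']
  set φ := hF.implicitFunctionOfProdDomain hinv
  have h1 : ∀ᶠ x in 𝓝 u, ev2 F (x, φ x) = 0 := by
    have := hF.eventually_apply_implicitFunctionOfProdDomain hinv
    rwa [h0] at this
  have h3 : φ u = v :=
    (hF.eventually_apply_eq_iff_implicitFunctionOfProdDomain hinv).self_of_nhds.mp rfl
  have h4 : HasDerivAt φ _ u :=
    (hF.hasStrictFDerivAt_implicitFunctionOfProdDomain hinv).hasFDerivAt.hasDerivAt
  set m := (-(F' ∘L .inr ℂ ℂ ℂ).inverse ∘L (F' ∘L .inl ℂ ℂ ℂ)) 1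
  refine ⟨φ, m, h3, h4, h1, ?_⟩
  have h5 : HasDerivAt (fun x => ev2 F (x, φ x)) (F' (1, m)) u := by
    have h6 : HasFDerivAt (ev2 F) F' (u, φ u) := by rw [h3]; exact hF.hasFDerivAt
    exact h6.comp_hasDerivAt (f := fun x => (x, φ x)) u ((hasDerivAt_id u).prodMk h4)
  have h7 : HasDerivAt (fun x => ev2 F (x, φ x)) 0 u :=
    (hasDerivAt_const u (0 : ℂ)).congr_of_eventuallyEq h1
  have := h5.unique h7
  simp only [hF', add_apply, smul_apply,
    ContinuousLinearMap.coe_fst', ContinuousLinearMap.coe_snd', smul_eq_mul, mul_one] at this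
  rw [← this]; ring

/-- Continuation of a root along a segment, as long as the slopes of the curve near `m₀` stay in
an isolated cluster. -/
theorem exists_continuation (F : MvPolynomial (Fin 2) ℂ) {u₀ v₀ m₀ h : ℂ} {θ θ' : ℝ}
    (hm₀ : m₀ ≠ 0) (hθ' : 0 ≤ θ') (hθ : θ' < θ) (h0 : ev2 F (u₀, v₀) = 0)
    (hslope : ev2 (pderiv 0 F) (u₀, v₀) + m₀ * ev2 (pderiv 1 F) (u₀, v₀) = 0)
    (hgap : ∀ τ : ℝ, 0 ≤ τ → τ ≤ 1 → ∀ v, ev2 F (u₀ + τ * h, v) = 0 →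
      ‖v - v₀ - m₀ * (τ * h)‖ ≤ θ * (τ * ‖m₀ * h‖) →
      ‖ev2 (pderiv 0 F) (u₀ + τ * h, v) + m₀ * ev2 (pderiv 1 F) (u₀ + τ * h, v)‖ ≤
        θ * (‖m₀‖ * ‖ev2 (pderiv 1 F) (u₀ + τ * h, v)‖) →
      ev2 (pderiv 1 F) (u₀ + τ * h, v) ≠ 0 ∧
      ‖ev2 (pderiv 0 F) (u₀ + τ * h, v) + m₀ * ev2 (pderiv 1 F) (u₀ + τ * h, v)‖ ≤
        θ' * (‖m₀‖ * ‖ev2 (pderiv 1 F) (u₀ + τ * h, v)‖)) :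
    ∃ v, ev2 F (u₀ + h, v) = 0 ∧ ‖v - v₀ - m₀ * h‖ ≤ θ * ‖m₀ * h‖ ∧
      ‖ev2 (pderiv 0 F) (u₀ + h, v) + m₀ * ev2 (pderiv 1 F) (u₀ + h, v)‖ ≤
        θ * (‖m₀‖ * ‖ev2 (pderiv 1 F) (u₀ + h, v)‖) ∧ ev2 (pderiv 1 F) (u₀ + h, v) ≠ 0 := by
  set F₁ := ev2 (pderiv 0 F) with hF₁
  set F₂ := ev2 (pderiv 1 F) with hF₂
  have c0 : Continuous (ev2 F) := continuous_ev2 F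
  have c1 : Continuous F₁ := continuous_ev2 _
  have c2 : Continuous F₂ := continuous_ev2 _
  have hm : 0 < ‖m₀‖ := norm_pos_iff.2 hm₀
  have hθ0 : 0 ≤ θ := hθ'.trans hθ.le
  set T : Set ℝ := {τ | ∃ v, ev2 F (u₀ + τ * h, v) = 0 ∧
    ‖v - v₀ - m₀ * (τ * h)‖ ≤ θ * (τ * ‖m₀ * h‖) ∧
    ‖F₁ (u₀ + τ * h, v) + m₀ * F₂ (u₀ + τ * h, v)‖ ≤ θ' * (‖m₀‖ * ‖F₂ (u₀ + τ * h, v)‖)} with hT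
  have hcl : IsClosed (T ∩ Set.Icc 0 1) := by
    set Z : Set (ℝ × ℂ) := (Set.Icc (0 : ℝ) 1 ×ˢ Metric.closedBall v₀ ((1 + θ) * ‖m₀ * h‖)) ∩
      {z | ev2 F (u₀ + z.1 * h, z.2) = 0 ∧
        ‖z.2 - v₀ - m₀ * (z.1 * h)‖ ≤ θ * (z.1 * ‖m₀ * h‖) ∧
        ‖F₁ (u₀ + z.1 * h, z.2) + m₀ * F₂ (u₀ + z.1 * h, z.2)‖ ≤
          θ' * (‖m₀‖ * ‖F₂ (u₀ + z.1 * h, z.2)‖)} with hZ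
    have hZc : IsCompact Z := by
      refine (isCompact_Icc.prod (isCompact_closedBall _ _)).inter_right ?_
      have d1 : IsClosed {z : ℝ × ℂ | ev2 F (u₀ + z.1 * h, z.2) = 0} :=
        isClosed_eq (by fun_prop) (by fun_prop)
      have d2 : IsClosed {z : ℝ × ℂ | ‖z.2 - v₀ - m₀ * (z.1 * h)‖ ≤ θ * (z.1 * ‖m₀ * h‖)} :=
        isClosed_le (by fun_prop) (by fun_prop)
      have d3 : IsClosed {z : ℝ × ℂ | ‖F₁ (u₀ + z.1 * h, z.2) + m₀ * F₂ (u₀ + z.1 * h, z.2)‖ ≤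
          θ' * (‖m₀‖ * ‖F₂ (u₀ + z.1 * h, z.2)‖)} :=
        isClosed_le (by fun_prop) (by fun_prop)
      exact d1.inter (d2.inter d3)
    have hTZ : T ∩ Set.Icc 0 1 = Prod.fst '' Z := by
      ext τ
      constructor
      · rintro ⟨⟨v, h1, h2, h3⟩, hτ⟩
        refine ⟨(τ, v), ⟨⟨hτ, ?_⟩, h1, h2, h3⟩, rfl⟩
        rw [Metric.mem_closedBall, dist_eq_norm]
        have e : v - v₀ = (v - v₀ - m₀ * (τ * h)) + τ * (m₀ * h) := by ring
        have e2 : ‖(τ : ℂ) * (m₀ * h)‖ = τ * ‖m₀ * h‖ := by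
          rw [norm_mul, Complex.norm_real, Real.norm_of_nonneg hτ.1]
        have h4 : τ * ‖m₀ * h‖ ≤ ‖m₀ * h‖ := mul_le_of_le_one_left (norm_nonneg _) hτ.2
        calc ‖v - v₀‖ ≤ θ * (τ * ‖m₀ * h‖) + τ * ‖m₀ * h‖ := by
              rw [e]; exact (norm_add_le _ _).trans (by rw [e2]; linarith)
          _ ≤ θ * ‖m₀ * h‖ + ‖m₀ * h‖ := by gcongr
          _ = _ := by ring
      · rintro ⟨⟨τ, v⟩, ⟨⟨hτ, -⟩, h1, h2, h3⟩, rfl⟩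
        exact ⟨⟨v, h1, h2, h3⟩, hτ⟩
    rw [hTZ]
    exact (hZc.image continuous_fst).isClosed
  have hz : (0 : ℝ) ∈ T := by
    refine ⟨v₀, by simpa using h0, by simp, ?_⟩
    simp only [Complex.ofReal_zero, zero_mul, add_zero]
    rw [hslope, norm_zero]
    positivity
  have hone : (1 : ℝ) ∈ T := by
    refine hcl.Icc_subset_of_forall_exists_gt hz ?_ (Set.right_mem_Icc.2 zero_le_one)
    rintro τ ⟨⟨v, h1, h2, h3⟩, hτ0, hτ1⟩ y hy
    obtain ⟨hF2, -⟩ := hgap τ hτ0 hτ1.le v h1 h2 (h3.trans (by gcongr))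
    obtain ⟨φ, m, hφ, hd, hroot, hm1⟩ := exists_local_branch h1 hF2
    have hF2n : 0 < ‖F₂ (u₀ + τ * h, v)‖ := norm_pos_iff.2 hF2
    have hmm : ‖m - m₀‖ ≤ θ' * ‖m₀‖ := by
      have e : F₁ (u₀ + τ * h, v) + m₀ * F₂ (u₀ + τ * h, v) =
          -((m - m₀) * F₂ (u₀ + τ * h, v)) := by linear_combination hm1
      rw [e, norm_neg, norm_mul, ← mul_assoc] at h3
      exact le_of_mul_le_mul_right h3 hF2n
    have hcont : Tendsto (fun σ : ℝ => u₀ + σ * h) (𝓝[>] τ) (𝓝 (u₀ + τ * h)) := by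
      have : Continuous fun σ : ℝ => u₀ + σ * h := by fun_prop
      exact this.continuousAt.tendsto.mono_left nhdsWithin_le_nhds
    have hlo := (hasDerivAt_iff_isLittleO.1 hd).def
      (show 0 < (θ - θ') * ‖m₀‖ from mul_pos (by linarith) hm)
    have hpair : Tendsto (fun x => (x, φ x)) (𝓝 (u₀ + τ * h)) (𝓝 (u₀ + τ * h, v)) := by
      have := (continuousAt_id.prodMk hd.continuousAt : ContinuousAt (fun x => (id x, φ x)) _)
      simpa [ContinuousAt, hφ] using this
    have hstrict : ∀ᶠ x in 𝓝 (u₀ + τ * h), ‖F₁ (x, φ x) + m₀ * F₂ (x, φ x)‖ <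
        θ * (‖m₀‖ * ‖F₂ (x, φ x)‖) := by
      have hlt : ‖F₁ (u₀ + τ * h, v) + m₀ * F₂ (u₀ + τ * h, v)‖ <
          θ * (‖m₀‖ * ‖F₂ (u₀ + τ * h, v)‖) :=
        h3.trans_lt (mul_lt_mul_of_pos_right hθ (mul_pos hm hF2n))
      have ho : IsOpen {p : ℂ × ℂ | ‖F₁ p + m₀ * F₂ p‖ < θ * (‖m₀‖ * ‖F₂ p‖)} :=
        isOpen_lt (by fun_prop) (by fun_prop)
      exact hpair (ho.mem_nhds hlt)
    have hτy : τ < min y 1 := lt_min hy hτ1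
    have hev : ∀ᶠ σ : ℝ in 𝓝[>] τ, σ ∈ Set.Ioc τ (min y 1) :=
      Ioc_mem_nhdsGT hτy
    obtain ⟨σ, hσ, e1, e2, e3⟩ := (hev.and ((hcont.eventually hroot).and
      ((hcont.eventually hlo).and (hcont.eventually hstrict)))).exists
    have hσ0 : 0 ≤ σ := hτ0.trans hσ.1.le
    have hσ1 : σ ≤ 1 := hσ.2.trans (min_le_right _ _)
    have e4 : ‖φ (u₀ + σ * h) - v₀ - m₀ * (σ * h)‖ ≤ θ * (σ * ‖m₀ * h‖) := by
      rw [hφ] at e2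
      have n1 : ‖(u₀ + σ * h) - (u₀ + τ * h)‖ = (σ - τ) * ‖h‖ := by
        rw [show (u₀ + σ * h) - (u₀ + τ * h) = ((σ - τ : ℝ) : ℂ) * h by push_cast; ring, norm_mul,
          Complex.norm_real, Real.norm_of_nonneg (by linarith [hσ.1])]
      rw [n1, smul_eq_mul] at e2
      have n2 : ‖((u₀ + σ * h) - (u₀ + τ * h)) * (m - m₀)‖ ≤ (σ - τ) * ‖h‖ * (θ' * ‖m₀‖) := by
        rw [norm_mul, n1]
        exact mul_le_mul_of_nonneg_left hmm (mul_nonneg (by linarith [hσ.1]) (norm_nonneg _))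
      have e : φ (u₀ + σ * h) - v₀ - m₀ * (σ * h) =
          (φ (u₀ + σ * h) - v - ((u₀ + σ * h) - (u₀ + τ * h)) * m) +
          (v - v₀ - m₀ * (τ * h)) + ((u₀ + σ * h) - (u₀ + τ * h)) * (m - m₀) := by ring
      rw [e]
      refine (norm_add₃_le).trans ((add_le_add_three e2 h2 n2).trans_eq ?_)
      rw [norm_mul]; ring
    exact ⟨σ, ⟨_, e1, e4, (hgap σ hσ0 hσ1 _ e1 e4 e3.le).2⟩, hσ.1, hσ.2.trans (min_le_left _ _)⟩
  obtain ⟨v, h1, h2, h3⟩ := hone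
  obtain ⟨h4, -⟩ := hgap 1 zero_le_one le_rfl v h1 h2 (h3.trans (by gcongr))
  simp only [Complex.ofReal_one, one_mul] at h1 h2 h3 h4
  exact ⟨v, h1, h2, h3.trans (by gcongr), h4⟩

end Walk

section Hilbert

lemma restrictTotalDegree_exponents (N : ℕ) :
    {s : Fin 2 →₀ ℕ | (s.sum fun _ e => e) ≤ N} =
      ↑(((Finset.range (N + 1)).sigma fun k => Finset.range (k + 1)).image
        fun z => expo z.2 (z.1 - z.2)) := by
  ext s
  simp only [Set.mem_ofPred_eq, Finset.coe_image, Set.mem_image, Finset.mem_coe, Finset.mem_sigma,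
    Finset.mem_range, Sigma.exists]
  rw [Finsupp.sum_fintype _ _ (fun _ => rfl), Fin.sum_univ_two]
  constructor
  · intro h
    refine ⟨s 0 + s 1, s 0, ⟨by omega, by omega⟩, ?_⟩
    rw [Nat.add_sub_cancel_left, expo_eta]
  · rintro ⟨k, i, ⟨h1, h2⟩, rfl⟩
    simp only [expo_zero, expo_one]
    omega

instance (N : ℕ) : FiniteDimensional ℂ (restrictTotalDegree (Fin 2) ℂ N) := by
  have : Finite {s : Fin 2 →₀ ℕ | (s.sum fun _ e => e) ≤ N} := by
    rw [restrictTotalDegree_exponents]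
    exact Finset.finite_toSet _
  exact Module.Finite.of_basis (basisRestrictSupport ℂ {s : Fin 2 →₀ ℕ | (s.sum fun _ e => e) ≤ N})

lemma finrank_restrictTotalDegree (N : ℕ) :
    2 * Module.finrank ℂ (restrictTotalDegree (Fin 2) ℂ N) = (N + 1) * (N + 2) := by
  have h1 : Module.finrank ℂ (restrictTotalDegree (Fin 2) ℂ N) =
      ∑ k ∈ Finset.range (N + 1), (k + 1) := by
    rw [restrictTotalDegree, Module.finrank_eq_nat_card_basis (basisRestrictSupport ℂ _),
      restrictTotalDegree_exponents, Nat.card_coe_set_eq, Set.ncard_coe_finset,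
      Finset.card_image_of_injOn, Finset.card_sigma]
    · simp
    · rintro ⟨k, i⟩ h ⟨l, j⟩ h' e
      simp only [Finset.coe_sigma, Set.mem_sigma_iff, Finset.mem_coe, Finset.mem_range] at h h'
      have e0 := DFunLike.congr_fun e 0
      have e1 := DFunLike.congr_fun e 1
      simp only [expo_zero, expo_one] at e0 e1
      have : k = l := by omega
      subst this e0
      rfl
  rw [h1]
  clear h1
  induction N with
  | zero => simp
  | succ n ih =>
    rw [Finset.sum_range_succ, mul_add, ih]
    ring

/-- Many polynomials of bounded degree are linearly dependent modulo a given polynomial. -/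
lemma exists_combination_dvd {ι : Type*} [Fintype ι] {G : MvPolynomial (Fin 2) ℂ} (hG : G ≠ 0)
    {D N : ℕ} (hD : G.totalDegree ≤ D) (f : ι → MvPolynomial (Fin 2) ℂ)
    (hf : ∀ i, (f i).totalDegree ≤ N) (hcard : D * (N + D + 2) < Fintype.card ι) :
    ∃ c : ι → ℂ, c ≠ 0 ∧ G ∣ ∑ i, c i • f i := by
  set e := G.totalDegree with he
  let V := restrictTotalDegree (Fin 2) ℂ N
  let W := restrictTotalDegree (Fin 2) ℂ (N + e)
  let Φ : (ι → ℂ) × V →ₗ[ℂ] W :=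
    LinearMap.codRestrict W
      ((Fintype.linearCombination ℂ f).coprod ((LinearMap.mulLeft ℂ G).comp V.subtype)) (by
      rintro ⟨c, u⟩
      have hu := (mem_restrictTotalDegree (Fin 2) N _).1 u.2
      rw [LinearMap.coprod_apply, Fintype.linearCombination_apply]
      refine Submodule.add_mem _ (Submodule.sum_mem _ fun i _ => Submodule.smul_mem _ _ ?_) ?_
      · rw [mem_restrictTotalDegree]
        exact (hf i).trans (by omega)
      · rw [mem_restrictTotalDegree]
        simp only [LinearMap.comp_apply, LinearMap.mulLeft_apply, Submodule.subtype_apply]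
        exact (totalDegree_mul _ _).trans (by omega))
  have hker : LinearMap.ker Φ ≠ ⊥ := by
    apply LinearMap.ker_ne_bot_of_finrank_lt
    rw [Module.finrank_prod, Module.finrank_fintype_fun_eq_card]
    have h1 := finrank_restrictTotalDegree N
    have h2 := finrank_restrictTotalDegree (N + e)
    nlinarith
  obtain ⟨⟨c, u⟩, hx, hne⟩ := (Submodule.ne_bot_iff _).1 hker
  have hx' : ∑ i, c i • f i + G * u = 0 := by
    have := congrArg Subtype.val (LinearMap.mem_ker.1 hx)
    simpa [Φ, Fintype.linearCombination_apply] using this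
  refine ⟨c, ?_, ⟨-u, by linear_combination hx'⟩⟩
  rintro rfl
  simp only [Pi.zero_apply, zero_smul, Finset.sum_const_zero, zero_add, mul_eq_zero, hG,
    false_or] at hx'
  apply hne
  ext1
  · rfl
  · exact Subtype.ext hx'

lemma totalDegree_aeval_polynomial_le (c : Polynomial ℂ) (A : MvPolynomial (Fin 2) ℂ) {I e : ℕ}
    (hc : c.natDegree ≤ I) (hA : A.totalDegree ≤ e) :
    (Polynomial.aeval A c).totalDegree ≤ I * e := by
  rw [Polynomial.aeval_eq_sum_range]
  refine totalDegree_finsetSum_le fun i hi => ?_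
  refine (totalDegree_smul_le _ _).trans ((totalDegree_pow _ _).trans ?_)
  exact Nat.mul_le_mul ((Nat.lt_succ_iff.1 (Finset.mem_range.1 hi)).trans hc) hA

lemma ev2_aeval_polynomial (c : Polynomial ℂ) (A : MvPolynomial (Fin 2) ℂ) (p : ℂ × ℂ) :
    ev2 (Polynomial.aeval A c) p = c.eval (ev2 A p) := by
  rw [Polynomial.aeval_eq_sum_range, ev2_sum, Polynomial.eval_eq_sum_range]
  refine Finset.sum_congr rfl fun i _ => ?_
  rw [smul_eq_C_mul, ev2_mul, ev2_C, ev2_pow]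

/-- On a plane curve, a polynomial `A` and a fraction `P / Q` are algebraically dependent, with a
relation of bounded degree. -/
lemma exists_algebraic_relation {G A P Q : MvPolynomial (Fin 2) ℂ} (hG : G ≠ 0)
    {D e : ℕ} (hD : G.totalDegree ≤ D) (hA : A.totalDegree ≤ e) (hP : P.totalDegree ≤ e)
    (hQ : Q.totalDegree ≤ e) :
    ∃ c : ℕ → Polynomial ℂ, (∃ j ≤ D * e, c j ≠ 0) ∧
      (∀ j, (c j).natDegree ≤ (D * (e + D) + D) ^ 2) ∧
      G ∣ ∑ j ∈ Finset.range (D * e + 1),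
        Polynomial.aeval A (c j) * P ^ j * Q ^ (D * e - j) := by
  set M := D * e with hM
  set I := (D * (e + D) + D) ^ 2 with hI
  obtain ⟨a, ha, hdvd⟩ := exists_combination_dvd (ι := Fin (I + 1) × Fin (M + 1)) hG hD
    (fun z => A ^ (z.1 : ℕ) * P ^ (z.2 : ℕ) * Q ^ (M - z.2)) (N := I * e + M * e) (by
      rintro ⟨i, j⟩
      have hi : (i : ℕ) ≤ I := Nat.lt_succ_iff.1 i.2
      have hj : (j : ℕ) ≤ M := Nat.lt_succ_iff.1 j.2
      refine (totalDegree_mul _ _).trans ((add_le_add_left (totalDegree_mul _ _) _).trans ?_)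
      have h1 : (A ^ (i : ℕ)).totalDegree ≤ I * e :=
        (totalDegree_pow _ _).trans (Nat.mul_le_mul hi hA)
      have h2 : (P ^ (j : ℕ)).totalDegree ≤ j * e :=
        (totalDegree_pow _ _).trans (Nat.mul_le_mul_left _ hP)
      have h3 : (Q ^ (M - j)).totalDegree ≤ (M - j) * e :=
        (totalDegree_pow _ _).trans (Nat.mul_le_mul_left _ hQ)
      have h4 : (j : ℕ) * e + (M - j) * e = M * e := by
        rw [← add_mul, Nat.add_sub_cancel' hj]
      dsimp only
      omega) (by
      simp only [Fintype.card_prod, Fintype.card_fin]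
      have h1 : D * (I * e + M * e + D + 2) = I * M + M * M + D * D + 2 * D := by
        rw [hM]; ring
      have h2 : (I + 1) * (M + 1) = I * M + I + M + 1 := by ring
      have h3 : I = (M + D * D + D) ^ 2 := by rw [hI, hM]; ring
      rw [h1, h2]
      rcases Nat.eq_zero_or_pos D with rfl | hD0
      · simp at hM ⊢
        simp [hM]
      · nlinarith [Nat.zero_le (M * D), Nat.zero_le (M * D * D), Nat.zero_le (D * D * D * D),
          Nat.mul_le_mul hD0 hD0])
  refine ⟨fun j => if h : j < M + 1 then
    ∑ i : Fin (I + 1), Polynomial.monomial i (a (i, ⟨j, h⟩)) else 0, ?_, ?_, ?_⟩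
  · obtain ⟨⟨i, j⟩, hij⟩ := Function.ne_iff.1 ha
    refine ⟨j, Nat.lt_succ_iff.1 j.2, fun h0 => hij ?_⟩
    dsimp only at h0
    rw [dif_pos j.2] at h0
    have := congrArg (fun q => Polynomial.coeff q i) h0
    simpa [Polynomial.finsetSum_coeff, Polynomial.coeff_monomial, Fin.val_inj] using this
  · intro j
    dsimp only
    split_ifs
    · refine Polynomial.natDegree_sum_le_of_forall_le _ _ fun i _ => ?_
      exact (Polynomial.natDegree_monomial_le _).trans (Nat.lt_succ_iff.1 i.2)
    · simp
  · convert hdvd using 1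
    rw [Fintype.sum_prod_type_right, Finset.sum_range]
    refine Finset.sum_congr rfl fun j _ => ?_
    dsimp only
    rw [dif_pos j.2, map_sum, Finset.sum_mul, Finset.sum_mul]
    refine Finset.sum_congr rfl fun i _ => ?_
    rw [Polynomial.aeval_monomial, algebraMap_eq, smul_eq_C_mul]
    ring

/-- A weak form of Bézout's theorem, for one coordinate. -/
lemma exists_polynomial_vanishing (D L : ℕ) : ∃ B : ℕ, ∀ h q A : MvPolynomial (Fin 2) ℂ,
    Irreducible h → h.totalDegree ≤ D → q.totalDegree ≤ L → A.totalDegree ≤ L → ¬ h ∣ q →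
      ∃ c : Polynomial ℂ, c ≠ 0 ∧ c.natDegree ≤ B ∧
        ∀ p, ev2 h p = 0 → ev2 q p = 0 → c.eval (ev2 A p) = 0 := by
  classical
  refine ⟨(D * (L + D) + D) ^ 2, fun h q A hh hD hq hA hdvd => ?_⟩
  obtain ⟨c, hc, hcdeg, hrel⟩ := exists_algebraic_relation (G := h) (A := A) (P := q) (Q := 1)
    hh.ne_zero hD hA hq (by simp)
  have hex : ∃ j, c j ≠ 0 := ⟨_, hc.choose_spec.2⟩
  set j := Nat.find hex with hj
  have hjM : j ≤ D * L := (Nat.find_min' hex hc.choose_spec.2).trans hc.choose_spec.1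
  refine ⟨c j, Nat.find_spec hex, hcdeg j, fun p hp hqp => ?_⟩
  have hsum : ∑ i ∈ Finset.range (D * L + 1), Polynomial.aeval A (c i) * q ^ i * 1 ^ (D * L - i) =
      q ^ j * ∑ i ∈ Finset.range (D * L + 1), Polynomial.aeval A (c i) * q ^ (i - j) := by
    rw [Finset.mul_sum]
    refine Finset.sum_congr rfl fun i _ => ?_
    rcases lt_or_ge i j with hij | hij
    · have : c i = 0 := not_not.1 (Nat.find_min hex hij)
      simp [this]
    · rw [one_pow, mul_one, mul_left_comm, ← pow_add, Nat.add_sub_cancel' hij]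
  rw [hsum] at hrel
  have hrel' := (hh.prime.dvd_or_dvd hrel).resolve_left fun h1 => hdvd (hh.prime.dvd_of_dvd_pow h1)
  have h0 := ev2_eq_zero_of_dvd hrel' hp
  rw [ev2_sum, Finset.sum_eq_single j] at h0
  · simpa [ev2_aeval_polynomial] using h0
  · intro i _ hij
    rw [ev2_mul, ev2_pow, hqp, ev2_aeval_polynomial]
    rcases lt_or_ge i j with h1 | h1
    · have : c i = 0 := not_not.1 (Nat.find_min hex h1)
      simp [this]
    · rw [zero_pow (by omega), mul_zero]
  · intro h1
    exact absurd (Finset.mem_range.2 (by omega)) h1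

/-- A weak form of Bézout's theorem. -/
theorem exists_card_common_zeros_le (D L : ℕ) : ∃ B : ℕ, ∀ h q : MvPolynomial (Fin 2) ℂ,
    Irreducible h → h.totalDegree ≤ D → q.totalDegree ≤ L → ¬ h ∣ q →
      ∃ T : Finset (ℂ × ℂ), T.card ≤ B ∧ ∀ p, ev2 h p = 0 → ev2 q p = 0 → p ∈ T := by
  classical
  obtain ⟨B, hB⟩ := exists_polynomial_vanishing D (L + 1)
  refine ⟨B * B, fun h q hh hD hq hdvd => ?_⟩
  obtain ⟨c, hc, hcd, hcv⟩ := hB h q (X 0) hh hD (by omega) (by simp) hdvd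
  obtain ⟨c', hc', hcd', hcv'⟩ := hB h q (X 1) hh hD (by omega) (by simp) hdvd
  refine ⟨c.roots.toFinset ×ˢ c'.roots.toFinset, ?_, fun p hp hqp => ?_⟩
  · rw [Finset.card_product]
    exact Nat.mul_le_mul
      ((Multiset.toFinset_card_le _).trans ((Polynomial.card_roots' _).trans hcd))
      ((Multiset.toFinset_card_le _).trans ((Polynomial.card_roots' _).trans hcd'))
  · have h1 := hcv p hp hqp
    have h2 := hcv' p hp hqp
    rw [ev2_X_zero] at h1
    rw [ev2_X_one] at h2
    simp [hc, hc', h1, h2]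

end Hilbert

section Stability

lemma norm_eval_sub_le {δ : ℝ} (hδ : 0 ≤ δ) {x x' : ℂ} (n : ℕ) (p : Polynomial ℂ)
    (hp : p.natDegree ≤ n) (hroots : ∀ z, p.IsRoot z → ‖x' - x‖ ≤ δ * ‖x - z‖) :
    ‖p.eval x' - p.eval x‖ ≤ ((1 + δ) ^ n - 1) * ‖p.eval x‖ := by
  induction n generalizing p with
  | zero =>
    rw [Polynomial.eq_C_of_natDegree_le_zero hp]
    simp
  | succ n ih =>
    by_cases hd : p.natDegree = 0
    · rw [Polynomial.eq_C_of_natDegree_le_zero hd.le]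
      simp only [Polynomial.eval_C, sub_self, norm_zero]
      have : 1 ≤ (1 + δ) ^ (n + 1) := one_le_pow₀ (by linarith)
      exact mul_nonneg (by linarith) (norm_nonneg _)
    · obtain ⟨z, hz⟩ := IsAlgClosed.exists_root p (by
        intro h; exact hd (Polynomial.natDegree_eq_of_degree_eq_some h))
      obtain ⟨q, rfl⟩ := Polynomial.dvd_iff_isRoot.2 hz
      have hq0 : q ≠ 0 := by rintro rfl; simp at hd
      have hqd : q.natDegree ≤ n := by
        rw [Polynomial.natDegree_mul (Polynomial.X_sub_C_ne_zero z) hq0, Polynomial.natDegree_X_sub_C] at hp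
        omega
      have h1 := ih q hqd fun w hw => hroots w (by
        rw [Polynomial.IsRoot, Polynomial.eval_mul, hw.eq_zero, mul_zero])
      have h2 := hroots z hz
      have h3 : ‖x' - z‖ ≤ (1 + δ) * ‖x - z‖ := by
        calc ‖x' - z‖ = ‖(x' - x) + (x - z)‖ := by ring_nf
          _ ≤ _ := (norm_add_le _ _).trans (by linarith)
      simp only [Polynomial.eval_mul, Polynomial.eval_sub, Polynomial.eval_X, Polynomial.eval_C]
      have e : (x' - z) * q.eval x' - (x - z) * q.eval x =
          (x' - z) * (q.eval x' - q.eval x) + (x' - x) * q.eval x := by ring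
      rw [e]
      have hq1 : 0 ≤ ((1 + δ) ^ n - 1) * ‖q.eval x‖ := (norm_nonneg _).trans h1
      calc _ ≤ ‖x' - z‖ * ‖q.eval x' - q.eval x‖ + ‖x' - x‖ * ‖q.eval x‖ := by
            rw [← norm_mul, ← norm_mul]; exact norm_add_le _ _
        _ ≤ ((1 + δ) * ‖x - z‖) * (((1 + δ) ^ n - 1) * ‖q.eval x‖) +
            (δ * ‖x - z‖) * ‖q.eval x‖ := by gcongr
        _ = _ := by rw [norm_mul]; ring

lemma sum_norm_coeff_le {κ : ℝ} (hκ : 1 ≤ κ) {w : ℂ} (n : ℕ) (p : Polynomial ℂ)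
    (hp : p.natDegree ≤ n) (hroots : ∀ z, p.IsRoot z → ‖w‖ + ‖z‖ ≤ κ * ‖w - z‖) :
    ∑ j ∈ Finset.range (n + 1), ‖p.coeff j‖ * ‖w‖ ^ j ≤ κ ^ n * ‖p.eval w‖ := by
  induction n generalizing p with
  | zero =>
    rw [Polynomial.eq_C_of_natDegree_le_zero hp]
    simp
  | succ n ih =>
    by_cases hd : p.natDegree = 0
    · rw [Polynomial.eq_C_of_natDegree_le_zero hd.le, Finset.sum_eq_single 0]
      · simp only [Polynomial.coeff_C_zero, pow_zero, mul_one, Polynomial.eval_C]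
        exact le_mul_of_one_le_left (norm_nonneg _) (one_le_pow₀ hκ)
      · intro j _ hj
        rw [Polynomial.coeff_C_of_ne_zero hj]; simp
      · simp
    · obtain ⟨z, hz⟩ := IsAlgClosed.exists_root p (by
        intro h; exact hd (Polynomial.natDegree_eq_of_degree_eq_some h))
      obtain ⟨q, rfl⟩ := Polynomial.dvd_iff_isRoot.2 hz
      have hq0 : q ≠ 0 := by rintro rfl; simp at hd
      have hqd : q.natDegree ≤ n := by
        rw [Polynomial.natDegree_mul (Polynomial.X_sub_C_ne_zero z) hq0, Polynomial.natDegree_X_sub_C] at hp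
        omega
      have h1 := ih q hqd fun w hw => hroots w (by
        rw [Polynomial.IsRoot, Polynomial.eval_mul, hw.eq_zero, mul_zero])
      have h2 := hroots z hz
      have hqc : q.coeff (n + 1) = 0 := Polynomial.coeff_eq_zero_of_natDegree_lt (by omega)
      set B := ∑ j ∈ Finset.range (n + 1), ‖q.coeff j‖ * ‖w‖ ^ j with hB
      have h3 : ∑ j ∈ Finset.range (n + 2), ‖((Polynomial.X - Polynomial.C z) * q).coeff j‖ * ‖w‖ ^ j ≤
          (‖w‖ + ‖z‖) * B := by
        have e1 : ∀ j, ‖((Polynomial.X - Polynomial.C z) * q).coeff (j + 1)‖ * ‖w‖ ^ (j + 1) ≤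
            ‖w‖ * (‖q.coeff j‖ * ‖w‖ ^ j) + ‖z‖ * (‖q.coeff (j + 1)‖ * ‖w‖ ^ (j + 1)) := by
          intro j
          rw [sub_mul, Polynomial.coeff_sub, Polynomial.coeff_X_mul, Polynomial.coeff_C_mul]
          calc _ ≤ (‖q.coeff j‖ + ‖z * q.coeff (j + 1)‖) * ‖w‖ ^ (j + 1) := by
                gcongr; exact norm_sub_le _ _
            _ = _ := by rw [norm_mul]; ring
        rw [Finset.sum_range_succ']
        have e2 : ‖((Polynomial.X - Polynomial.C z) * q).coeff 0‖ * ‖w‖ ^ 0 = ‖z‖ * (‖q.coeff 0‖ * ‖w‖ ^ 0) := by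
          rw [sub_mul, Polynomial.coeff_sub, Polynomial.coeff_C_mul]; simp
        rw [e2]
        have e3 : ‖z‖ * B = ∑ j ∈ Finset.range (n + 1),
            ‖z‖ * (‖q.coeff (j + 1)‖ * ‖w‖ ^ (j + 1)) + ‖z‖ * (‖q.coeff 0‖ * ‖w‖ ^ 0) := by
          rw [← Finset.sum_range_succ' (fun j => ‖z‖ * (‖q.coeff j‖ * ‖w‖ ^ j)),
            Finset.sum_range_succ, hqc, hB, Finset.mul_sum]
          simp
        rw [add_mul, e3, ← add_assoc, hB, Finset.mul_sum, ← Finset.sum_add_distrib]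
        gcongr with j _
        exact e1 j
      have hB0 : 0 ≤ B := Finset.sum_nonneg fun _ _ => by positivity
      calc _ ≤ (‖w‖ + ‖z‖) * B := h3
        _ ≤ (κ * ‖w - z‖) * (κ ^ n * ‖q.eval w‖) := by gcongr
        _ = _ := by rw [Polynomial.eval_mul, norm_mul, Polynomial.eval_sub, Polynomial.eval_X, Polynomial.eval_C]; ring

/-- The nonzero roots of a polynomial move little in ratio when its coefficients do. -/
lemma exists_root_near (M : ℕ) {η : ℝ} (hη : 0 < η) (hη1 : η ≤ 1) {p p' : Polynomial ℂ}
    (hp : p ≠ 0) (hd : p.natDegree ≤ M) (hd' : p'.natDegree ≤ M)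
    (hcoeff : ∀ j, ‖p'.coeff j - p.coeff j‖ ≤ (η / 6) ^ (M + 1) * ‖p.coeff j‖)
    {w : ℂ} (hw : w ≠ 0) (hroot : p'.eval w = 0) :
    ∃ z, p.IsRoot z ∧ ‖w - z‖ ≤ η / 2 * ‖w‖ := by
  by_contra! hno
  have hw' : 0 < ‖w‖ := norm_pos_iff.2 hw
  have h1 := sum_norm_coeff_le (κ := 6 / η) (by rw [le_div_iff₀ hη]; linarith) (w := w) M p hd (by
    intro z hz
    have h2 := hno z hz
    have h3 : ‖z‖ ≤ ‖w‖ + ‖w - z‖ := by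
      calc ‖z‖ = ‖w - (w - z)‖ := by ring_nf
        _ ≤ _ := norm_sub_le _ _
    have h4 : ‖w‖ ≤ 2 / η * ‖w - z‖ := by
      rw [div_mul_eq_mul_div, le_div_iff₀ hη]; linarith
    have h5 : ‖w - z‖ ≤ 2 / η * ‖w - z‖ :=
      le_mul_of_one_le_left (norm_nonneg _) (by rw [le_div_iff₀ hη]; linarith)
    calc ‖w‖ + ‖z‖ ≤ 2 / η * ‖w - z‖ + (2 / η * ‖w - z‖ + 2 / η * ‖w - z‖) := by linarith
      _ = _ := by ring)
  set B := ∑ j ∈ Finset.range (M + 1), ‖p.coeff j‖ * ‖w‖ ^ j with hB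
  have h2 : ‖p.eval w‖ ≤ (η / 6) ^ (M + 1) * B := by
    have e : p.eval w = ∑ j ∈ Finset.range (M + 1), (p.coeff j - p'.coeff j) * w ^ j := by
      rw [← sub_zero (p.eval w), ← hroot, Polynomial.eval_eq_sum_range' (Nat.lt_succ_iff.2 hd),
        Polynomial.eval_eq_sum_range' (Nat.lt_succ_iff.2 hd'), ← Finset.sum_sub_distrib]
      exact Finset.sum_congr rfl fun j _ => by ring
    rw [e, hB, Finset.mul_sum]
    refine (norm_sum_le _ _).trans (Finset.sum_le_sum fun j _ => ?_)
    rw [norm_mul, norm_pow, norm_sub_rev, ← mul_assoc]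
    gcongr
    exact hcoeff j
  have hB0 : 0 < B := by
    refine Finset.sum_pos' (fun _ _ => by positivity) ⟨p.natDegree,
      Finset.mem_range.2 (Nat.lt_succ_iff.2 hd), ?_⟩
    have : p.coeff p.natDegree ≠ 0 := Polynomial.leadingCoeff_ne_zero.2 hp
    positivity
  have h3 : B ≤ η / 6 * B := by
    calc B ≤ (6 / η) ^ M * ((η / 6) ^ (M + 1) * B) := h1.trans (by gcongr)
      _ = ((6 / η) * (η / 6)) ^ M * (η / 6 * B) := by rw [mul_pow, pow_succ]; ring
      _ = _ := by rw [div_mul_div_cancel₀ hη.ne']; norm_num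
  nlinarith

/-- A finite set of ratios leaves a gap around any centre. -/
lemma exists_gap (m : ℕ) {T : Finset ℂ} (hT : T.card ≤ m) {z₀ : ℂ} (hz₀ : z₀ ≠ 0) :
    ∃ θ θ' : ℝ, 0 ≤ θ' ∧ θ' < θ ∧ θ ≤ 1 / 2 ∧ ∀ w z : ℂ, z ∈ T →
      ‖w - z‖ ≤ 1 / (16 * (m + 1)) * ‖w‖ → ‖w - z₀‖ ≤ θ * ‖z₀‖ → ‖w - z₀‖ ≤ θ' * ‖z₀‖ := by
  classical
  set u : ℝ := 1 / (2 * (m + 1)) with hu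
  have hu0 : 0 < u := by positivity
  have hum : u * (m + 1) = 1 / 2 := by rw [hu]; field_simp
  have hn : 0 < ‖z₀‖ := norm_pos_iff.2 hz₀
  have hj : ∃ j ∈ Finset.range (m + 1), ∀ z ∈ T,
      ¬ ((j + 1 / 2 : ℝ) * u * ‖z₀‖ < ‖z - z₀‖ ∧ ‖z - z₀‖ ≤ (j + 5 / 4) * u * ‖z₀‖) := by
    by_contra! h
    choose! f hfT hf using h
    obtain ⟨i, hi, j, hj, hij, hfij⟩ := Finset.exists_ne_map_eq_of_card_lt_of_maps_to
      (s := Finset.range (m + 1)) (t := T) (by rw [Finset.card_range]; omega) (f := f)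
      (fun i hi => hfT i hi)
    wlog hlt : i < j generalizing i j
    · exact this j hj i hi hij.symm hfij.symm (by omega)
    have h1 := (hf i hi).2
    have h2 := (hf j hj).1
    rw [hfij] at h1
    have h3 := h2.trans_le h1
    have h4 : (i : ℝ) + 1 ≤ j := by exact_mod_cast hlt
    have h5 : ((i : ℝ) + 5 / 4) * u * ‖z₀‖ ≤ (j + 1 / 2) * u * ‖z₀‖ := by
      have : (i : ℝ) + 5 / 4 ≤ j + 1 / 2 := by linarith
      gcongr
    linarith
  obtain ⟨j, hjm, hj⟩ := hj
  have hjm' : (j : ℝ) + 1 ≤ m + 1 := by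
    have := Finset.mem_range.1 hjm
    exact_mod_cast this
  refine ⟨(j + 1) * u, (j + 3 / 4) * u, by positivity, by gcongr; norm_num, ?_, ?_⟩
  · calc ((j : ℝ) + 1) * u ≤ (m + 1) * u := by gcongr
      _ = 1 / 2 := by linarith
  · intro w z hz hwz hw
    by_contra! hlt
    have hw2 : ‖w‖ ≤ 2 * ‖z₀‖ := by
      have h1 : ((j : ℝ) + 1) * u ≤ 1 := by nlinarith
      calc ‖w‖ = ‖(w - z₀) + z₀‖ := by ring_nf
        _ ≤ ‖w - z₀‖ + ‖z₀‖ := norm_add_le _ _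
        _ ≤ 1 * ‖z₀‖ + ‖z₀‖ := by gcongr; exact hw.trans (by gcongr)
        _ = _ := by ring
    have hη : 1 / (16 * ((m : ℝ) + 1)) = u / 8 := by rw [hu]; field_simp; norm_num
    rw [hη] at hwz
    have hwz' : ‖w - z‖ ≤ u / 4 * ‖z₀‖ := hwz.trans (by nlinarith)
    refine hj z hz ⟨?_, ?_⟩
    · have : ‖w - z₀‖ ≤ ‖w - z‖ + ‖z - z₀‖ := norm_sub_le_norm_sub_add_norm_sub _ _ _
      nlinarith
    · have : ‖z - z₀‖ ≤ ‖z - w‖ + ‖w - z₀‖ := norm_sub_le_norm_sub_add_norm_sub _ _ _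
      rw [norm_sub_rev z w] at this
      nlinarith

end Stability

section Slopes

lemma totalDegree_pderiv_lt {G : MvPolynomial (Fin 2) ℂ} {i : Fin 2} (h : pderiv i G ≠ 0) :
    (pderiv i G).totalDegree < G.totalDegree := by
  rw [totalDegree, Finset.sup_lt_iff]
  · intro s hs
    have hs' : s + Finsupp.single i 1 ∈ G.support := by
      rw [mem_support_iff] at hs ⊢
      intro h0
      rw [coeff_pderiv, h0, zero_mul] at hs
      exact hs rfl
    have h1 := le_totalDegree_fin_two hs'
    rw [Finsupp.sum_fintype _ _ (fun _ => rfl), Fin.sum_univ_two]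
    have h2 : (Finsupp.single i 1 : Fin 2 →₀ ℕ) 0 + (Finsupp.single i 1 : Fin 2 →₀ ℕ) 1 = 1 := by
      fin_cases i <;> simp
    simp only [Finsupp.add_apply] at h1
    omega
  · rw [bot_eq_zero', pos_iff_ne_zero]
    intro h0
    rw [totalDegree_eq_zero_iff_eq_C] at h0
    rw [h0, pderiv_C] at h
    exact h rfl

lemma not_dvd_pderiv {G : MvPolynomial (Fin 2) ℂ} {i : Fin 2} (h : pderiv i G ≠ 0) :
    ¬ G ∣ pderiv i G := by
  rintro ⟨k, hk⟩
  have hG : G ≠ 0 := by rintro rfl; simp at h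
  have hk0 : k ≠ 0 := by rintro rfl; simp [hk] at h
  have h1 := totalDegree_pderiv_lt h
  rw [hk, totalDegree_mul_of_isDomain hG hk0] at h1
  omega

lemma exists_pow_le_one_add {ε : ℝ} (hε : 0 < ε) (I : ℕ) :
    ∃ K : ℕ, 2 ≤ K ∧ (1 + 3 / 2 ^ K : ℝ) ^ I - 1 ≤ ε := by
  have h1 : Filter.Tendsto (fun K : ℕ => ((1 : ℝ) + 3 * (1 / 2) ^ K) ^ I - 1) Filter.atTop
      (nhds ((1 + 3 * 0) ^ I - 1)) :=
    (((tendsto_pow_atTop_nhds_zero_of_lt_one (by norm_num) (by norm_num)).const_mul 3).const_add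
      1 |>.pow I).sub_const 1
  have h2 : ((1 : ℝ) + 3 * 0) ^ I - 1 < ε := by simpa using hε
  obtain ⟨K, hK, hK2⟩ := ((h1.eventually (gt_mem_nhds h2)).and
    (Filter.eventually_ge_atTop 2)).exists
  refine ⟨K, hK2, ?_⟩
  rw [div_eq_mul_inv, ← inv_pow, ← one_div]
  exact hK.le

/-- Away from a bounded number of vertical lines, the slopes of a plane curve over a disc fall into
a bounded number of narrow clusters. -/
theorem exists_slope_clusters (D : ℕ) : ∃ B K M : ℕ, ∀ G : MvPolynomial (Fin 2) ℂ,
    Irreducible G → G.totalDegree ≤ D → pderiv 0 G ≠ 0 → pderiv 1 G ≠ 0 →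
    ∃ V : Finset ℂ, V.card ≤ B ∧ ∀ (x : ℂ) (r : ℝ), (∀ v ∈ V, 2 ^ K * r < ‖x - v‖) →
      ∃ T : Finset ℂ, T.card ≤ M ∧ ∀ x' y', ‖x' - x‖ ≤ 3 * r → ev2 G (x', y') = 0 →
        ev2 (pderiv 0 G) (x', y') ≠ 0 ∧ ev2 (pderiv 1 G) (x', y') ≠ 0 ∧
        ∃ z ∈ T, z ≠ 0 ∧
          ‖-ev2 (pderiv 0 G) (x', y') / ev2 (pderiv 1 G) (x', y') - z‖ ≤
            1 / (16 * (M + 1)) * ‖-ev2 (pderiv 0 G) (x', y') / ev2 (pderiv 1 G) (x', y')‖ ∧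
          ‖-ev2 (pderiv 0 G) (x', y') / ev2 (pderiv 1 G) (x', y') - z‖ ≤
            1 / (16 * (M + 1)) * ‖z‖ := by
  classical
  obtain ⟨B, hB⟩ := exists_card_common_zeros_le D D
  set M := D * (D + 1) with hM
  set I := (D * (D + 1 + D) + D) ^ 2 with hI
  set η : ℝ := 1 / (16 * (M + 1)) with hη
  have hη0 : 0 < η := by positivity
  have hη1 : η ≤ 1 := by
    rw [hη, div_le_one (by positivity)]
    have : (0 : ℝ) ≤ M := Nat.cast_nonneg _
    linarith
  obtain ⟨K, hK2, hK⟩ := exists_pow_le_one_add (ε := (η / 6) ^ (M + 1)) (by positivity) I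
  refine ⟨B + B + (M + 1) * I, K, M, fun G hG hD h0 h1 => ?_⟩
  have hd0 := totalDegree_pderiv_lt h0
  have hd1 := totalDegree_pderiv_lt h1
  obtain ⟨T0, hT0, hZ0⟩ := hB G _ hG hD (hd0.le.trans hD) (not_dvd_pderiv h0)
  obtain ⟨T1, hT1, hZ1⟩ := hB G _ hG hD (hd1.le.trans hD) (not_dvd_pderiv h1)
  obtain ⟨c, ⟨j₀, hj₀, hcj₀⟩, hcdeg, hrel⟩ := exists_algebraic_relation (G := G) (A := X 0)
    (P := -pderiv 0 G) (Q := pderiv 1 G) (e := D + 1) hG.ne_zero hD (by simp)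
    (by rw [totalDegree_neg]; omega) (by omega)
  refine ⟨T0.image Prod.fst ∪ T1.image Prod.fst ∪
    (Finset.range (M + 1)).biUnion fun j => (c j).roots.toFinset, ?_, ?_⟩
  · refine (Finset.card_union_le _ _).trans (add_le_add ((Finset.card_union_le _ _).trans
      (add_le_add (Finset.card_image_le.trans hT0) (Finset.card_image_le.trans hT1))) ?_)
    refine (Finset.card_biUnion_le_card_mul _ _ I fun j _ => ?_).trans (by simp)
    exact (Multiset.toFinset_card_le _).trans ((Polynomial.card_roots' _).trans (hcdeg j))
  intro x r hx
  have h2K : (0 : ℝ) < 2 ^ K := by positivity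
  have h2K1 : (3 : ℝ) ≤ 2 ^ K := by
    calc (3 : ℝ) ≤ 2 ^ 2 := by norm_num
      _ ≤ 2 ^ K := pow_le_pow_right₀ (by norm_num) hK2
  have hroot : ∀ j ∈ Finset.range (M + 1), c j ≠ 0 → ∀ z, (c j).IsRoot z →
      2 ^ K * r < ‖x - z‖ := fun j hj hc z hz => hx z (Finset.mem_union_right _
        (Finset.mem_biUnion.2 ⟨j, hj, by simp [hc, hz.eq_zero]⟩))
  let N : ℂ → Polynomial ℂ := fun u =>
    ∑ j ∈ Finset.range (M + 1), Polynomial.monomial j ((c j).eval u)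
  have hNdeg : ∀ u, (N u).natDegree ≤ M := fun u =>
    Polynomial.natDegree_sum_le_of_forall_le _ _ fun j hj =>
      (Polynomial.natDegree_monomial_le _).trans (Nat.lt_succ_iff.1 (Finset.mem_range.1 hj))
  have hNcoeff : ∀ u j, (N u).coeff j = if j ∈ Finset.range (M + 1) then (c j).eval u else 0 := by
    intro u j
    simp only [N, Polynomial.finsetSum_coeff, Polynomial.coeff_monomial, Finset.sum_ite_eq']
  refine ⟨(N x).roots.toFinset, (Multiset.toFinset_card_le _).trans
    ((Polynomial.card_roots' _).trans (hNdeg x)), fun x' y' hx' hG' => ?_⟩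
  have hr : 0 ≤ r := by nlinarith [norm_nonneg (x' - x)]
  have hxV : x' ∉ T0.image Prod.fst ∪ T1.image Prod.fst ∪
      (Finset.range (M + 1)).biUnion fun j => (c j).roots.toFinset := by
    intro hmem
    have := hx x' hmem
    rw [norm_sub_rev] at this
    nlinarith
  simp only [Finset.mem_union, Finset.mem_image, not_or, not_exists, not_and] at hxV
  have hG0 : ev2 (pderiv 0 G) (x', y') ≠ 0 := fun h => hxV.1.1 _ (hZ0 _ hG' h) rfl
  have hG1 : ev2 (pderiv 1 G) (x', y') ≠ 0 := fun h => hxV.1.2 _ (hZ1 _ hG' h) rfl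
  refine ⟨hG0, hG1, ?_⟩
  set w := -ev2 (pderiv 0 G) (x', y') / ev2 (pderiv 1 G) (x', y') with hw
  have hw0 : w ≠ 0 := div_ne_zero (neg_ne_zero.2 hG0) hG1
  have hNw : (N x').eval w = 0 := by
    have h := ev2_eq_zero_of_dvd hrel hG'
    have e : ev2 (∑ j ∈ Finset.range (M + 1),
        Polynomial.aeval (X 0) (c j) * (-pderiv 0 G) ^ j * pderiv 1 G ^ (M - j)) (x', y') =
        ev2 (pderiv 1 G) (x', y') ^ M * (N x').eval w := by
      rw [ev2_sum, Polynomial.eval_finsetSum, Finset.mul_sum]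
      refine Finset.sum_congr rfl fun j hj => ?_
      have hjM : j ≤ M := Nat.lt_succ_iff.1 (Finset.mem_range.1 hj)
      rw [ev2_mul, ev2_mul, ev2_aeval_polynomial, ev2_X_zero, ev2_pow, ev2_pow, ev2_neg,
        Polynomial.eval_monomial, hw, div_pow, ← Nat.sub_add_cancel hjM, pow_add,
        Nat.add_sub_cancel]
      field_simp
    rw [e] at h
    exact (mul_eq_zero.1 h).resolve_left (pow_ne_zero _ hG1)
  have hNx : N x ≠ 0 := by
    intro h
    have h1 := hNcoeff x j₀
    rw [h, Polynomial.coeff_zero, if_pos (Finset.mem_range.2 (Nat.lt_succ_iff.2 hj₀))] at h1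
    have := hroot j₀ (Finset.mem_range.2 (Nat.lt_succ_iff.2 hj₀)) hcj₀ x h1.symm
    rw [sub_self, norm_zero] at this
    nlinarith
  obtain ⟨z, hz, hwz⟩ := exists_root_near M hη0 hη1 hNx (hNdeg x) (hNdeg x') (fun j => by
    rw [hNcoeff, hNcoeff]
    split_ifs with hj
    · by_cases hcj : c j = 0
      · simp [hcj]
      · refine (norm_eval_sub_le (δ := 3 / 2 ^ K) (by positivity) I _ (hcdeg j)
          fun z hz => ?_).trans (by gcongr)
        have := hroot j hj hcj z hz
        rw [div_mul_eq_mul_div, le_div_iff₀ h2K]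
        nlinarith
    · simp) hw0 hNw
  have hwn : 0 < ‖w‖ := norm_pos_iff.2 hw0
  have hwz2 : ‖w‖ ≤ 2 * ‖z‖ := by
    have h3 : ‖w‖ ≤ ‖w - z‖ + ‖z‖ := by simpa using norm_add_le (w - z) z
    nlinarith
  refine ⟨z, by simp [hNx, hz.eq_zero], ?_, by nlinarith, by nlinarith⟩
  rintro rfl
  simp only [norm_zero, mul_zero] at hwz2
  linarith

end Slopes

section Away

lemma pderiv_swapVars_zero (G : MvPolynomial (Fin 2) ℂ) :
    pderiv 0 (swapVars G) = swapVars (pderiv 1 G) := by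
  have h := pderiv_rename (R := ℂ) (Equiv.swap (0 : Fin 2) 1).injective 1 G
  rwa [Equiv.swap_apply_right] at h

lemma pderiv_swapVars_one (G : MvPolynomial (Fin 2) ℂ) :
    pderiv 1 (swapVars G) = swapVars (pderiv 0 G) := by
  have h := pderiv_rename (R := ℂ) (Equiv.swap (0 : Fin 2) 1).injective 0 G
  rwa [Equiv.swap_apply_left] at h

lemma not_dvd_X_sub_C {G : MvPolynomial (Fin 2) ℂ} {i j : Fin 2} (hij : i ≠ j)
    (h : pderiv j G ≠ 0) (e : ℂ) : ¬ G ∣ X i - C e := by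
  rintro ⟨k, hk⟩
  have hG0 : G ≠ 0 := by rintro rfl; simp at h
  have hne : (X i - C e : MvPolynomial (Fin 2) ℂ) ≠ 0 := by
    intro h0
    have h1 := congrArg (pderiv i) h0
    simp at h1
  have hk0 : k ≠ 0 := by rintro rfl; exact hne (by rw [hk, mul_zero])
  have hdeg : (X i - C e : MvPolynomial (Fin 2) ℂ).totalDegree ≤ 1 :=
    (totalDegree_sub _ _).trans (by simp)
  rw [hk, totalDegree_mul_of_isDomain hG0 hk0] at hdeg
  have hG1 : G.totalDegree ≠ 0 := by
    intro h0
    rw [totalDegree_eq_zero_iff_eq_C] at h0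
    rw [h0, pderiv_C] at h
    exact h rfl
  have hkC := totalDegree_eq_zero_iff_eq_C.1 (show k.totalDegree = 0 by omega)
  have h2 := congrArg (pderiv j) hk
  rw [hkC, pderiv_mul, pderiv_C, mul_zero, add_zero, map_sub, pderiv_C,
    pderiv_X_of_ne hij, sub_zero] at h2
  rcases mul_eq_zero.1 h2.symm with h3 | h3
  · exact h h3
  · exact hk0 (hkC.trans h3)

lemma fewPairs_of_continuation {B : ℕ} {F : MvPolynomial (Fin 2) ℂ}
    (hroots : ∀ e, ∃ T : Finset ℂ, T.card ≤ B ∧ ∀ y, ev2 F (e, y) = 0 → y ∈ T)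
    (Q Q' : Finset (ℤ × ℤ × ℤ)) :
    FewPairs (B * (2 * 18 + 3) ^ 2) Q Q' fun P R => ∃ x y m : ℂ, IsCell Q P x ∧ IsCell Q' R y ∧
      m ≠ 0 ∧ ‖m‖ * 2 ^ P.1 ≤ 2 ^ R.1 ∧ ∀ e, ‖e - x‖ ≤ 2 * 2 ^ P.1 →
        ∃ y', ev2 F (e, y') = 0 ∧ ev2 (pderiv 1 F) (e, y') ≠ 0 ∧
          ‖y' - y - m * (e - x)‖ ≤ 1 / 2 * ‖m * (e - x)‖ ∧
          ‖ev2 (pderiv 0 F) (e, y') + m * ev2 (pderiv 1 F) (e, y')‖ ≤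
            1 / 2 * (‖m‖ * ‖ev2 (pderiv 1 F) (e, y')‖) := by
  classical
  refine fewPairs_of_left fun P hP => ?_
  by_cases hne : ∃ e, IsCell Q P e
  swap
  · refine ⟨∅, by simp, ?_⟩
    rintro R - ⟨x, y, m, hx, -⟩
    exact absurd ⟨x, hx⟩ hne
  obtain ⟨e, he⟩ := hne
  obtain ⟨T, hT, hTr⟩ := hroots e
  have hs : ∀ y', ∃ s : ℤ, ev2 (pderiv 1 F) (e, y') ≠ 0 → ev2 (pderiv 0 F) (e, y') ≠ 0 →
      2 / 3 * ‖ev2 (pderiv 0 F) (e, y') / ev2 (pderiv 1 F) (e, y')‖ * (2 : ℝ) ^ P.1 ∈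
        Set.Ico ((2 : ℝ) ^ s) (2 ^ (s + 1)) := by
    intro y'
    by_cases h : ev2 (pderiv 1 F) (e, y') ≠ 0 ∧ ev2 (pderiv 0 F) (e, y') ≠ 0
    · have h1 : 0 < ‖ev2 (pderiv 0 F) (e, y') / ev2 (pderiv 1 F) (e, y')‖ :=
        norm_pos_iff.2 (div_ne_zero h.2 h.1)
      obtain ⟨s, hs⟩ := exists_mem_Ico_zpow (x := 2 / 3 *
        ‖ev2 (pderiv 0 F) (e, y') / ev2 (pderiv 1 F) (e, y')‖ * (2 : ℝ) ^ P.1) (y := 2)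
        (by positivity) (by norm_num)
      exact ⟨s, fun _ _ => hs⟩
    · exact ⟨0, fun h1 h2 => absurd ⟨h1, h2⟩ h⟩
  choose s hs using hs
  choose U hU hUR using fun y' => exists_finset_isCellFrom Q' (s y') y' 18
  refine ⟨T.biUnion U, (Finset.card_biUnion_le_card_mul _ _ _ fun y' _ => hU y').trans
    (Nat.mul_le_mul_right _ hT), ?_⟩
  rintro R - ⟨x, y, m, hx, hy, hm, hmR, hcont⟩
  have hex : ‖e - x‖ ≤ 2 * 2 ^ P.1 := norm_sub_le_of_sqKey_eq (he.2.1.trans hx.2.1.symm)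
  obtain ⟨y', h1, h2, h3, h4⟩ := hcont e hex
  refine Finset.mem_biUnion.2 ⟨y', hTr y' h1, hUR y' R y ?_ ?_⟩
  all_goals
    have hm0 : 0 < ‖m‖ := norm_pos_iff.2 hm
    have hF2 : 0 < ‖ev2 (pderiv 1 F) (e, y')‖ := norm_pos_iff.2 h2
    set q := ‖ev2 (pderiv 0 F) (e, y') / ev2 (pderiv 1 F) (e, y')‖ with hq
    have hq1 : ‖ev2 (pderiv 0 F) (e, y') / ev2 (pderiv 1 F) (e, y') + m‖ ≤ 1 / 2 * ‖m‖ := by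
      have e1 : ev2 (pderiv 0 F) (e, y') / ev2 (pderiv 1 F) (e, y') + m =
        (ev2 (pderiv 0 F) (e, y') + m * ev2 (pderiv 1 F) (e, y')) /
          ev2 (pderiv 1 F) (e, y') := by field_simp
      rw [e1, norm_div, div_le_iff₀ hF2]
      linarith
    have hq2 : q ≤ 3 / 2 * ‖m‖ := by
      have := norm_sub_le (ev2 (pderiv 0 F) (e, y') / ev2 (pderiv 1 F) (e, y') + m) m
      rw [add_sub_cancel_right] at this
      linarith
    have hq3 : ‖m‖ ≤ 2 * q := by
      have := norm_sub_le (ev2 (pderiv 0 F) (e, y') / ev2 (pderiv 1 F) (e, y') + m)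
        (ev2 (pderiv 0 F) (e, y') / ev2 (pderiv 1 F) (e, y'))
      rw [add_sub_cancel_left] at this
      linarith
    have hF1 : ev2 (pderiv 0 F) (e, y') ≠ 0 := by
      intro h
      rw [hq, h, zero_div, norm_zero] at hq3
      linarith
    have hsy := hs y' h2 hF1
    have hP0 : (0 : ℝ) < 2 ^ P.1 := by positivity
  · refine hy.isCellFrom ?_
    have : (2 : ℝ) ^ s y' ≤ 2 ^ R.1 := by
      refine (hsy.1.trans ?_).trans hmR
      gcongr
      linarith
    exact (zpow_le_zpow_iff_right₀ (by norm_num)).1 this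
  · have h5 : ‖y - y'‖ ≤ 3 / 2 * ‖m * (e - x)‖ := by
      have := norm_add_le (y' - y - m * (e - x)) (m * (e - x))
      rw [sub_add_cancel, norm_sub_rev] at this
      linarith
    have h6 : ‖m * (e - x)‖ ≤ 2 * q * (2 * 2 ^ P.1) := by
      rw [norm_mul]; gcongr
    have h7 := hsy.2
    rw [zpow_add_one₀ (by norm_num)] at h7
    push_cast
    linarith

/-- The part of a plane curve that is far from finitely many vertical lines meets few pairs of
cells. -/
theorem fewPairs_away (D : ℕ) : ∃ B K c : ℕ, ∀ G : MvPolynomial (Fin 2) ℂ,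
    Irreducible G → G.totalDegree ≤ D → pderiv 0 G ≠ 0 → pderiv 1 G ≠ 0 →
    ∃ V : Finset ℂ, V.card ≤ B ∧ ∀ Q Q' : Finset (ℤ × ℤ × ℤ),
      FewPairs c Q Q' fun P R => ∃ x y, IsCell Q P x ∧ IsCell Q' R y ∧ ev2 G (x, y) = 0 ∧
        ∀ v ∈ V, 2 ^ K * 2 ^ P.1 < ‖x - v‖ := by
  classical
  obtain ⟨B, K, M, hBKM⟩ := exists_slope_clusters D
  obtain ⟨B', hB'⟩ := exists_card_common_zeros_le D 1
  refine ⟨B, K, B' * (2 * 18 + 3) ^ 2 + B' * (2 * 18 + 3) ^ 2, fun G hG hD h0 h1 => ?_⟩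
  obtain ⟨V, hV, hcl⟩ := hBKM G hG hD h0 h1
  refine ⟨V, hV, fun Q Q' => ?_⟩
  have hr1 : ∀ e, ∃ T : Finset ℂ, T.card ≤ B' ∧ ∀ y, ev2 G (e, y) = 0 → y ∈ T := by
    intro e
    obtain ⟨T, hT, hTz⟩ := hB' G (X 0 - C e) hG hD ((totalDegree_sub _ _).trans (by simp))
      (not_dvd_X_sub_C (by decide) h1 e)
    exact ⟨T.image Prod.snd, Finset.card_image_le.trans hT, fun y hy =>
      Finset.mem_image.2 ⟨(e, y), hTz _ hy (by simp), rfl⟩⟩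
  have hr2 : ∀ e, ∃ T : Finset ℂ, T.card ≤ B' ∧ ∀ x, ev2 (swapVars G) (e, x) = 0 → x ∈ T := by
    intro e
    obtain ⟨T, hT, hTz⟩ := hB' G (X 1 - C e) hG hD ((totalDegree_sub _ _).trans (by simp))
      (not_dvd_X_sub_C (by decide) h0 e)
    exact ⟨T.image Prod.fst, Finset.card_image_le.trans hT, fun x hx =>
      Finset.mem_image.2 ⟨(x, e), hTz _ (by rwa [ev2_swapVars] at hx) (by simp), rfl⟩⟩
  refine FewPairs.mono ((fewPairs_of_continuation hr1 Q Q').or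
    (fewPairs_of_continuation hr2 Q' Q).flip) le_rfl ?_
  rintro P - R - ⟨x, y, hx, hy, hxy, hfar⟩
  obtain ⟨T, hT, hTc⟩ := hcl x (2 ^ P.1) hfar
  have hPpos : (0 : ℝ) < 2 ^ P.1 := by positivity
  have hRpos : (0 : ℝ) < 2 ^ R.1 := by positivity
  obtain ⟨g0, g1, -⟩ := hTc x y (by rw [sub_self, norm_zero]; positivity) hxy
  set m := -ev2 (pderiv 0 G) (x, y) / ev2 (pderiv 1 G) (x, y) with hm
  have hm0 : m ≠ 0 := div_ne_zero (neg_ne_zero.2 g0) g1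
  have hmn : 0 < ‖m‖ := norm_pos_iff.2 hm0
  rcases le_total (‖m‖ * 2 ^ P.1) (2 ^ R.1) with hle | hle
  · left
    refine ⟨x, y, m, hx, hy, hm0, hle, fun e he => ?_⟩
    obtain ⟨θ, θ', hθ0, hθ, hθ2, hgap⟩ := exists_gap M hT hm0
    obtain ⟨v, e1, e2, e3, e4⟩ := exists_continuation G (u₀ := x) (v₀ := y) (m₀ := m) (h := e - x)
      hm0 hθ0 hθ hxy (by rw [hm]; field_simp; ring) (by
      intro τ hτ0 hτ1 v hv _ hsl
      have hn : ‖x + τ * (e - x) - x‖ ≤ 3 * 2 ^ P.1 := by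
        rw [add_sub_cancel_left, norm_mul, Complex.norm_real, Real.norm_of_nonneg hτ0]
        nlinarith [norm_nonneg (e - x)]
      obtain ⟨d0, d1, z, hz, -, hz1, -⟩ := hTc _ v hn hv
      refine ⟨d1, ?_⟩
      have hd1 := norm_pos_iff.2 d1
      generalize ev2 (pderiv 0 G) (x + τ * (e - x), v) = F₁ at *
      generalize ev2 (pderiv 1 G) (x + τ * (e - x), v) = F₂ at *
      have e5 : ‖F₁ + m * F₂‖ = ‖-F₁ / F₂ - m‖ * ‖F₂‖ := by
        rw [← norm_mul, ← norm_neg]; congr 1; field_simp; ring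
      rw [e5, ← mul_assoc] at hsl ⊢
      exact mul_le_mul_of_nonneg_right
        (hgap _ z hz hz1 (le_of_mul_le_mul_right hsl hd1)) hd1.le)
    rw [add_sub_cancel] at e1 e3 e4
    exact ⟨v, e1, e4, e2.trans (by gcongr), e3.trans (by gcongr)⟩
  · right
    have hmi0 : m⁻¹ ≠ 0 := inv_ne_zero hm0
    have hle' : ‖m⁻¹‖ * 2 ^ R.1 ≤ 2 ^ P.1 := by
      rw [norm_inv, inv_mul_le_iff₀ hmn]; exact hle
    refine ⟨y, x, m⁻¹, hy, hx, hmi0, hle', fun e he => ?_⟩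
    obtain ⟨θ, θ', hθ0, hθ, hθ2, hgap⟩ := exists_gap M (T := T.image (·⁻¹))
      (Finset.card_image_le.trans hT) hmi0
    obtain ⟨v, e1, e2, e3, e4⟩ := exists_continuation (swapVars G) (u₀ := y) (v₀ := x)
      (m₀ := m⁻¹) (h := e - y) hmi0 hθ0 hθ (by rwa [ev2_swapVars]) (by
        rw [pderiv_swapVars_zero, pderiv_swapVars_one, ev2_swapVars, ev2_swapVars, hm]
        field_simp; ring) (by
      intro τ hτ0 hτ1 v hv hvn hsl
      rw [pderiv_swapVars_zero, pderiv_swapVars_one, ev2_swapVars, ev2_swapVars] at hsl ⊢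
      rw [ev2_swapVars] at hv
      have hn : ‖v - x‖ ≤ 3 * 2 ^ P.1 := by
        have e5 := norm_add_le (v - x - m⁻¹ * (τ * (e - y))) (m⁻¹ * (τ * (e - y)))
        rw [sub_add_cancel] at e5
        have e6 : ‖m⁻¹ * (τ * (e - y))‖ = τ * ‖m⁻¹ * (e - y)‖ := by
          rw [norm_mul, norm_mul, norm_mul, Complex.norm_real, Real.norm_of_nonneg hτ0]; ring
        have e7 : ‖m⁻¹ * (e - y)‖ ≤ 2 * 2 ^ P.1 := by
          rw [norm_mul]
          calc _ ≤ ‖m⁻¹‖ * (2 * 2 ^ R.1) := by gcongr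
            _ ≤ _ := by linarith
        have e8 : τ * ‖m⁻¹ * (e - y)‖ ≤ 2 * 2 ^ P.1 :=
          (mul_le_of_le_one_left (norm_nonneg _) hτ1).trans e7
        have e9 : 0 ≤ τ * ‖m⁻¹ * (e - y)‖ := by positivity
        rw [e6] at e5
        nlinarith
      obtain ⟨d0, d1, z, hz, hz0, hz1, hz2⟩ := hTc v _ hn hv
      refine ⟨d0, ?_⟩
      have hd0 := norm_pos_iff.2 d0
      generalize ev2 (pderiv 0 G) (v, y + τ * (e - y)) = F₁ at *
      generalize ev2 (pderiv 1 G) (v, y + τ * (e - y)) = F₂ at *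
      have e5 : ‖F₂ + m⁻¹ * F₁‖ = ‖(-F₁ / F₂)⁻¹ - m⁻¹‖ * ‖F₁‖ := by
        rw [← norm_mul, ← norm_neg]; congr 1; field_simp; ring
      rw [e5, ← mul_assoc] at hsl ⊢
      have hw : -F₁ / F₂ ≠ 0 := div_ne_zero (neg_ne_zero.2 d0) d1
      refine mul_le_mul_of_nonneg_right (hgap _ z⁻¹ (Finset.mem_image_of_mem _ hz) ?_
        (le_of_mul_le_mul_right hsl hd0)) hd0.le
      rw [inv_sub_inv hw hz0, norm_div, norm_mul, norm_inv, norm_sub_rev,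
        div_le_iff₀ (mul_pos (norm_pos_iff.2 hw) (norm_pos_iff.2 hz0))]
      refine hz2.trans_eq ?_
      have hw' := norm_ne_zero_iff.2 hw
      generalize ‖-F₁ / F₂‖ = w at *
      field_simp)
    rw [add_sub_cancel] at e1 e3 e4
    exact ⟨v, e1, e4, e2.trans (by gcongr), e3.trans (by gcongr)⟩

end Away

section Crossing

lemma totalDegree_pos_of_irreducible {h : MvPolynomial (Fin 2) ℂ} (hh : Irreducible h) :
    0 < h.totalDegree := by
  by_contra! h0
  have hC := totalDegree_eq_zero_iff_eq_C.1 (Nat.le_zero.1 h0)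
  refine hh.not_isUnit ?_
  rw [hC] at hh ⊢
  exact (isUnit_iff_ne_zero.2 fun h1 => hh.ne_zero (by rw [h1, map_zero])).map C

/-- A plane curve is a union of boundedly many irreducible ones. -/
lemma exists_irreducible_factors {g : MvPolynomial (Fin 2) ℂ} (hg : g ≠ 0) :
    ∃ I : Finset (MvPolynomial (Fin 2) ℂ), I.card ≤ g.totalDegree ∧
      (∀ h ∈ I, Irreducible h ∧ h ∣ g ∧ h.totalDegree ≤ g.totalDegree) ∧
      ∀ p, ev2 g p = 0 → ∃ h ∈ I, ev2 h p = 0 := by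
  classical
  induction hn : g.totalDegree using Nat.strong_induction_on generalizing g with
  | _ n ih =>
    subst hn
    by_cases hu : IsUnit g
    · refine ⟨∅, by simp, by simp, fun p hp => ?_⟩
      have h1 := hu.map (eval ![p.1, p.2])
      exact absurd hp h1.ne_zero
    · obtain ⟨h, hh, k, rfl⟩ := WfDvdMonoid.exists_irreducible_factor hu hg
      have hk : k ≠ 0 := right_ne_zero_of_mul hg
      have hdeg := totalDegree_mul_of_isDomain hh.ne_zero hk
      have hpos := totalDegree_pos_of_irreducible hh
      obtain ⟨I, hI, hI1, hI2⟩ := ih k.totalDegree (by omega) hk rfl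
      refine ⟨insert h I, (Finset.card_insert_le _ _).trans (by omega), ?_, fun p hp => ?_⟩
      · intro f hf
        rcases Finset.mem_insert.1 hf with rfl | hf
        · exact ⟨hh, dvd_mul_right _ _, by omega⟩
        · obtain ⟨a, b, c⟩ := hI1 f hf
          exact ⟨a, b.mul_left _, by omega⟩
      · rw [ev2_mul] at hp
        rcases mul_eq_zero.1 hp with hp | hp
        · exact ⟨h, Finset.mem_insert_self _ _, hp⟩
        · obtain ⟨f, hf, hf0⟩ := hI2 p hp
          exact ⟨f, Finset.mem_insert_of_mem hf, hf0⟩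

lemma ev2_eq_of_pderiv_one_eq_zero {G : MvPolynomial (Fin 2) ℂ} (h : pderiv 1 G = 0) (x y y' : ℂ) :
    ev2 G (x, y) = ev2 G (x, y') := by
  have hd : ∀ t : ℂ, HasDerivAt (fun t => ev2 G (x, t)) 0 t := by
    intro t
    have h1 := (hasStrictFDerivAt_ev2 G (x, t)).hasFDerivAt.comp_hasDerivAt t
      ((hasDerivAt_const t x).prodMk (hasDerivAt_id t))
    simpa [h, Function.comp_def] using h1
  exact is_const_of_deriv_eq_zero (fun t => (hd t).differentiableAt) (fun t => (hd t).deriv) y y'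

lemma pderiv_zero_ne_zero_of_pderiv_one_eq_zero {G : MvPolynomial (Fin 2) ℂ} (hG : Irreducible G)
    (h : pderiv 1 G = 0) : pderiv 0 G ≠ 0 := by
  intro h0
  have h2 : pderiv 1 (swapVars G) = 0 := by rw [pderiv_swapVars_one, h0, map_zero]
  have hc : ∀ p, ev2 (G - C (ev2 G (0, 0))) p = 0 := by
    rintro ⟨x, y⟩
    have e1 := ev2_eq_of_pderiv_one_eq_zero h x y 0
    have e2 := ev2_eq_of_pderiv_one_eq_zero h2 0 x 0
    simp only [ev2_swapVars] at e2
    rw [ev2_sub, ev2_C, e1, e2, sub_self]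
  have h3 := totalDegree_pos_of_irreducible hG
  rw [sub_eq_zero.1 (eq_zero_of_ev2 hc), totalDegree_C] at h3
  exact h3.false

lemma fewPairs_of_mem_left (T : Finset ℂ) (Q Q' : Finset (ℤ × ℤ × ℤ)) :
    FewPairs T.card Q Q' fun P _ => ∃ x ∈ T, IsCell Q P x := by
  classical
  refine fewPairs_of_right fun R _ => ⟨T.biUnion fun x => Q.filter fun P => IsCell Q P x, ?_, ?_⟩
  · refine (Finset.card_biUnion_le_card_mul _ _ 1 fun x _ => ?_).trans (mul_one _).le
    exact Finset.card_le_one.2 fun P hP P' hP' =>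
      (Finset.mem_filter.1 hP).2.eq (Finset.mem_filter.1 hP').2
  · rintro P hP ⟨x, hx, hc⟩
    exact Finset.mem_biUnion.2 ⟨x, hx, Finset.mem_filter.2 ⟨hP, hc⟩⟩

lemma fewPairs_of_pderiv_one_eq_zero (D : ℕ) : ∃ c : ℕ, ∀ G : MvPolynomial (Fin 2) ℂ,
    Irreducible G → G.totalDegree ≤ D → pderiv 1 G = 0 → ∀ Q Q' : Finset (ℤ × ℤ × ℤ),
      FewPairs c Q Q' fun P R => ∃ x y, IsCell Q P x ∧ IsCell Q' R y ∧ ev2 G (x, y) = 0 := by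
  classical
  obtain ⟨B, hB⟩ := exists_card_common_zeros_le D 1
  refine ⟨B, fun G hG hD h1 Q Q' => ?_⟩
  have h0 := pderiv_zero_ne_zero_of_pderiv_one_eq_zero hG h1
  obtain ⟨T, hT, hTz⟩ := hB G (X 1 - C 0) hG hD ((totalDegree_sub _ _).trans (by simp))
    (not_dvd_X_sub_C (by decide) h0 0)
  refine (fewPairs_of_mem_left (T.image Prod.fst) Q Q').mono (Finset.card_image_le.trans hT) ?_
  rintro P - R - ⟨x, y, hx, -, hxy⟩
  rw [ev2_eq_of_pderiv_one_eq_zero h1 x y 0] at hxy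
  exact ⟨x, Finset.mem_image.2 ⟨(x, 0), hTz _ hxy (by simp), rfl⟩, hx⟩

lemma fewPairs_of_irreducible (D : ℕ) : ∃ c : ℕ, ∀ G : MvPolynomial (Fin 2) ℂ,
    Irreducible G → G.totalDegree ≤ D → ∀ Q Q' : Finset (ℤ × ℤ × ℤ),
      FewPairs c Q Q' fun P R => ∃ x y, IsCell Q P x ∧ IsCell Q' R y ∧ ev2 G (x, y) = 0 := by
  classical
  obtain ⟨B, K, c, hc⟩ := fewPairs_away D
  obtain ⟨c', hc'⟩ := fewPairs_near_point D K
  obtain ⟨c₁, hc₁⟩ := fewPairs_of_pderiv_one_eq_zero D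
  refine ⟨c + c + B * B * c' + c₁, fun G hG hD Q Q' => ?_⟩
  have hG' : Irreducible (swapVars G) := (MulEquiv.irreducible_iff swapVars).2 hG
  have hD' : (swapVars G).totalDegree ≤ D := (totalDegree_swapVars G).trans_le hD
  by_cases h1 : pderiv 1 G = 0
  · exact (hc₁ G hG hD h1 Q Q').mono (by omega) fun _ _ _ _ h => h
  by_cases h0 : pderiv 0 G = 0
  · refine (hc₁ (swapVars G) hG' hD' (by rw [pderiv_swapVars_one, h0, map_zero]) Q' Q).flip.mono
      (by omega) ?_
    rintro P - R - ⟨x, y, hx, hy, hxy⟩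
    exact ⟨y, x, hy, hx, by rwa [ev2_swapVars]⟩
  obtain ⟨V, hV, hVf⟩ := hc G hG hD h0 h1
  obtain ⟨W, hW, hWf⟩ := hc (swapVars G) hG' hD'
    (by rw [pderiv_swapVars_zero]; simpa using h1) (by rw [pderiv_swapVars_one]; simpa using h0)
  refine (((hVf Q Q').or (hWf Q' Q).flip).or (FewPairs.exists (V ×ˢ W) fun z _ =>
    hc' G hG.ne_zero hD z.1 z.2 Q Q')).mono (c' := c + c + B * B * c' + c₁) ?_ ?_
  · rw [Finset.card_product]
    have := Nat.mul_le_mul_right c' (Nat.mul_le_mul hV hW)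
    omega
  rintro P - R - ⟨x, y, hx, hy, hxy⟩
  by_cases hv : ∃ v ∈ V, ‖x - v‖ ≤ 2 ^ K * 2 ^ P.1
  swap
  · push Not at hv
    exact Or.inl (Or.inl ⟨x, y, hx, hy, hxy, hv⟩)
  by_cases hw : ∃ w ∈ W, ‖y - w‖ ≤ 2 ^ K * 2 ^ R.1
  swap
  · push Not at hw
    exact Or.inl (Or.inr ⟨y, x, hy, hx, by rwa [ev2_swapVars], hw⟩)
  obtain ⟨v, hv, hxv⟩ := hv
  obtain ⟨w, hw, hyw⟩ := hw
  exact Or.inr ⟨(v, w), Finset.mem_product.2 ⟨hv, hw⟩, x, y, hx, hy, hxy, hxv, hyw⟩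

/-- A plane curve meets linearly many pairs of cells of two dyadic partitions. -/
theorem fewPairs_curve (D : ℕ) : ∃ c : ℕ, ∀ g : MvPolynomial (Fin 2) ℂ,
    g ≠ 0 → g.totalDegree ≤ D → ∀ Q Q' : Finset (ℤ × ℤ × ℤ),
      FewPairs c Q Q' fun P R => ∃ x y, IsCell Q P x ∧ IsCell Q' R y ∧ ev2 g (x, y) = 0 := by
  obtain ⟨c, hc⟩ := fewPairs_of_irreducible D
  refine ⟨D * c, fun g hg hD Q Q' => ?_⟩
  obtain ⟨I, hI, hI1, hI2⟩ := exists_irreducible_factors hg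
  refine (FewPairs.exists I fun h hh => hc h (hI1 h hh).1 ((hI1 h hh).2.2.trans hD) Q Q').mono
    (Nat.mul_le_mul_right _ (hI.trans hD)) ?_
  rintro P - R - ⟨x, y, hx, hy, hxy⟩
  obtain ⟨h, hh, h0⟩ := hI2 _ hxy
  exact ⟨h, hh, x, y, hx, hy, h0⟩

end Crossing

section Incidences

open Classical in
lemma card_le_mul_card_image_add_card_pairs {α β : Type*} [DecidableEq β]
    (J : Finset α) (K : α → β)
    (E : α → α → Prop) (Δ : ℕ) (hE : ∀ p ∈ J, (J.filter (E p)).card ≤ Δ) :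
    J.card ≤ Δ * (J.image K).card +
      ((J ×ˢ J).filter fun z => K z.1 = K z.2 ∧ ¬ E z.1 z.2).card := by
  set J₁ := J.filter fun p => ∃ p' ∈ J, K p = K p' ∧ ¬ E p p'
  set J₂ := J.filter fun p => ¬ ∃ p' ∈ J, K p = K p' ∧ ¬ E p p'
  have h1 : J₁.card ≤ ((J ×ˢ J).filter fun z => K z.1 = K z.2 ∧ ¬ E z.1 z.2).card := by
    refine (Finset.card_le_card fun p hp => ?_).trans
      (Finset.card_image_le (f := Prod.fst))
    obtain ⟨hp, p', hp', h⟩ := Finset.mem_filter.1 hp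
    exact Finset.mem_image.2 ⟨(p, p'), Finset.mem_filter.2 ⟨Finset.mem_product.2 ⟨hp, hp'⟩, h⟩, rfl⟩
  have h2 : J₂.card ≤ Δ * (J.image K).card := by
    refine (Finset.card_le_mul_card_image (f := K) J₂ Δ fun b hb => ?_).trans
      (Nat.mul_le_mul_left _ (Finset.card_le_card
        (Finset.image_subset_image (Finset.filter_subset _ _))))
    obtain ⟨p, hp, rfl⟩ := Finset.mem_image.1 hb
    obtain ⟨hp, hne⟩ := Finset.mem_filter.1 hp
    refine (Finset.card_le_card fun p' hp' => ?_).trans (hE p hp)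
    obtain ⟨hp', hK⟩ := Finset.mem_filter.1 hp'
    have hp' := (Finset.mem_filter.1 hp').1
    refine Finset.mem_filter.2 ⟨hp', ?_⟩
    by_contra h
    exact hne ⟨p', hp', hK.symm, h⟩
  have h3 : J₁.card + J₂.card = J.card := Finset.card_filter_add_card_filter_not _
  omega

open Classical in
/-- Incidences between pairs of points and plane curves of bounded degree, counted with the help of
a dyadic partition with parameter `m`. -/
lemma card_incidences_le_of_partition (D : ℕ) : ∃ c : ℕ, ∀ (Δ M μ m : ℕ) {α β : Type}
    (S : Finset α) (X : α → ℂ) (T : Finset β) (G : β → MvPolynomial (Fin 2) ℂ)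
    (inc : α × α → β → Prop) (E : α × α → α × α → Prop), 1 ≤ m →
    (∀ z, (S.filter fun x => X x = z).card ≤ μ) →
    (∀ t ∈ T, G t ≠ 0 ∧ (G t).totalDegree ≤ D) →
    (∀ t ∈ T, ∀ p ∈ S ×ˢ S, inc p t → ev2 (G t) (X p.1, X p.2) = 0) →
    (∀ p ∈ S ×ˢ S, ((S ×ˢ S).filter (E p)).card ≤ Δ) →
    (∀ p ∈ S ×ˢ S, ∀ p' ∈ S ×ˢ S, ¬ E p p' → (T.filter fun t => inc p t ∧ inc p' t).card ≤ M) →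
    ∃ q : ℕ, m * q ≤ 4 * S.card + 4 * m ∧
      ∑ t ∈ T, ((S ×ˢ S).filter fun p => inc p t).card ≤
        T.card * (Δ * (c * (q + q))) + S.card ^ 2 * (μ * m) ^ 2 * M := by
  obtain ⟨c, hc⟩ := fewPairs_curve D
  refine ⟨c, fun Δ M μ m α β S X T G inc E hm hμ hG hinc hE hM => ?_⟩
  obtain ⟨Q, hQ, hcov, hcell⟩ := exists_dyadic_partition (S.image X) m hm
  refine ⟨Q.card, hQ.trans (by gcongr; exact Finset.card_image_le), ?_⟩
  choose! κ hκ using hcov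
  have hκ' : ∀ x ∈ S, IsCell Q (κ (X x)) (X x) := fun x hx => hκ _ (Finset.mem_image_of_mem _ hx)
  set K : α × α → (ℤ × ℤ × ℤ) × (ℤ × ℤ × ℤ) := fun p => (κ (X p.1), κ (X p.2)) with hK
  have hfib : ∀ P ∈ Q, (S.filter fun x => κ (X x) = P).card ≤ μ * m := by
    intro P hP
    refine (Finset.card_le_mul_card_image (f := X) _ μ fun z _ => ?_).trans
      (Nat.mul_le_mul_left _ ((Finset.card_le_card ?_).trans (hcell P hP)))
    · refine (Finset.card_le_card ?_).trans (hμ z)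
      exact Finset.filter_subset_filter _ (Finset.filter_subset _ _)
    · intro z hz
      obtain ⟨x, hx, rfl⟩ := Finset.mem_image.1 hz
      obtain ⟨hx', hxP⟩ := Finset.mem_filter.1 hx
      exact Finset.mem_filter.2 ⟨Finset.mem_image_of_mem _ hx', hxP ▸ hκ' x hx'⟩
  set N := ((S ×ˢ S) ×ˢ (S ×ˢ S)).filter fun z => K z.1 = K z.2 ∧ ¬ E z.1 z.2
  have hN : N.card ≤ S.card ^ 2 * (μ * m) ^ 2 := by
    have e : S.card ^ 2 = (S ×ˢ S).card := by rw [Finset.card_product, sq]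
    rw [e, mul_comm]
    refine (Finset.card_le_mul_card_image_of_maps_to (f := Prod.fst) (t := S ×ˢ S)
      (fun z hz => (Finset.mem_product.1 (Finset.mem_filter.1 hz).1).1) _ fun p hp => ?_)
    obtain ⟨hp1, hp2⟩ := Finset.mem_product.1 hp
    refine (Finset.card_le_card_of_injOn Prod.snd (t := (S.filter fun x => κ (X x) = κ (X p.1)) ×ˢ
      (S.filter fun x => κ (X x) = κ (X p.2))) ?_ ?_).trans ?_
    · rintro z hz
      obtain ⟨hzN, rfl⟩ := Finset.mem_filter.1 (Finset.mem_coe.1 hz)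
      obtain ⟨hz', hKz, -⟩ := Finset.mem_filter.1 hzN
      obtain ⟨h1, h2⟩ := Prod.ext_iff.1 hKz
      have hz2 := Finset.mem_product.1 (Finset.mem_product.1 hz').2
      exact Finset.mem_coe.2 (Finset.mem_product.2 ⟨Finset.mem_filter.2 ⟨hz2.1, h1.symm⟩,
        Finset.mem_filter.2 ⟨hz2.2, h2.symm⟩⟩)
    · intro z hz w hw h
      have h1 := (Finset.mem_filter.1 (Finset.mem_coe.1 hz)).2
      have h2 := (Finset.mem_filter.1 (Finset.mem_coe.1 hw)).2
      exact Prod.ext (h1.trans h2.symm) h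
    · rw [Finset.card_product, sq]
      exact Nat.mul_le_mul (hfib _ (hκ' _ hp1).1) (hfib _ (hκ' _ hp2).1)
  have h1 : ∀ t ∈ T, ((S ×ˢ S).filter fun p => inc p t).card ≤ Δ * (c * (Q.card + Q.card)) +
      (N.filter fun z => inc z.1 t ∧ inc z.2 t).card := by
    intro t ht
    refine (card_le_mul_card_image_add_card_pairs _ K E Δ fun p hp => ?_).trans (add_le_add
      (Nat.mul_le_mul_left _ (le_trans (Finset.card_le_card ?_)
        (hc (G t) (hG t ht).1 (hG t ht).2 Q Q))) (Finset.card_le_card ?_))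
    · exact (Finset.card_le_card (Finset.filter_subset_filter _ (Finset.filter_subset _ _))).trans
        (hE p (Finset.mem_filter.1 hp).1)
    · intro z hz
      obtain ⟨p, hp, rfl⟩ := Finset.mem_image.1 hz
      obtain ⟨hp, hpt⟩ := Finset.mem_filter.1 hp
      obtain ⟨hp1, hp2⟩ := Finset.mem_product.1 hp
      exact Finset.mem_filter.2 ⟨Finset.mem_product.2 ⟨(hκ' _ hp1).1, (hκ' _ hp2).1⟩,
        _, _, hκ' _ hp1, hκ' _ hp2, hinc t ht p hp hpt⟩
    · intro z hz
      simp only [N, Finset.mem_filter, Finset.mem_product] at hz ⊢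
      tauto
  have h2 : ∑ t ∈ T, (N.filter fun z => inc z.1 t ∧ inc z.2 t).card ≤ N.card * M := by
    refine (Finset.sum_card_bipartiteAbove_eq_sum_card_bipartiteBelow (s := T) (t := N)
      (r := fun t (z : (α × α) × (α × α)) => inc z.1 t ∧ inc z.2 t)).trans_le ?_
    refine Finset.sum_le_card_nsmul _ _ _ fun z hz => ?_
    obtain ⟨hz, -, hzE⟩ := Finset.mem_filter.1 hz
    obtain ⟨hz1, hz2⟩ := Finset.mem_product.1 hz
    exact hM _ hz1 _ hz2 hzE
  calc _ ≤ ∑ t ∈ T, (Δ * (c * (Q.card + Q.card)) +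
      (N.filter fun z => inc z.1 t ∧ inc z.2 t).card) := Finset.sum_le_sum h1
    _ ≤ _ := by
      rw [Finset.sum_add_distrib, Finset.sum_const, smul_eq_mul]
      exact add_le_add le_rfl (h2.trans (Nat.mul_le_mul_right _ hN))

open Classical in
/-- Pairs of points of an `n`-element set and `n ^ 2` plane curves of bounded degree, any two
non-exceptional pairs being on boundedly many common curves, have `O(n ^ (8 / 3))` incidences. -/
theorem card_incidences_le (D Δ M μ : ℕ) : ∃ c : ℝ, 0 ≤ c ∧ ∀ {α β : Type}
    (S : Finset α) (X : α → ℂ) (T : Finset β) (G : β → MvPolynomial (Fin 2) ℂ)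
    (inc : α × α → β → Prop) (E : α × α → α × α → Prop), T.card ≤ S.card ^ 2 →
    (∀ z, (S.filter fun x => X x = z).card ≤ μ) →
    (∀ t ∈ T, G t ≠ 0 ∧ (G t).totalDegree ≤ D) →
    (∀ t ∈ T, ∀ p ∈ S ×ˢ S, inc p t → ev2 (G t) (X p.1, X p.2) = 0) →
    (∀ p ∈ S ×ˢ S, ((S ×ˢ S).filter (E p)).card ≤ Δ) →
    (∀ p ∈ S ×ˢ S, ∀ p' ∈ S ×ˢ S, ¬ E p p' → (T.filter fun t => inc p t ∧ inc p' t).card ≤ M) →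
    ((∑ t ∈ T, ((S ×ˢ S).filter fun p => inc p t).card : ℕ) : ℝ) ≤
      c * (S.card : ℝ) ^ ((8 : ℝ) / 3) := by
  obtain ⟨c, hc⟩ := card_incidences_le_of_partition D
  refine ⟨Δ * (c * (8 + 8)) + (μ * 2) ^ 2 * M, by positivity,
    fun {α β} S X T G inc E hT hμ hG hinc hE hM => ?_⟩
  rcases Finset.eq_empty_or_nonempty S with rfl | hS
  · simp
  have hn : (1 : ℝ) ≤ S.card := by exact_mod_cast hS.card_pos
  set n : ℝ := (S.card : ℝ) with hnd
  set u : ℝ := n ^ ((1 : ℝ) / 3) with hu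
  have hu1 : 1 ≤ u := Real.one_le_rpow hn (by norm_num)
  have hu3 : u ^ 3 = n := by
    rw [hu, ← Real.rpow_natCast, ← Real.rpow_mul (by linarith)]; norm_num
  have hu8 : n ^ ((8 : ℝ) / 3) = u ^ 8 := by
    rw [hu, ← Real.rpow_natCast, ← Real.rpow_mul (by linarith)]; norm_num
  set m := ⌈u⌉₊ with hm
  have hm1 : u ≤ m := Nat.le_ceil u
  have hm2 : (m : ℝ) ≤ 2 * u := by
    have := Nat.ceil_lt_add_one (show 0 ≤ u by linarith)
    linarith
  obtain ⟨q, hq, hI⟩ := hc Δ M μ m S X T G inc E (Nat.ceil_pos.2 (by linarith)) hμ hG hinc hE hM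
  have hq' : (m : ℝ) * q ≤ 4 * n + 4 * m := by rw [hnd]; exact_mod_cast hq
  have hq8 : (q : ℝ) ≤ 8 * u ^ 2 := by
    have h1 : (m : ℝ) * q ≤ m * (8 * u ^ 2) := by
      have h2 : n ≤ m * u ^ 2 := by
        rw [← hu3]; nlinarith [sq_nonneg u]
      nlinarith [one_le_pow₀ hu1 (n := 2)]
    exact le_of_mul_le_mul_left h1 (by linarith)
  have hT' : (T.card : ℝ) ≤ u ^ 6 := by
    have : (T.card : ℝ) ≤ n ^ 2 := by rw [hnd]; exact_mod_cast hT
    rwa [← hu3, ← pow_mul] at this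
  have h2 : ((∑ t ∈ T, ((S ×ˢ S).filter fun p => inc p t).card : ℕ) : ℝ) ≤
      T.card * (Δ * (c * (q + q))) + n ^ 2 * (μ * m) ^ 2 * M := by
    rw [hnd]; exact_mod_cast hI
  refine h2.trans ?_
  calc (T.card : ℝ) * (Δ * (c * (q + q))) + n ^ 2 * (μ * m) ^ 2 * M
      ≤ u ^ 6 * (Δ * (c * (8 * u ^ 2 + 8 * u ^ 2))) + n ^ 2 * (μ * (2 * u)) ^ 2 * M := by gcongr
    _ = _ := by rw [hu8, ← hu3]; ring

end Incidences

section LiftedPoints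

/-- The polar form of the quadric `w₀ w₃ = w₁² + w₂²`, which carries the lifts of points of `ℂ²`. -/
def qB (u v : Fin 4 → ℂ) : ℂ := u 0 * v 3 + u 3 * v 0 - 2 * (u 1 * v 1) - 2 * (u 2 * v 2)

/-- The lift of a point of `ℂ²` to the quadric; circles and lines become plane sections. -/
def lift (p : ℂ × ℂ) : Fin 4 → ℂ := ![p.1 ^ 2 + p.2 ^ 2, p.1, p.2, 1]

@[simp] lemma lift_apply_zero (p : ℂ × ℂ) : lift p 0 = p.1 ^ 2 + p.2 ^ 2 := rfl
@[simp] lemma lift_apply_one (p : ℂ × ℂ) : lift p 1 = p.1 := rfl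
@[simp] lemma lift_apply_two (p : ℂ × ℂ) : lift p 2 = p.2 := rfl
@[simp] lemma lift_apply_three (p : ℂ × ℂ) : lift p 3 = 1 := rfl

lemma qB_comm (u v : Fin 4 → ℂ) : qB u v = qB v u := by simp only [qB]; ring

@[simp] lemma qB_add_left (u u' v : Fin 4 → ℂ) : qB (u + u') v = qB u v + qB u' v := by
  simp only [qB, Pi.add_apply]; ring

@[simp] lemma qB_sub_left (u u' v : Fin 4 → ℂ) : qB (u - u') v = qB u v - qB u' v := by
  simp only [qB, Pi.sub_apply]; ring

@[simp] lemma qB_smul_left (a : ℂ) (u v : Fin 4 → ℂ) : qB (a • u) v = a * qB u v := by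
  simp only [qB, Pi.smul_apply, smul_eq_mul]; ring

@[simp] lemma qB_neg_left (u v : Fin 4 → ℂ) : qB (-u) v = - qB u v := by
  simp only [qB, Pi.neg_apply]; ring

@[simp] lemma qB_zero_left (v : Fin 4 → ℂ) : qB 0 v = 0 := by simp [qB]

@[simp] lemma qB_add_right (u v v' : Fin 4 → ℂ) : qB u (v + v') = qB u v + qB u v' := by
  simp only [qB, Pi.add_apply]; ring

@[simp] lemma qB_sub_right (u v v' : Fin 4 → ℂ) : qB u (v - v') = qB u v - qB u v' := by
  simp only [qB, Pi.sub_apply]; ring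

@[simp] lemma qB_smul_right (a : ℂ) (u v : Fin 4 → ℂ) : qB u (a • v) = a * qB u v := by
  simp only [qB, Pi.smul_apply, smul_eq_mul]; ring

@[simp] lemma qB_neg_right (u v : Fin 4 → ℂ) : qB u (-v) = - qB u v := by
  simp only [qB, Pi.neg_apply]; ring

@[simp] lemma qB_zero_right (u : Fin 4 → ℂ) : qB u 0 = 0 := by simp [qB]

@[simp] lemma qB_lift_self (p : ℂ × ℂ) : qB (lift p) (lift p) = 0 := by simp [qB]; ring

lemma qB_lift_lift (p q : ℂ × ℂ) :
    qB (lift p) (lift q) = (p.1 - q.1) ^ 2 + (p.2 - q.2) ^ 2 := by simp [qB]; ring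

lemma lift_eq_smul {p q : ℂ × ℂ} {c : ℂ} (h : lift p = c • lift q) : p = q := by
  have h3 := congrFun h 3
  have h1 := congrFun h 1
  have h2 := congrFun h 2
  simp at h1 h2 h3
  subst h3
  exact Prod.ext (by simpa using h1) (by simpa using h2)

lemma eq_of_smul_lift_eq {p q : ℂ × ℂ} {a b : ℂ} (ha : a ≠ 0) (h : a • lift p = b • lift q) :
    p = q := by
  refine lift_eq_smul (c := a⁻¹ * b) ?_
  rw [mul_smul, ← h, smul_smul, inv_mul_cancel₀ ha, one_smul]

lemma eq_smul_lift_of_isotropic {w : Fin 4 → ℂ} (h : qB w w = 0) (h3 : w 3 ≠ 0) :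
    w = w 3 • lift (w 1 / w 3, w 2 / w 3) := by
  simp only [qB] at h
  ext i
  fin_cases i
  · simp
    field_simp
    linear_combination h / 2
  · simp; field_simp
  · simp; field_simp
  · simp

/-- An isotropic vector on the line spanned by two non-orthogonal lifted points is a multiple of
one of them. -/
lemma eq_or_eq_of_lift_eq {p x y : ℂ × ℂ} {a b : ℂ} (h : lift p = a • lift x + b • lift y)
    (hxy : qB (lift x) (lift y) ≠ 0) : p = x ∨ p = y := by
  have h0 := qB_lift_self p
  rw [h] at h0
  simp only [qB_add_left, qB_add_right, qB_smul_left, qB_smul_right, qB_lift_self,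
    qB_comm (lift y) (lift x)] at h0
  have : a * b = 0 := by
    have : (a * b) * qB (lift x) (lift y) = 0 := by linear_combination h0 / 2
    exact (mul_eq_zero.1 this).resolve_right hxy
  rcases mul_eq_zero.1 this with rfl | rfl
  · right; exact lift_eq_smul (by simpa using h)
  · left; exact lift_eq_smul (by simpa using h)

/-- The half-turn about the line through `v`, for `v` normalised by `qB v v = 2`. -/
def reflect (v u : Fin 4 → ℂ) : Fin 4 → ℂ := qB v u • v - u

lemma reflect_reflect {v : Fin 4 → ℂ} (hv : qB v v = 2) (u : Fin 4 → ℂ) :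
    reflect v (reflect v u) = u := by
  simp only [reflect, qB_sub_right, qB_smul_right, hv]
  module

lemma qB_reflect_reflect {v : Fin 4 → ℂ} (hv : qB v v = 2) (u w : Fin 4 → ℂ) :
    qB (reflect v u) (reflect v w) = qB u w := by
  simp only [reflect, qB_sub_right, qB_smul_right, qB_sub_left, qB_smul_left, hv, qB_comm u v]
  ring

lemma reflect_smul (v u : Fin 4 → ℂ) (a : ℂ) : reflect v (a • u) = a • reflect v u := by
  simp only [reflect, qB_smul_right]; module

lemma reflect_neg_left (v u : Fin 4 → ℂ) : reflect (-v) u = reflect v u := by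
  simp only [reflect, qB_neg_left]; module

lemma reflect_reflect_left {v : Fin 4 → ℂ} (hv : qB v v = 2) (w u : Fin 4 → ℂ) :
    reflect (reflect v w) u = reflect v (reflect w (reflect v u)) := by
  simp only [reflect, qB_sub_right, qB_smul_right, qB_sub_left, qB_smul_left, hv, qB_comm w v]
  module

lemma exists_qB_ne_zero {u : Fin 4 → ℂ} (hu : u ≠ 0) : ∃ w, qB u w ≠ 0 := by
  by_contra! h
  apply hu
  have h0 := h (Pi.single 0 1)
  have h1 := h (Pi.single 1 1)
  have h2 := h (Pi.single 2 1)
  have h3 := h (Pi.single 3 1)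
  simp [qB] at h0 h1 h2 h3
  ext i
  fin_cases i <;> simp [h0, h1, h2, h3]

/-- Three vectors are orthogonal to a common nonzero vector. -/
lemma exists_orthogonal (w : Fin 3 → Fin 4 → ℂ) : ∃ u : Fin 4 → ℂ, u ≠ 0 ∧ ∀ i, qB u (w i) = 0 := by
  let T : (Fin 4 → ℂ) →ₗ[ℂ] (Fin 3 → ℂ) :=
    { toFun := fun u i => qB u (w i)
      map_add' := fun u v => by ext i; simp
      map_smul' := fun a u => by ext i; simp }
  have hT : LinearMap.ker T ≠ ⊥ := LinearMap.ker_ne_bot_of_finrank_lt (by simp)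
  obtain ⟨u, hu, hu0⟩ := Submodule.exists_mem_ne_zero_of_ne_bot hT
  exact ⟨u, hu0, fun i => congrFun (LinearMap.mem_ker.1 hu) i⟩

lemma exists_orthogonal_three (w₁ w₂ w₃ : Fin 4 → ℂ) :
    ∃ u : Fin 4 → ℂ, u ≠ 0 ∧ qB u w₁ = 0 ∧ qB u w₂ = 0 ∧ qB u w₃ = 0 := by
  obtain ⟨u, hu, h⟩ := exists_orthogonal ![w₁, w₂, w₃]
  exact ⟨u, hu, h 0, h 1, h 2⟩

/-- Vectors `A, B, A', B'` dual to `x, y, x', y'` with respect to `qB`. -/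
structure IsDual (x y x' y' A B A' B' : Fin 4 → ℂ) : Prop where
  Ax : qB A x = 1
  Ay : qB A y = 0
  Ax' : qB A x' = 0
  Ay' : qB A y' = 0
  Bx : qB B x = 0
  By : qB B y = 1
  Bx' : qB B x' = 0
  By' : qB B y' = 0
  prime_A_x : qB A' x = 0
  prime_A_y : qB A' y = 0
  prime_A_x' : qB A' x' = 1
  prime_A_y' : qB A' y' = 0
  prime_B_x : qB B' x = 0
  prime_B_y : qB B' y = 0
  prime_B_x' : qB B' x' = 0
  prime_B_y' : qB B' y' = 1
  expand : ∀ w, (qB A w • x + qB B w • y) + (qB A' w • x' + qB B' w • y') = w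

/-- Four vectors either lie in a common plane or have a dual system. -/
lemma exists_orthogonal_or_isDual (x y x' y' : Fin 4 → ℂ) :
    (∃ u : Fin 4 → ℂ, u ≠ 0 ∧ qB u x = 0 ∧ qB u y = 0 ∧ qB u x' = 0 ∧ qB u y' = 0) ∨
    ∃ A B A' B', IsDual x y x' y' A B A' B' := by
  let T : (Fin 4 → ℂ) →ₗ[ℂ] (Fin 4 → ℂ) :=
    { toFun := fun u => ![qB u x, qB u y, qB u x', qB u y']
      map_add' := fun u v => by ext i; fin_cases i <;> simp
      map_smul' := fun a u => by ext i; fin_cases i <;> simp }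
  by_cases hT : LinearMap.ker T = ⊥
  · right
    have hs : Function.Surjective T := LinearMap.surjective_of_injective (LinearMap.ker_eq_bot.1 hT)
    obtain ⟨A, hA⟩ := hs ![1, 0, 0, 0]
    obtain ⟨B, hB⟩ := hs ![0, 1, 0, 0]
    obtain ⟨A', hA'⟩ := hs ![0, 0, 1, 0]
    obtain ⟨B', hB'⟩ := hs ![0, 0, 0, 1]
    have key : ∀ {U c}, T U = c → qB U x = c 0 ∧ qB U y = c 1 ∧ qB U x' = c 2 ∧ qB U y' = c 3 := by
      rintro U c rfl
      exact ⟨rfl, rfl, rfl, rfl⟩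
    obtain ⟨a1, a2, a3, a4⟩ := key hA
    obtain ⟨b1, b2, b3, b4⟩ := key hB
    obtain ⟨c1, c2, c3, c4⟩ := key hA'
    obtain ⟨d1, d2, d3, d4⟩ := key hB'
    simp at a1 a2 a3 a4 b1 b2 b3 b4 c1 c2 c3 c4 d1 d2 d3 d4
    refine ⟨A, B, A', B', a1, a2, a3, a4, b1, b2, b3, b4, c1, c2, c3, c4, d1, d2, d3, d4, ?_⟩
    intro w
    by_contra hw
    obtain ⟨u, hu⟩ := exists_qB_ne_zero (sub_ne_zero.2 (Ne.symm hw))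
    apply hu
    have hu : u = qB u x • A + qB u y • B + qB u x' • A' + qB u y' • B' := by
      apply LinearMap.ker_eq_bot.1 hT
      ext i
      fin_cases i <;> simp [T, a1, a2, a3, a4, b1, b2, b3, b4, c1, c2, c3, c4, d1, d2, d3, d4]
    rw [qB_comm]
    have h1 := congrArg (fun z => qB z w) hu
    simp only [qB_add_left, qB_smul_left] at h1
    simp only [qB_add_right, qB_smul_right, qB_sub_right]
    linear_combination h1
  · left
    obtain ⟨u, hu, hu0⟩ := Submodule.exists_mem_ne_zero_of_ne_bot hT
    have h := LinearMap.mem_ker.1 hu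
    exact ⟨u, hu0, congrFun h 0, congrFun h 1, congrFun h 2, congrFun h 3⟩

/-- A difference of products of linear forms that vanishes on all lifted points is a multiple of
the quadratic form of `qB`. -/
lemma exists_eq_mul_qB {u₁ u₂ u₃ u₄ : Fin 4 → ℂ}
    (h : ∀ p, qB u₁ (lift p) * qB u₂ (lift p) - qB u₃ (lift p) * qB u₄ (lift p) = 0) :
    ∃ c : ℂ, ∀ w, qB u₁ w * qB u₂ w - qB u₃ w * qB u₄ w = c * qB w w := by
  have e0 := h (0, 0)
  have e1 := h (1, 0)
  have e2 := h (-1, 0)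
  have e3 := h (2, 0)
  have e4 := h (-2, 0)
  have f1 := h (0, 1)
  have f2 := h (0, -1)
  have f3 := h (0, 2)
  have f4 := h (0, -2)
  have g1 := h (1, 1)
  simp only [qB, lift_apply_zero, lift_apply_one, lift_apply_two, lift_apply_three] at *
  have m33 : u₁ 0 * u₂ 0 - u₃ 0 * u₄ 0 = 0 := by linear_combination e0
  have m00 : u₁ 3 * u₂ 3 - u₃ 3 * u₄ 3 = 0 := by
    linear_combination (e3 + e4 - 4 * e1 - 4 * e2 + 6 * e0) / 24
  have m13 : u₁ 1 * u₂ 0 + u₁ 0 * u₂ 1 - u₃ 1 * u₄ 0 - u₃ 0 * u₄ 1 = 0 := by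
    linear_combination (e3 - e4 - 8 * e1 + 8 * e2) / 24
  have m01 : u₁ 1 * u₂ 3 + u₁ 3 * u₂ 1 - u₃ 1 * u₄ 3 - u₃ 3 * u₄ 1 = 0 := by
    linear_combination (-(e3 - e4) + 2 * e1 - 2 * e2) / 24
  have m11 : u₁ 3 * u₂ 0 + u₁ 0 * u₂ 3 - u₃ 3 * u₄ 0 - u₃ 0 * u₄ 3
      + 4 * (u₁ 1 * u₂ 1 - u₃ 1 * u₄ 1) = 0 := by
    linear_combination (e1 + e2 - 2 * e0) / 2 - m00
  have m23 : u₁ 2 * u₂ 0 + u₁ 0 * u₂ 2 - u₃ 2 * u₄ 0 - u₃ 0 * u₄ 2 = 0 := by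
    linear_combination (f3 - f4 - 8 * f1 + 8 * f2) / 24
  have m02 : u₁ 2 * u₂ 3 + u₁ 3 * u₂ 2 - u₃ 2 * u₄ 3 - u₃ 3 * u₄ 2 = 0 := by
    linear_combination (-(f3 - f4) + 2 * f1 - 2 * f2) / 24
  have m22 : u₁ 3 * u₂ 0 + u₁ 0 * u₂ 3 - u₃ 3 * u₄ 0 - u₃ 0 * u₄ 3
      + 4 * (u₁ 2 * u₂ 2 - u₃ 2 * u₄ 2) = 0 := by
    linear_combination (f1 + f2 - 2 * e0) / 2 - m00
  have m12 : u₁ 1 * u₂ 2 + u₁ 2 * u₂ 1 - u₃ 1 * u₄ 2 - u₃ 2 * u₄ 1 = 0 := by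
    linear_combination (g1 - e0 - m11 - m22 - 4 * m00 + 4 * m01 + 4 * m02 + 2 * m13 + 2 * m23) / 4
  refine ⟨(u₁ 3 * u₂ 0 + u₁ 0 * u₂ 3 - u₃ 3 * u₄ 0 - u₃ 0 * u₄ 3) / 2, fun w => ?_⟩
  linear_combination m33 * w 3 ^ 2 + m00 * w 0 ^ 2 - 2 * m13 * w 1 * w 3 - 2 * m01 * w 0 * w 1
    - 2 * m23 * w 2 * w 3 - 2 * m02 * w 0 * w 2 + m11 * w 1 ^ 2 + m22 * w 2 ^ 2
    + 4 * m12 * w 1 * w 2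

end LiftedPoints

section Circles

lemma ev2_circlePoly (a b c : ℂ) (p : ℂ × ℂ) :
    ev2 (circlePoly a b c) p = p.1 ^ 2 + p.2 ^ 2 + a * p.1 + b * p.2 + c := by
  simp [circlePoly]

lemma ev2_circlePoly_eq_qB (a b c : ℂ) (p : ℂ × ℂ) :
    ev2 (circlePoly a b c) p = qB ![c, -a / 2, -b / 2, 1] (lift p) := by
  simp [ev2_circlePoly, qB]; ring

/-- Distinct points of a nondegenerate circle do not lie on a common isotropic line. -/
lemma qB_lift_ne_zero_of_circle {a b c : ℂ} (h : Irreducible (circlePoly a b c)) {p q : ℂ × ℂ}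
    (hp : ev2 (circlePoly a b c) p = 0) (hq : ev2 (circlePoly a b c) q = 0) (hpq : p ≠ q) :
    qB (lift p) (lift q) ≠ 0 := by
  intro h0
  rw [qB_lift_lift] at h0
  rw [ev2_circlePoly] at hp hq
  obtain ⟨x, y⟩ := p
  obtain ⟨x', y'⟩ := q
  simp only at h0 hp hq
  have hx : x - x' ≠ 0 := by
    intro hx
    rw [hx] at h0
    have hy : y - y' = 0 := by simpa using h0
    exact hpq (Prod.ext (sub_eq_zero.1 hx) (sub_eq_zero.1 hy))
  obtain ⟨e, he⟩ : ∃ e, y - y' = e * (x - x') := ⟨(y - y') / (x - x'), by field_simp⟩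
  have he2 : e ^ 2 = -1 := by
    have : (e ^ 2 + 1) * (x - x') ^ 2 = 0 := by rw [he] at h0; linear_combination h0
    have := (mul_eq_zero.1 this).resolve_right (pow_ne_zero _ hx)
    linear_combination this
  have hlin : 2 * x' + 2 * e * y' + a + b * e = 0 := by
    have hxx : x = x' + (x - x') := by ring
    have hyy : y = y' + e * (x - x') := by linear_combination he
    have : (2 * x' + 2 * e * y' + a + b * e) * (x - x') = 0 := by
      have hp' := hp
      rw [hyy] at hp'
      linear_combination hp' - hq - (x - x') ^ 2 * he2
    exact (mul_eq_zero.1 this).resolve_right hx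
  have hfac : circlePoly a b c = (C e * X 0 - X 1 + C (y' - e * x')) *
      (- C e * X 0 - X 1 + C (-b - (y' - e * x'))) := by
    have e1 : a = e * (-b - (y' - e * x')) - e * (y' - e * x') := by
      linear_combination hlin - 2 * x' * he2
    have e2 : c = (y' - e * x') * (-b - (y' - e * x')) := by
      linear_combination hq - x' * hlin + x' ^ 2 * he2
    have hC : (C e : MvPolynomial (Fin 2) ℂ) ^ 2 = -1 := by rw [← C_pow, he2]; simp
    have h1 : (C a : MvPolynomial (Fin 2) ℂ) =
        C e * C (-b - (y' - e * x')) - C e * C (y' - e * x') := by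
      rw [← C_mul, ← C_mul, ← C_sub, ← e1]
    have h2 : (C c : MvPolynomial (Fin 2) ℂ) = C (y' - e * x') * C (-b - (y' - e * x')) := by
      rw [← C_mul, ← e2]
    have h3 : (C b : MvPolynomial (Fin 2) ℂ) =
      - C (-b - (y' - e * x')) - C (y' - e * x') := by
      rw [← C_neg, ← C_sub]; congr 1; ring
    rw [circlePoly, h1, h2, h3]
    linear_combination X 0 ^ 2 * hC
  have hne : ∀ (f : MvPolynomial (Fin 2) ℂ) (k l : ℂ),
      f = C k * X 0 - X 1 + C l → ¬ IsUnit f := by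
    rintro f k l rfl hu
    obtain ⟨r, -, hr⟩ := MvPolynomial.isUnit_iff_eq_C_of_isReduced.1 hu
    have h1 := congrArg (fun f => ev2 f (0, 0)) hr
    have h2 := congrArg (fun f => ev2 f (0, 1)) hr
    simp at h1 h2
    rw [h1] at h2
    simp at h2
  rcases h.isUnit_or_isUnit hfac with hu | hu
  · exact hne _ e _ rfl hu
  · exact hne _ (-e) (-b - (y' - e * x')) (by rw [C_neg]) hu

/-- A circle is determined by three of its points. -/
lemma circle_eq_of_three {a b c a' b' c' : ℂ} (h : Irreducible (circlePoly a b c))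
    {p q r : ℂ × ℂ} (hpq : p ≠ q) (hpr : p ≠ r) (hqr : q ≠ r)
    (hp : ev2 (circlePoly a b c) p = 0) (hq : ev2 (circlePoly a b c) q = 0)
    (hr : ev2 (circlePoly a b c) r = 0) (hp' : ev2 (circlePoly a' b' c') p = 0)
    (hq' : ev2 (circlePoly a' b' c') q = 0) (hr' : ev2 (circlePoly a' b' c') r = 0) :
    circlePoly a b c = circlePoly a' b' c' := by
  have n1 := qB_lift_ne_zero_of_circle h hp hq hpq
  have n2 := qB_lift_ne_zero_of_circle h hp hr hpr
  have n3 := qB_lift_ne_zero_of_circle h hq hr hqr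
  rw [qB_lift_lift] at n1 n2 n3
  rw [ev2_circlePoly] at hp hq hr hp' hq' hr'
  obtain ⟨x₁, y₁⟩ := p
  obtain ⟨x₂, y₂⟩ := q
  obtain ⟨x₃, y₃⟩ := r
  simp only at *
  have d1 : (a - a') * (x₁ - x₂) + (b - b') * (y₁ - y₂) = 0 := by
    linear_combination hp - hp' - hq + hq'
  have d2 : (a - a') * (x₁ - x₃) + (b - b') * (y₁ - y₃) = 0 := by
    linear_combination hp - hp' - hr + hr'
  have hab : a = a' ∧ b = b' := by
    by_contra hne
    have hdet : (x₁ - x₂) * (y₁ - y₃) - (x₁ - x₃) * (y₁ - y₂) = 0 := by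
      by_contra hd
      apply hne
      constructor
      · apply sub_eq_zero.1
        apply (mul_eq_zero.1 (?_ : (a - a') * ((x₁ - x₂) * (y₁ - y₃) - (x₁ - x₃) * (y₁ - y₂)) = 0)).resolve_right hd
        linear_combination (y₁ - y₃) * d1 - (y₁ - y₂) * d2
      · apply sub_eq_zero.1
        apply (mul_eq_zero.1 (?_ : (b - b') * ((x₁ - x₂) * (y₁ - y₃) - (x₁ - x₃) * (y₁ - y₂)) = 0)).resolve_right hd
        linear_combination - (x₁ - x₃) * d1 + (x₁ - x₂) * d2
    obtain ⟨t, ht⟩ : ∃ t, t * ((x₁ - x₂) ^ 2 + (y₁ - y₂) ^ 2) =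
        (x₁ - x₃) * (x₁ - x₂) + (y₁ - y₃) * (y₁ - y₂) := ⟨_, div_mul_cancel₀ _ n1⟩
    have tx : x₃ = x₁ - t * (x₁ - x₂) := by
      apply sub_eq_zero.1
      apply (mul_eq_zero.1 (?_ : _ * ((x₁ - x₂) ^ 2 + (y₁ - y₂) ^ 2) = 0)).resolve_right n1
      linear_combination (x₁ - x₂) * ht + (y₁ - y₂) * hdet
    have ty : y₃ = y₁ - t * (y₁ - y₂) := by
      apply sub_eq_zero.1
      apply (mul_eq_zero.1 (?_ : _ * ((x₁ - x₂) ^ 2 + (y₁ - y₂) ^ 2) = 0)).resolve_right n1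
      linear_combination (y₁ - y₂) * ht - (x₁ - x₂) * hdet
    have hroot : t * (t - 1) * ((x₁ - x₂) ^ 2 + (y₁ - y₂) ^ 2) = 0 := by
      rw [tx, ty] at hr
      linear_combination hr - (1 - t) * hp - t * hq
    rcases mul_eq_zero.1 ((mul_eq_zero.1 hroot).resolve_right n1) with h0 | h0
    · rw [h0] at tx ty
      exact hpr (by rw [tx, ty]; simp)
    · have : t = 1 := by linear_combination h0
      rw [this] at tx ty
      exact hqr (by rw [tx, ty]; simp)
  obtain ⟨rfl, rfl⟩ := hab
  have : c = c' := by linear_combination hp - hp'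
  rw [this]

/-- `v` is a normalised vector on the line spanned by the lifts of `x` and `y`. -/
def OnLine (v : Fin 4 → ℂ) (x y : ℂ × ℂ) : Prop := ∃ α β : ℂ, v = α • lift x + β • lift y

lemma mul_mul_qB_eq_one {v : Fin 4 → ℂ} {x y : ℂ × ℂ} {α β : ℂ} (hv : qB v v = 2)
    (h : v = α • lift x + β • lift y) : α * β * qB (lift x) (lift y) = 1 := by
  rw [h] at hv
  simp only [qB_add_left, qB_add_right, qB_smul_left, qB_smul_right, qB_lift_self,
    qB_comm (lift y) (lift x)] at hv
  linear_combination hv / 2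

lemma OnLine.qB_ne_zero {v : Fin 4 → ℂ} {x y : ℂ × ℂ} (hv : qB v v = 2) (h : OnLine v x y) :
    qB (lift x) (lift y) ≠ 0 := by
  obtain ⟨α, β, h⟩ := h
  intro h0
  simpa [h0] using mul_mul_qB_eq_one hv h

/-- The half-turn about a vector on the line through two lifted points interchanges them. -/
lemma OnLine.reflect_eq {v : Fin 4 → ℂ} {x y : ℂ × ℂ} (hv : qB v v = 2) (h : OnLine v x y) :
    ∃ κ : ℂ, κ ≠ 0 ∧ reflect v (lift x) = κ • lift y := by
  obtain ⟨α, β, h⟩ := h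
  have h1 := mul_mul_qB_eq_one hv h
  refine ⟨β * (β * qB (lift x) (lift y)), ?_, ?_⟩
  · intro h0
    rcases mul_eq_zero.1 h0 with h0 | h0 <;> simp [h0, mul_assoc] at h1
  · have h2 : qB v (lift x) = β * qB (lift x) (lift y) := by
      rw [h]; simp [qB_comm (lift y) (lift x)]
    rw [reflect, h2, h, smul_add, smul_smul, smul_smul]
    have h3 : β * qB (lift x) (lift y) * α = 1 := by linear_combination h1
    rw [h3]
    module

/-- A linear dependence of four vectors orthogonal to a nonzero vector. -/
lemma exists_dependence {u : Fin 4 → ℂ} (hu : u ≠ 0) {w₁ w₂ w₃ w₄ : Fin 4 → ℂ}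
    (h₁ : qB u w₁ = 0) (h₂ : qB u w₂ = 0) (h₃ : qB u w₃ = 0) (h₄ : qB u w₄ = 0) :
    ∃ a b c d : ℂ, ¬ (a = 0 ∧ b = 0 ∧ c = 0 ∧ d = 0) ∧
      a • w₁ + b • w₂ + c • w₃ + d • w₄ = 0 := by
  let T : (Fin 4 → ℂ) →ₗ[ℂ] (Fin 4 → ℂ) :=
    { toFun := fun a => a 0 • w₁ + a 1 • w₂ + a 2 • w₃ + a 3 • w₄
      map_add' := fun a b => by simp only [Pi.add_apply]; module
      map_smul' := fun r a => by simp only [Pi.smul_apply, smul_eq_mul, RingHom.id_apply]; module }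
  by_cases hT : LinearMap.ker T = ⊥
  · exfalso
    have hs : Function.Surjective T := LinearMap.surjective_of_injective (LinearMap.ker_eq_bot.1 hT)
    obtain ⟨w, hw⟩ := exists_qB_ne_zero hu
    obtain ⟨a, rfl⟩ := hs w
    apply hw
    change qB u (a 0 • w₁ + a 1 • w₂ + a 2 • w₃ + a 3 • w₄) = 0
    simp [h₁, h₂, h₃, h₄]
  · obtain ⟨a, ha, ha0⟩ := Submodule.exists_mem_ne_zero_of_ne_bot hT
    refine ⟨a 0, a 1, a 2, a 3, ?_, LinearMap.mem_ker.1 ha⟩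
    rintro ⟨e0, e1, e2, e3⟩
    apply ha0
    ext i
    fin_cases i <;> simpa

/-- Two disjoint pairs of points of a circle are interchanged by a common half-turn. -/
lemma exists_onLine_of_circle {a b c : ℂ} (h : Irreducible (circlePoly a b c)) {x y s t : ℂ × ℂ}
    (hx : ev2 (circlePoly a b c) x = 0) (hy : ev2 (circlePoly a b c) y = 0)
    (hs : ev2 (circlePoly a b c) s = 0) (ht : ev2 (circlePoly a b c) t = 0)
    (hxy : x ≠ y) (hxs : x ≠ s) (hxt : x ≠ t) (hys : y ≠ s) (hyt : y ≠ t) (hst : s ≠ t) :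
    ∃ v, qB v v = 2 ∧ OnLine v x y ∧ OnLine v s t := by
  have qxy := qB_lift_ne_zero_of_circle h hx hy hxy
  have qxs := qB_lift_ne_zero_of_circle h hx hs hxs
  have qxt := qB_lift_ne_zero_of_circle h hx ht hxt
  have qys := qB_lift_ne_zero_of_circle h hy hs hys
  have qyt := qB_lift_ne_zero_of_circle h hy ht hyt
  have qst := qB_lift_ne_zero_of_circle h hs ht hst
  rw [ev2_circlePoly_eq_qB] at hx hy hs ht
  have hu : (![c, -a / 2, -b / 2, 1] : Fin 4 → ℂ) ≠ 0 := fun h => by simpa using congrFun h 3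
  obtain ⟨α, β, γ, δ, h0, hdep⟩ := exists_dependence hu hx hy hs ht
  have ex := congrArg (qB (lift x)) hdep
  have ey := congrArg (qB (lift y)) hdep
  have es := congrArg (qB (lift s)) hdep
  have et := congrArg (qB (lift t)) hdep
  simp only [qB_add_right, qB_smul_right, qB_lift_self, qB_zero_right, mul_zero, zero_add,
    add_zero, qB_comm (lift y) (lift x), qB_comm (lift s) (lift x), qB_comm (lift t) (lift x),
    qB_comm (lift s) (lift y), qB_comm (lift t) (lift y), qB_comm (lift t) (lift s)] at ex ey es et
  have hw : α * β * qB (lift x) (lift y) = γ * δ * qB (lift s) (lift t) := by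
    linear_combination (α * ex + β * ey - γ * es - δ * et) / 2
  have hne : α * β * qB (lift x) (lift y) ≠ 0 := by
    intro hz
    have hz' : α * β = 0 := (mul_eq_zero.1 hz).resolve_right qxy
    have hz2 : γ * δ = 0 := by
      rw [hz] at hw
      exact (mul_eq_zero.1 hw.symm).resolve_right qst
    apply h0
    rcases mul_eq_zero.1 hz' with rfl | rfl <;> rcases mul_eq_zero.1 hz2 with rfl | rfl <;>
      simp_all
  obtain ⟨r, hr⟩ := IsAlgClosed.exists_pow_nat_eq (α * β * qB (lift x) (lift y)) (n := 2) (by norm_num)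
  have hr0 : r ≠ 0 := by rintro rfl; exact hne (by rw [← hr]; norm_num)
  refine ⟨r⁻¹ • (α • lift x + β • lift y), ?_, ⟨r⁻¹ * α, r⁻¹ * β, by module⟩,
    ⟨-(r⁻¹ * γ), -(r⁻¹ * δ), ?_⟩⟩
  · simp only [qB_smul_left, qB_smul_right, qB_add_left, qB_add_right, qB_lift_self,
      qB_comm (lift y) (lift x)]
    field_simp
    linear_combination -2 * hr
  · have : α • lift x + β • lift y = -(γ • lift s + δ • lift t) := by
      rw [eq_neg_iff_add_eq_zero, ← hdep]; module
    rw [this]; module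

end Circles

section PolynomialFunctions

/-- `f` is a polynomial function of degree at most `e` on `ℂ²`. -/
def IsPolyMap (e : ℕ) (f : ℂ × ℂ → ℂ) : Prop :=
  ∃ q : MvPolynomial (Fin 2) ℂ, q.totalDegree ≤ e ∧ ∀ p, ev2 q p = f p

variable {e e' : ℕ} {f f' : ℂ × ℂ → ℂ}

lemma IsPolyMap.mono (h : IsPolyMap e f) (he : e ≤ e') : IsPolyMap e' f := by
  obtain ⟨q, hq, hf⟩ := h
  exact ⟨q, hq.trans he, hf⟩

lemma isPolyMap_const (a : ℂ) : IsPolyMap 0 fun _ => a := ⟨C a, by simp, by simp⟩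

lemma IsPolyMap.add (h : IsPolyMap e f) (h' : IsPolyMap e f') : IsPolyMap e fun p => f p + f' p := by
  obtain ⟨q, hq, hf⟩ := h
  obtain ⟨q', hq', hf'⟩ := h'
  exact ⟨q + q', (totalDegree_add _ _).trans (max_le hq hq'), by simp [hf, hf']⟩

lemma IsPolyMap.sub (h : IsPolyMap e f) (h' : IsPolyMap e f') : IsPolyMap e fun p => f p - f' p := by
  obtain ⟨q, hq, hf⟩ := h
  obtain ⟨q', hq', hf'⟩ := h'
  exact ⟨q - q', (totalDegree_sub _ _).trans (max_le hq hq'), by simp [hf, hf']⟩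

lemma IsPolyMap.mul (h : IsPolyMap e f) (h' : IsPolyMap e' f') : IsPolyMap (e + e') fun p => f p * f' p := by
  obtain ⟨q, hq, hf⟩ := h
  obtain ⟨q', hq', hf'⟩ := h'
  exact ⟨q * q', (totalDegree_mul _ _).trans (add_le_add hq hq'), by simp [hf, hf']⟩

lemma IsPolyMap.const_mul (a : ℂ) (h : IsPolyMap e f) : IsPolyMap e fun p => a * f p := by
  simpa using (isPolyMap_const a).mul h

lemma IsPolyMap.pow (h : IsPolyMap e f) (n : ℕ) : IsPolyMap (n * e) fun p => f p ^ n := by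
  obtain ⟨q, hq, hf⟩ := h
  exact ⟨q ^ n, (totalDegree_pow _ _).trans (Nat.mul_le_mul_left _ hq), by simp [hf]⟩

lemma IsPolyMap.sum {ι : Type*} {s : Finset ι} {F : ι → ℂ × ℂ → ℂ} (h : ∀ i ∈ s, IsPolyMap e (F i)) :
    IsPolyMap e fun p => ∑ i ∈ s, F i p := by
  classical
  induction s using Finset.induction_on with
  | empty => exact ⟨0, by simp, by simp⟩
  | insert i s hi ih =>
    simp only [Finset.sum_insert hi]
    exact (h i (by simp)).add (ih fun j hj => h j (by simp [hj]))

lemma isPolyMap_lift (i : Fin 4) : IsPolyMap 2 fun p => lift p i := by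
  have h0 : IsPolyMap 1 fun p : ℂ × ℂ => p.1 := ⟨X 0, by simp, by simp⟩
  have h1 : IsPolyMap 1 fun p : ℂ × ℂ => p.2 := ⟨X 1, by simp, by simp⟩
  fin_cases i
  · exact (h0.pow 2).add (h1.pow 2)
  · exact h0.mono (by norm_num)
  · exact h1.mono (by norm_num)
  · exact (isPolyMap_const 1).mono (by norm_num)

lemma isPolyMap_qB_lift (u : Fin 4 → ℂ) : IsPolyMap 2 fun p => qB u (lift p) :=
  ((((isPolyMap_lift 3).const_mul _).add ((isPolyMap_lift 0).const_mul _)).sub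
    (((isPolyMap_lift 1).const_mul _).const_mul 2)).sub (((isPolyMap_lift 2).const_mul _).const_mul 2)

end PolynomialFunctions

section Curves

/-- An irreducible plane curve of degree between `5` and `D`. -/
structure IsCurve (D : ℕ) (h : MvPolynomial (Fin 2) ℂ) : Prop where
  irreducible : Irreducible h
  le : h.totalDegree ≤ D
  five_le : 5 ≤ h.totalDegree

variable {D : ℕ} {h : MvPolynomial (Fin 2) ℂ}

lemma IsCurve.not_dvd (hh : IsCurve D h) {q : MvPolynomial (Fin 2) ℂ} (hq : q ≠ 0)
    (hq4 : q.totalDegree ≤ 4) : ¬ h ∣ q := fun hd => by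
  have := totalDegree_le_of_dvd_of_isDomain hd hq
  have := hh.five_le
  omega

lemma X_sub_C_ne_zero' (a : ℂ) : (X 0 - C a : MvPolynomial (Fin 2) ℂ) ≠ 0 := fun h0 => by
  have := congrArg (fun f => ev2 f (a + 1, 0)) h0
  simp at this

lemma IsCurve.zeros_infinite (hh : IsCurve D h) : {p | ev2 h p = 0}.Infinite := by
  intro hfin
  have hp : Prime h := hh.irreducible.prime
  let f : MvPolynomial (Fin 2) ℂ := ∏ p ∈ hfin.toFinset, (X 0 - C p.1)
  have hmem : f ∈ vanishingIdeal ℂ (zeroLocus ℂ (Ideal.span {h})) := by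
    intro x hx
    have h0 : ev2 h (x 0, x 1) = 0 := by
      have h1 := hx h (Ideal.subset_span rfl)
      have hx' : x = ![x 0, x 1] := by ext i; fin_cases i <;> rfl
      rw [hx'] at h1
      simpa [ev2, aeval_eq_eval] using h1
    rw [aeval_eq_eval]
    simp only [f, map_prod]
    exact Finset.prod_eq_zero (i := (x 0, x 1)) (by simpa using h0) (by simp)
  rw [vanishingIdeal_zeroLocus_eq_radical] at hmem
  obtain ⟨n, hn⟩ := hmem
  have hd := hp.dvd_of_dvd_pow (Ideal.mem_span_singleton.1 hn)
  obtain ⟨p, -, hdp⟩ := hp.exists_mem_finset_dvd hd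
  refine hh.not_dvd (X_sub_C_ne_zero' p.1) ?_ hdp
  exact (totalDegree_sub _ _).trans (by simp)

/-- A quartic polynomial function with infinitely many zeros on the curve is zero. -/
lemma IsCurve.forall_eq_zero (hh : IsCurve D h) {f : ℂ × ℂ → ℂ} (hf : IsPolyMap 4 f)
    (hinf : {p | ev2 h p = 0 ∧ f p = 0}.Infinite) (p : ℂ × ℂ) : f p = 0 := by
  obtain ⟨q, hq, hqf⟩ := hf
  rw [← hqf p]
  by_cases hq0 : q = 0
  · simp [hq0]
  obtain ⟨B, hB⟩ := exists_card_common_zeros_le D 4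
  obtain ⟨T, -, hT⟩ := hB h q hh.irreducible hh.le hq (hh.not_dvd hq0 hq)
  exact absurd (T.finite_toSet.subset fun p hp => hT p hp.1 ((hqf p).trans hp.2)) hinf

lemma exists_card_zeros_le (D L : ℕ) : ∃ B : ℕ, ∀ (h : MvPolynomial (Fin 2) ℂ) (f : ℂ × ℂ → ℂ),
    IsCurve D h → IsPolyMap L f →
      (∃ T : Finset (ℂ × ℂ), T.card ≤ B ∧ ∀ p, ev2 h p = 0 → f p = 0 → p ∈ T) ∨
      ∀ p, ev2 h p = 0 → f p = 0 := by
  obtain ⟨B, hB⟩ := exists_card_common_zeros_le D L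
  refine ⟨B, fun h f hh hf => ?_⟩
  obtain ⟨q, hq, hqf⟩ := hf
  by_cases hd : h ∣ q
  · exact Or.inr fun p hp => by rw [← hqf p]; exact ev2_eq_zero_of_dvd hd hp
  · obtain ⟨T, hT, hT'⟩ := hB h q hh.irreducible hh.le hq hd
    exact Or.inl ⟨T, hT, fun p hp hp' => hT' p hp ((hqf p).trans hp')⟩

lemma eq_zero_of_qB_lift {u : Fin 4 → ℂ} (h : ∀ p, qB u (lift p) = 0) : u = 0 := by
  have e0 := h (0, 0)
  have e1 := h (1, 0)
  have e2 := h (-1, 0)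
  have f1 := h (0, 1)
  have f2 := h (0, -1)
  simp only [qB, lift_apply_zero, lift_apply_one, lift_apply_two, lift_apply_three] at *
  have h0 : u 0 = 0 := by linear_combination e0
  ext i
  fin_cases i
  · exact h0
  · change u 1 = 0; linear_combination (e2 - e1) / 4
  · change u 2 = 0; linear_combination (f2 - f1) / 4
  · change u 3 = 0; linear_combination (e1 + e2) / 2 - h0

/-- Plane sections of a curve are bounded in size. -/
lemma exists_card_section_le (D : ℕ) : ∃ B : ℕ, ∀ (h : MvPolynomial (Fin 2) ℂ) (u : Fin 4 → ℂ),
    IsCurve D h → u ≠ 0 →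
      ∃ T : Finset (ℂ × ℂ), T.card ≤ B ∧ ∀ p, ev2 h p = 0 → qB u (lift p) = 0 → p ∈ T := by
  obtain ⟨B, hB⟩ := exists_card_zeros_le D 4
  refine ⟨B, fun h u hh hu => ?_⟩
  have hp : IsPolyMap 4 fun p => qB u (lift p) := (isPolyMap_qB_lift u).mono (by norm_num)
  refine (hB h _ hh hp).resolve_right fun hall => hu (eq_zero_of_qB_lift ?_)
  exact hh.forall_eq_zero hp (hh.zeros_infinite.mono fun p hp => ⟨hp, hall p hp⟩)

lemma IsCurve.section_finite (hh : IsCurve D h) {u : Fin 4 → ℂ} (hu : u ≠ 0) :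
    {p | ev2 h p = 0 ∧ qB u (lift p) = 0}.Finite := by
  obtain ⟨B, hB⟩ := exists_card_section_le D
  obtain ⟨T, -, hT⟩ := hB h u hh hu
  exact T.finite_toSet.subset fun p hp => hT p hp.1 hp.2

/-- The vector `w` is proportional to the lift of a point of the curve. -/
def Hits (h : MvPolynomial (Fin 2) ℂ) (w : Fin 4 → ℂ) : Prop :=
  ∃ t, ev2 h t = 0 ∧ ∃ κ : ℂ, κ ≠ 0 ∧ w = κ • lift t

/-- Clearing denominators in `h (w₁ / w₃, w₂ / w₃)`. -/
lemma exists_isPolyMap_homogenization {e : ℕ} (hD : h.totalDegree ≤ D) {w : ℂ × ℂ → Fin 4 → ℂ}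
    (hw : ∀ i, IsPolyMap e fun p => w p i) : ∃ f : ℂ × ℂ → ℂ, IsPolyMap (D * e) f ∧
      ∀ p, w p 3 ≠ 0 → f p = w p 3 ^ D * ev2 h (w p 1 / w p 3, w p 2 / w p 3) := by
  refine ⟨fun p => ∑ m ∈ h.support, h.coeff m *
    (w p 1 ^ m 0 * w p 2 ^ m 1 * w p 3 ^ (D - (m 0 + m 1))), ?_, fun p hp => ?_⟩
  · refine IsPolyMap.sum fun m hm => ?_
    have h1 := (le_totalDegree_fin_two hm).trans hD
    refine IsPolyMap.const_mul _ (((((hw 1).pow _).mul ((hw 2).pow _)).mul ((hw 3).pow _)).mono ?_)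
    rw [← add_mul, ← add_mul]
    exact Nat.mul_le_mul_right _ (by omega)
  · rw [ev2, eval_eq', Finset.mul_sum]
    refine Finset.sum_congr rfl fun m hm => ?_
    have h1 := (le_totalDegree_fin_two hm).trans hD
    simp only [Fin.prod_univ_two, Matrix.cons_val_zero, Matrix.cons_val_one]
    have h2 : w p 3 ^ D = w p 3 ^ m 0 * w p 3 ^ m 1 * w p 3 ^ (D - (m 0 + m 1)) := by
      rw [← pow_add, ← pow_add]; congr 1; omega
    rw [h2, div_pow, div_pow]
    field_simp

/-- A rational map from one curve to the quadric either meets another curve in a bounded number of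
points or maps all but boundedly many points into it. -/
lemma hits_dichotomy (D e : ℕ) : ∃ B : ℕ, ∀ (h h' : MvPolynomial (Fin 2) ℂ)
    (w : ℂ × ℂ → Fin 4 → ℂ), IsCurve D h → IsCurve D h' → (∀ i, IsPolyMap e fun p => w p i) →
      (∀ p, qB (w p) (w p) = 0) →
      ({p | ev2 h p = 0 ∧ Hits h' (w p)}.Finite →
        ∃ T : Finset (ℂ × ℂ), T.card ≤ B ∧ ∀ p, ev2 h p = 0 → Hits h' (w p) → p ∈ T) ∧
      ({p | ev2 h p = 0 ∧ Hits h' (w p)}.Infinite →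
        {p | ev2 h p = 0 ∧ ¬ Hits h' (w p)}.Finite) := by
  obtain ⟨B, hB⟩ := exists_card_zeros_le D (D * e)
  obtain ⟨B', hB'⟩ := exists_card_zeros_le D e
  refine ⟨B, fun h h' w hh hh' hw hq => ?_⟩
  have hits : ∀ p, Hits h' (w p) → w p 3 ≠ 0 ∧ ev2 h' (w p 1 / w p 3, w p 2 / w p 3) = 0 := by
    rintro p ⟨t, ht, κ, hκ, h1⟩
    rw [h1]
    simp [hκ, ht]
  obtain ⟨f, hf, hfw⟩ := exists_isPolyMap_homogenization hh'.le hw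
  have hzero : ∀ p, Hits h' (w p) → f p = 0 := fun p hp => by
    rw [hfw p (hits p hp).1, (hits p hp).2, mul_zero]
  rcases hB' h _ hh (hw 3) with ⟨T₃, -, hT₃⟩ | h3
  · rcases hB h f hh hf with ⟨T, hT, hTf⟩ | hall
    · have key : ∀ p, ev2 h p = 0 → Hits h' (w p) → p ∈ T := fun p hp hp' => hTf p hp (hzero p hp')
      refine ⟨fun _ => ⟨T, hT, key⟩, fun hinf => absurd ?_ hinf⟩
      exact T.finite_toSet.subset fun p hp => key p hp.1 hp.2
    · have key : {p | ev2 h p = 0 ∧ ¬ Hits h' (w p)}.Finite := by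
        refine T₃.finite_toSet.subset fun p hp => hT₃ p hp.1 ?_
        by_contra h3
        refine hp.2 ⟨(w p 1 / w p 3, w p 2 / w p 3), ?_, w p 3, h3,
          eq_smul_lift_of_isotropic (hq p) h3⟩
        have := hfw p h3
        rw [hall p hp.1] at this
        exact (mul_eq_zero.1 this.symm).resolve_left (pow_ne_zero _ h3)
      refine ⟨fun hfin => absurd ((hfin.union key).subset ?_) hh.zeros_infinite, fun _ => key⟩
      intro p hp
      by_cases h1 : Hits h' (w p)
      · exact Or.inl ⟨hp, h1⟩
      · exact Or.inr ⟨hp, h1⟩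
  · have key : ∀ p, ev2 h p = 0 → ¬ Hits h' (w p) := fun p hp hp' => (hits p hp').1 (h3 p hp)
    refine ⟨fun _ => ⟨∅, by simp, fun p hp hp' => absurd hp' (key p hp)⟩, fun hinf => ?_⟩
    obtain ⟨p, hp⟩ := hinf.nonempty
    exact absurd hp.2 (key p hp.1)

end Curves

section Conical

variable {D : ℕ} {h h' h'' : MvPolynomial (Fin 2) ℂ}

/-- The map `R` carries all but finitely many points of the first curve to the second one. -/
def Carries (h h' : MvPolynomial (Fin 2) ℂ) (R : (Fin 4 → ℂ) → Fin 4 → ℂ) : Prop :=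
  {p | ev2 h p = 0 ∧ ¬ Hits h' (R (lift p))}.Finite

lemma eq_of_map_lift {R : (Fin 4 → ℂ) → Fin 4 → ℂ} (hR : Function.Injective R)
    (hR' : ∀ (a : ℂ) u, R (a • u) = a • R u) {p q t : ℂ × ℂ} {κ κ' : ℂ} (hκ : κ ≠ 0)
    (hp : R (lift p) = κ • lift t) (hq : R (lift q) = κ' • lift t) : p = q := by
  have h1 : R (κ • lift q) = R (κ' • lift p) := by
    rw [hR', hR', hp, hq, smul_smul, smul_smul, mul_comm]
  exact (eq_of_smul_lift_eq hκ (hR h1)).symm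

lemma Carries.comp {R R' : (Fin 4 → ℂ) → Fin 4 → ℂ} (hR : Function.Injective R)
    (hs : ∀ (a : ℂ) u, R (a • u) = a • R u) (hs' : ∀ (a : ℂ) u, R' (a • u) = a • R' u)
    (H : Carries h h' R) (H' : Carries h' h'' R') : Carries h h'' fun u => R' (R u) := by
  have hfin : (⋃ t ∈ {p | ev2 h' p = 0 ∧ ¬ Hits h'' (R' (lift p))},
      {p | ∃ κ : ℂ, κ ≠ 0 ∧ R (lift p) = κ • lift t}).Finite := by
    refine Set.Finite.biUnion H' fun t _ => Set.Subsingleton.finite ?_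
    rintro p ⟨κ, hκ, hp⟩ q ⟨κ', -, hq⟩
    exact eq_of_map_lift hR hs hκ hp hq
  refine (H.union hfin).subset ?_
  rintro p ⟨hp, hp'⟩
  by_cases h1 : Hits h' (R (lift p))
  · right
    obtain ⟨t, ht, κ, hκ, h2⟩ := h1
    refine Set.mem_biUnion (x := t) ⟨ht, ?_⟩ ⟨κ, hκ, h2⟩
    rintro ⟨r, hr, κ', hκ', h3⟩
    refine hp' ⟨r, hr, κ * κ', mul_ne_zero hκ hκ', ?_⟩
    change R' (R (lift p)) = _
    rw [h2, hs', h3, smul_smul]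
  · exact Or.inl ⟨hp, h1⟩

lemma isPolyMap_reflect_lift (v : Fin 4 → ℂ) (i : Fin 4) :
    IsPolyMap 2 fun p => reflect v (lift p) i := by
  have : IsPolyMap 2 fun p => v i * qB v (lift p) - lift p i :=
    ((isPolyMap_qB_lift v).const_mul _).sub (isPolyMap_lift i)
  convert this using 2
  simp [reflect, mul_comm]

/-- The half-turn about `v` maps infinitely many points of the first curve to the second one. -/
def Conical (h h' : MvPolynomial (Fin 2) ℂ) (v : Fin 4 → ℂ) : Prop :=
  qB v v = 2 ∧ {p | ev2 h p = 0 ∧ Hits h' (reflect v (lift p))}.Infinite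

lemma reflect_injective {v : Fin 4 → ℂ} (hv : qB v v = 2) : Function.Injective (reflect v) :=
  fun u w huw => by rw [← reflect_reflect hv u, huw, reflect_reflect hv]

lemma Conical.carries {v : Fin 4 → ℂ} (H : Conical h h' v) (hh : IsCurve D h)
    (hh' : IsCurve D h') : Carries h h' (reflect v) := by
  obtain ⟨B, hB⟩ := hits_dichotomy D 2
  exact (hB h h' _ hh hh' (isPolyMap_reflect_lift v)
    fun p => by rw [qB_reflect_reflect H.1, qB_lift_self]).2 H.2

lemma Carries.conical {v : Fin 4 → ℂ} (H : Carries h h' (reflect v)) (hh : IsCurve D h)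
    (hv : qB v v = 2) : Conical h h' v := by
  refine ⟨hv, fun hfin => hh.zeros_infinite ((H.union hfin).subset fun p hp => ?_)⟩
  by_cases h1 : Hits h' (reflect v (lift p))
  · exact Or.inr ⟨hp, h1⟩
  · exact Or.inl ⟨hp, h1⟩

lemma Conical.symm {v : Fin 4 → ℂ} (H : Conical h h' v) : Conical h' h v := by
  refine ⟨H.1, fun hfin => H.2 ?_⟩
  have hfin' : (⋃ t ∈ {p | ev2 h' p = 0 ∧ Hits h (reflect v (lift p))},
      {p | ∃ κ : ℂ, κ ≠ 0 ∧ reflect v (lift p) = κ • lift t}).Finite := by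
    refine Set.Finite.biUnion hfin fun t _ => Set.Subsingleton.finite ?_
    rintro p ⟨κ, hκ, hp⟩ q ⟨κ', -, hq⟩
    exact eq_of_map_lift (reflect_injective H.1) (fun a u => reflect_smul v u a) hκ hp hq
  refine hfin'.subset ?_
  rintro p ⟨hp, t, ht, κ, hκ, h1⟩
  refine Set.mem_biUnion (x := t) ⟨ht, p, hp, κ⁻¹, inv_ne_zero hκ, ?_⟩ ⟨κ, hκ, h1⟩
  have h2 := reflect_reflect H.1 (lift p)
  rw [h1, reflect_smul] at h2
  rw [← h2, smul_smul, inv_mul_cancel₀ hκ, one_smul]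

lemma Conical.reflect {v w : Fin 4 → ℂ} (hv : Conical h h' v) (hw : Conical h h' w)
    (hh : IsCurve D h) (hh' : IsCurve D h') : Conical h h' (reflect v w) := by
  have hs : ∀ (v : Fin 4 → ℂ) (a : ℂ) u, _root_.reflect v (a • u) = a • _root_.reflect v u :=
    fun v a u => reflect_smul v u a
  have h1 := Carries.comp (reflect_injective hv.1) (hs v) (hs w) (hv.carries hh hh')
    (hw.symm.carries hh' hh)
  have h2 := Carries.comp ((reflect_injective hw.1).comp (reflect_injective hv.1))
    (fun a u => by simp [hs]) (hs v) h1 (hv.carries hh hh')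
  refine Carries.conical (v := _root_.reflect v w) ?_ hh
    (by rw [qB_reflect_reflect hv.1, hw.1])
  have h3 : _root_.reflect (_root_.reflect v w) =
      fun u => _root_.reflect v (_root_.reflect w (_root_.reflect v u)) :=
    funext fun u => reflect_reflect_left hv.1 w u
  rw [h3]
  exact h2

/-- The sequence `v₀, v₁, …` in which each vector is obtained from the one two places before it by
the half-turn about its predecessor. -/
def turnSeq (c : ℂ) (v₀ v₁ : Fin 4 → ℂ) : ℕ → Fin 4 → ℂ
  | 0 => v₀
  | 1 => v₁
  | k + 2 => c • turnSeq c v₀ v₁ (k + 1) - turnSeq c v₀ v₁ k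

lemma turnSeq_spec {v₀ v₁ : Fin 4 → ℂ} (h₀ : Conical h h' v₀) (h₁ : Conical h h' v₁)
    (hh : IsCurve D h) (hh' : IsCurve D h') (k : ℕ) :
    Conical h h' (turnSeq (qB v₀ v₁) v₀ v₁ k) ∧ Conical h h' (turnSeq (qB v₀ v₁) v₀ v₁ (k + 1)) ∧
      qB (turnSeq (qB v₀ v₁) v₀ v₁ (k + 1)) (turnSeq (qB v₀ v₁) v₀ v₁ k) = qB v₀ v₁ := by
  induction k with
  | zero => exact ⟨h₀, h₁, qB_comm _ _⟩
  | succ k ih =>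
    obtain ⟨i1, i2, i3⟩ := ih
    have e : turnSeq (qB v₀ v₁) v₀ v₁ (k + 2) =
        _root_.reflect (turnSeq (qB v₀ v₁) v₀ v₁ (k + 1)) (turnSeq (qB v₀ v₁) v₀ v₁ k) := by
      rw [_root_.reflect, i3]; rfl
    refine ⟨i2, ?_, ?_⟩
    · rw [show k + 1 + 1 = k + 2 from rfl, e]
      exact i2.reflect i1 hh hh'
    · rw [show k + 1 + 1 = k + 2 from rfl, e, _root_.reflect, qB_sub_left, qB_smul_left, i2.1, i3,
        qB_comm (turnSeq (qB v₀ v₁) v₀ v₁ k), i3]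
      ring

lemma qB_turnSeq_eq_zero {u v₀ v₁ : Fin 4 → ℂ} (c : ℂ) (h₀ : qB u v₀ = 0) (h₁ : qB u v₁ = 0)
    (k : ℕ) : qB u (turnSeq c v₀ v₁ k) = 0 ∧ qB u (turnSeq c v₀ v₁ (k + 1)) = 0 := by
  induction k with
  | zero => exact ⟨h₀, h₁⟩
  | succ k ih => exact ⟨ih.2, by simp [turnSeq, ih]⟩

/-- Among boundedly many consecutive members of the sequence two agree up to sign. -/
lemma exists_turnSeq_eq (D : ℕ) : ∃ N : ℕ, ∀ (h h' : MvPolynomial (Fin 2) ℂ) (v₀ v₁ : Fin 4 → ℂ),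
    IsCurve D h → IsCurve D h' → Conical h h' v₀ → Conical h h' v₁ →
      ∃ i j, i < j ∧ j ≤ N ∧ (turnSeq (qB v₀ v₁) v₀ v₁ i = turnSeq (qB v₀ v₁) v₀ v₁ j ∨
        turnSeq (qB v₀ v₁) v₀ v₁ i = - turnSeq (qB v₀ v₁) v₀ v₁ j) := by
  classical
  obtain ⟨N, hN⟩ := exists_card_section_le D
  refine ⟨N, fun h h' v₀ v₁ hh hh' H₀ H₁ => ?_⟩
  set w := turnSeq (qB v₀ v₁) v₀ v₁ with hw
  have hwc : ∀ k, Conical h h' (w k) := fun k => (turnSeq_spec H₀ H₁ hh hh' k).1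
  have hw0 : ∀ k, w k ≠ 0 := fun k h0 => by simpa [h0] using (hwc k).1
  obtain ⟨u, hu, hu0, hu1, -⟩ := exists_orthogonal_three v₀ v₁ v₁
  have hbad : ({p | ev2 h p = 0 ∧ qB u (lift p) = 0} ∪ ⋃ k ∈ Set.Iic N,
      ({p | ev2 h p = 0 ∧ qB (w k) (lift p) = 0} ∪
        {p | ev2 h p = 0 ∧ ¬ Hits h' (reflect (w k) (lift p))})).Finite :=
    (hh.section_finite hu).union (Set.Finite.biUnion (Set.finite_Iic N) fun k _ =>
      (hh.section_finite (hw0 k)).union ((hwc k).carries hh hh'))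
  obtain ⟨s, hs, hs'⟩ := (hh.zeros_infinite.sdiff hbad).nonempty
  simp only [Set.mem_union, Set.mem_iUnion, Set.mem_Iic, not_or, not_exists] at hs'
  have hus : qB u (lift s) ≠ 0 := fun h0 => hs'.1 ⟨hs, h0⟩
  have hws : ∀ k ≤ N, qB (w k) (lift s) ≠ 0 := fun k hk h0 => (hs'.2 k hk).1 ⟨hs, h0⟩
  have hhit : ∀ k ≤ N, Hits h' (reflect (w k) (lift s)) := fun k hk => by
    by_contra h0
    exact (hs'.2 k hk).2 ⟨hs, h0⟩
  choose! t ht κ hκ htκ using hhit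
  obtain ⟨u', hu', hu'0, hu'1, hu's⟩ := exists_orthogonal_three v₀ v₁ (lift s)
  obtain ⟨T, hT, hTs⟩ := hN h' u' hh' hu'
  have hmaps : ∀ k ∈ Finset.range (N + 1), t k ∈ T := fun k hk => by
    have hk : k ≤ N := by simpa [Nat.lt_succ_iff] using hk
    refine hTs _ (ht k hk) ?_
    have h1 := congrArg (qB u') (htκ k hk)
    have hz : qB u' (w k) = 0 := (qB_turnSeq_eq_zero (qB v₀ v₁) hu'0 hu'1 k).1
    simp only [reflect, qB_sub_right, qB_smul_right, hu's, hz, mul_zero, sub_zero] at h1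
    exact (mul_eq_zero.1 h1.symm).resolve_left (hκ k hk)
  obtain ⟨i, hi, j, hj, hij, htt⟩ := Finset.exists_ne_map_eq_of_card_lt_of_maps_to
    (by simpa [Nat.lt_succ_iff] using hT) hmaps
  have key : ∀ i j, i ≤ N → j ≤ N → t i = t j → w i = w j ∨ w i = - w j := by
    intro i j hi hj htt
    have e1 := htκ i hi
    have e2 := htκ j hj
    rw [htt] at e1
    have hκκ : κ i = κ j := by
      have f1 := congrArg (qB u) e1
      have f2 := congrArg (qB u) e2
      simp only [reflect, qB_sub_right, qB_smul_right, hw,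
        (qB_turnSeq_eq_zero (qB v₀ v₁) hu0 hu1 _).1, mul_zero, zero_sub] at f1 f2
      have h0 : qB u (lift (t j)) ≠ 0 := fun h0 => by simp [h0] at f1; exact hus f1
      exact mul_right_cancel₀ h0 (f1.symm.trans f2)
    rw [hκκ, ← e2, reflect, reflect, sub_left_inj] at e1
    obtain ⟨r, hr⟩ : ∃ r : ℂ, w i = r • w j := by
      refine ⟨(qB (w i) (lift s))⁻¹ * qB (w j) (lift s), ?_⟩
      rw [mul_smul, ← e1, smul_smul, inv_mul_cancel₀ (hws i hi), one_smul]
    have h2 := (hwc i).1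
    rw [hr] at h2
    simp only [qB_smul_left, qB_smul_right, (hwc j).1] at h2
    have h3 : (r - 1) * (r + 1) = 0 := by linear_combination h2 / 2
    rcases mul_eq_zero.1 h3 with h3 | h3
    · left; rw [hr, sub_eq_zero.1 h3, one_smul]
    · right; rw [hr, eq_neg_of_add_eq_zero_left h3, neg_smul, one_smul]
  simp only [Finset.mem_range, Nat.lt_succ_iff] at hi hj
  rcases lt_or_gt_of_ne hij with hlt | hlt
  · exact ⟨i, j, hlt, hj, key i j hi hj htt⟩
  · exact ⟨j, i, hlt, hi, key j i hj hi htt.symm⟩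

/-- The polynomials `p₀ = 0`, `p₁ = 1`, `p_{k+2} = X p_{k+1} - p_k`. -/
def turnPoly : ℕ → Polynomial ℂ
  | 0 => 0
  | 1 => 1
  | k + 2 => Polynomial.X * turnPoly (k + 1) - turnPoly k

lemma turnSeq_eq (c : ℂ) (v₀ v₁ : Fin 4 → ℂ) (k : ℕ) :
    turnSeq c v₀ v₁ (k + 1) = (turnPoly (k + 1)).eval c • v₁ - (turnPoly k).eval c • v₀ ∧
    turnSeq c v₀ v₁ (k + 2) = (turnPoly (k + 2)).eval c • v₁ - (turnPoly (k + 1)).eval c • v₀ := by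
  induction k with
  | zero => constructor <;> simp [turnSeq, turnPoly]
  | succ k ih =>
    refine ⟨ih.2, ?_⟩
    rw [show k + 1 + 2 = (k + 1) + 1 + 1 from rfl, turnSeq, ih.1, ih.2]
    simp only [turnPoly, Polynomial.eval_sub, Polynomial.eval_mul, Polynomial.eval_X]
    module

lemma exists_turnSeq_eq_smul_sub (c : ℂ) (v₀ v₁ : Fin 4 → ℂ) (k : ℕ) :
    ∃ r : ℂ, turnSeq c v₀ v₁ k = (turnPoly k).eval c • v₁ - r • v₀ := by
  cases k with
  | zero => exact ⟨-1, by simp [turnSeq, turnPoly]⟩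
  | succ k => exact ⟨_, (turnSeq_eq c v₀ v₁ k).1⟩

lemma eval_turnPoly_two (k : ℕ) :
    (turnPoly k).eval 2 = k ∧ (turnPoly (k + 1)).eval 2 = k + 1 := by
  induction k with
  | zero => simp [turnPoly]
  | succ k ih =>
    refine ⟨by simpa using ih.2, ?_⟩
    simp only [turnPoly, Polynomial.eval_sub, Polynomial.eval_mul, Polynomial.eval_X, ih]
    push_cast; ring

lemma turnSeq_two (v₀ v₁ : Fin 4 → ℂ) (k : ℕ) :
    turnSeq 2 v₀ v₁ k = v₀ + (k : ℂ) • (v₁ - v₀) ∧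
      turnSeq 2 v₀ v₁ (k + 1) = v₀ + ((k : ℂ) + 1) • (v₁ - v₀) := by
  induction k with
  | zero => simp [turnSeq]
  | succ k ih =>
    refine ⟨by simpa using ih.2, ?_⟩
    rw [show k + 1 + 1 = k + 2 from rfl, turnSeq, ih.1, ih.2]
    push_cast
    module

lemma Conical.eq_of_qB_eq_two {v₀ v₁ : Fin 4 → ℂ} (hh : IsCurve D h) (hh' : IsCurve D h')
    (H₀ : Conical h h' v₀) (H₁ : Conical h h' v₁) (hc : qB v₀ v₁ = 2) : v₀ = v₁ := by
  obtain ⟨N, hN⟩ := exists_turnSeq_eq D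
  obtain ⟨i, j, hij, -, hw⟩ := hN h h' v₀ v₁ hh hh' H₀ H₁
  rw [hc, (turnSeq_two v₀ v₁ i).1, (turnSeq_two v₀ v₁ j).1] at hw
  rcases hw with hw | hw
  · have h1 : ((j : ℂ) - i) • (v₁ - v₀) = 0 := by
      have := sub_eq_zero.2 hw.symm
      rw [← this]; module
    rcases smul_eq_zero.1 h1 with h1 | h1
    · have : (j : ℂ) = i := sub_eq_zero.1 h1
      have : j = i := by exact_mod_cast this
      omega
    · exact (sub_eq_zero.1 h1).symm
  · have h1 := congrArg (qB v₀) hw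
    simp only [qB_add_right, qB_neg_right, qB_smul_right, qB_sub_right, hc, H₀.1] at h1
    norm_num at h1

/-- The possible values of `qB` on pairs of conical vectors. -/
lemma exists_qB_conical_mem (D : ℕ) : ∃ Λ : Finset ℂ, ∀ (h h' : MvPolynomial (Fin 2) ℂ)
    (v₀ v₁ : Fin 4 → ℂ), IsCurve D h → IsCurve D h' → Conical h h' v₀ → Conical h h' v₁ →
      qB v₀ v₁ ∈ Λ := by
  classical
  obtain ⟨N, hN⟩ := exists_turnSeq_eq D
  let r : Finset (ℕ × ℕ) := Finset.range (N + 1) ×ˢ Finset.range (N + 1)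
  refine ⟨{2, -2} ∪ (r.biUnion fun z => (turnPoly z.1 - turnPoly z.2).roots.toFinset ∪
    (turnPoly z.1 + turnPoly z.2).roots.toFinset), fun h h' v₀ v₁ hh hh' H₀ H₁ => ?_⟩
  obtain ⟨i, j, hij, hj, hw⟩ := hN h h' v₀ v₁ hh hh' H₀ H₁
  set c := qB v₀ v₁ with hc
  obtain ⟨a, ha⟩ := exists_turnSeq_eq_smul_sub c v₀ v₁ i
  obtain ⟨b, hb⟩ := exists_turnSeq_eq_smul_sub c v₀ v₁ j
  obtain ⟨ε, hε, hw'⟩ : ∃ ε : ℂ, (ε = 1 ∨ ε = -1) ∧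
      turnSeq c v₀ v₁ i = ε • turnSeq c v₀ v₁ j := by
    rcases hw with hw | hw
    · exact ⟨1, Or.inl rfl, by simpa using hw⟩
    · exact ⟨-1, Or.inr rfl, by simpa using hw⟩
  rw [ha, hb] at hw'
  have h1 : ((turnPoly i).eval c - ε * (turnPoly j).eval c) • v₁ = (a - ε * b) • v₀ := by
    rw [← sub_eq_zero] at hw' ⊢
    rw [← hw']; module
  simp only [Finset.mem_union, Finset.mem_insert, Finset.mem_singleton, Finset.mem_biUnion]
  by_cases hz : (turnPoly i).eval c - ε * (turnPoly j).eval c = 0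
  · right
    have hijC : (i : ℂ) ≠ j := by exact_mod_cast hij.ne
    have hijC' : (i : ℂ) + j ≠ 0 := by exact_mod_cast (by omega : i + j ≠ 0)
    refine ⟨(i, j), by simp [r]; omega, ?_⟩
    rcases hε with rfl | rfl
    · left
      rw [Multiset.mem_toFinset, Polynomial.mem_roots']
      refine ⟨fun h0 => ?_, by simpa using hz⟩
      have := congrArg (Polynomial.eval 2) h0
      simp [(eval_turnPoly_two _).1] at this
      exact hijC (sub_eq_zero.1 this)
    · right
      rw [Multiset.mem_toFinset, Polynomial.mem_roots']
      refine ⟨fun h0 => ?_, by simpa using hz⟩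
      have := congrArg (Polynomial.eval 2) h0
      simp [(eval_turnPoly_two _).1] at this
      exact hijC' (by exact_mod_cast this)
  · left
    set z := (turnPoly i).eval c - ε * (turnPoly j).eval c with hzd
    obtain ⟨l, hl⟩ : ∃ l : ℂ, v₁ = l • v₀ := by
      refine ⟨z⁻¹ * (a - ε * b), ?_⟩
      rw [mul_smul, ← h1, smul_smul, inv_mul_cancel₀ hz, one_smul]
    have h2 := H₁.1
    rw [hl] at h2
    rw [hc, hl]
    simp only [qB_smul_left, qB_smul_right, H₀.1] at h2 ⊢
    have h3 : (l - 1) * (l + 1) = 0 := by linear_combination h2 / 2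
    rcases mul_eq_zero.1 h3 with h3 | h3
    · left; linear_combination 2 * h3
    · right; linear_combination 2 * h3

/-- There are boundedly many conical vectors. -/
theorem exists_conical_finset (D : ℕ) : ∃ L : ℕ, ∀ h h' : MvPolynomial (Fin 2) ℂ,
    IsCurve D h → IsCurve D h' →
      ∃ V : Finset (Fin 4 → ℂ), V.card ≤ L ∧ ∀ v, Conical h h' v → v ∈ V := by
  classical
  obtain ⟨Λ, hΛ⟩ := exists_qB_conical_mem D
  refine ⟨(Λ.card + 1) ^ 4, fun h h' hh hh' => ?_⟩
  let V : Set (Fin 4 → ℂ) := {v | Conical h h' v}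
  obtain ⟨b, hbV, hspan, hli⟩ := exists_linearIndependent ℂ V
  have hbfin : b.Finite := hli.set_finite_of_isNoetherian
  have : Fintype b := hbfin.fintype
  have hbcard : Fintype.card b ≤ 4 := by
    simpa using hli.fintype_card_le_finrank
  have hmaps : Set.MapsTo (fun (v : Fin 4 → ℂ) (i : b) => qB v i) V
      (Fintype.piFinset fun _ : b => Λ : Set (b → ℂ)) := fun v hv => by
    simp only [Finset.mem_coe, Fintype.mem_piFinset]
    exact fun i => hΛ h h' v i hh hh' hv (hbV i.2)
  have hinj : Set.InjOn (fun (v : Fin 4 → ℂ) (i : b) => qB v i) V := by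
    intro v hv v' hv' hvv
    have h1 : ∀ w ∈ Submodule.span ℂ b, qB v w = qB v' w := by
      intro w hw
      induction hw using Submodule.span_induction with
      | mem w hw => exact congrFun hvv ⟨w, hw⟩
      | zero => simp
      | add x y _ _ hx hy => simp [hx, hy]
      | smul a x _ hx => simp [hx]
    refine Conical.eq_of_qB_eq_two hh hh' hv hv' ?_
    rw [h1 v' (hspan ▸ Submodule.subset_span hv')]
    exact hv'.1
  have hVfin : V.Finite := Set.Finite.of_injOn hmaps hinj (Finset.finite_toSet _)
  refine ⟨hVfin.toFinset, ?_, fun v hv => hVfin.mem_toFinset.2 hv⟩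
  refine (Finset.card_le_card_of_injOn (t := Fintype.piFinset fun _ : b => Λ)
    (fun (v : Fin 4 → ℂ) (i : b) => qB v i) (fun v hv => ?_) (by simpa using hinj)).trans ?_
  · exact hmaps (by simpa using hv)
  · rw [Fintype.card_piFinset, Finset.prod_const, Finset.card_univ]
    exact (Nat.pow_le_pow_left (Nat.le_succ _) _).trans (Nat.pow_le_pow_right (by omega) hbcard)

end Conical

section Transversals

variable {a b : MvPolynomial (Fin 2) ℂ} {x y x' y' s t : ℂ × ℂ}

lemma eq_or_eq_neg_of_mul_eq {α β α' β' : ℂ} (h0 : α * β ≠ 0) (h1 : α' * β' = α * β)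
    (h2 : α * β' = α' * β) : (α' = α ∧ β' = β) ∨ (α' = -α ∧ β' = -β) := by
  have hα := left_ne_zero_of_mul h0
  have hβ := right_ne_zero_of_mul h0
  have h3 : (α' - α) * (α' + α) = 0 := by
    have : β * ((α' - α) * (α' + α)) = 0 := by linear_combination α * h1 - α' * h2
    exact (mul_eq_zero.1 this).resolve_left hβ
  rcases mul_eq_zero.1 h3 with h4 | h4
  · have h4 : α' = α := sub_eq_zero.1 h4
    subst h4
    exact Or.inl ⟨rfl, mul_left_cancel₀ hα h2⟩
  · have h4 : α' = -α := eq_neg_of_add_eq_zero_left h4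
    subst h4
    exact Or.inr ⟨rfl, mul_left_cancel₀ hα (by linear_combination h2)⟩

lemma OnLine.neg {v : Fin 4 → ℂ} (h : OnLine v x y) : OnLine (-v) x y := by
  obtain ⟨α, β, h⟩ := h
  exact ⟨-α, -β, by rw [h]; module⟩

/-- Two normalised vectors on one line are equal up to sign once their coordinates are
proportional. -/
lemma eq_or_eq_neg_of_onLine {v w : Fin 4 → ℂ} {α β α' β' : ℂ} (hv : qB v v = 2) (hw : qB w w = 2)
    (h : v = α • lift x + β • lift y) (h' : w = α' • lift x + β' • lift y)
    (hp : α * β' = α' * β) : w = v ∨ w = -v := by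
  have h1 := mul_mul_qB_eq_one hv h
  have h2 := mul_mul_qB_eq_one hw h'
  have hq : qB (lift x) (lift y) ≠ 0 := fun h0 => by simp [h0] at h1
  have h0 : α * β ≠ 0 := fun h0 => by simp [h0] at h1
  rcases eq_or_eq_neg_of_mul_eq h0 (mul_right_cancel₀ hq (h2.trans h1.symm)) hp with
    ⟨rfl, rfl⟩ | ⟨rfl, rfl⟩
  · exact Or.inl (h'.trans h.symm)
  · right; rw [h', h]; module

/-- Distinct lines through two pairs of points share at most one normalised vector up to sign. -/
lemma eq_or_eq_neg_of_onLine_onLine {v w : Fin 4 → ℂ} (hv : qB v v = 2) (hw : qB w w = 2)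
    (hxy : x ≠ y) (h1 : (x', y') ≠ (x, y)) (h2 : (x', y') ≠ (y, x))
    (hvx : OnLine v x y) (hvx' : OnLine v x' y') (hwx : OnLine w x y) (hwx' : OnLine w x' y') :
    w = v ∨ w = -v := by
  have hq := hvx'.qB_ne_zero hv
  obtain ⟨α, β, e1⟩ := hvx
  obtain ⟨γ, δ, e2⟩ := hvx'
  obtain ⟨α', β', e3⟩ := hwx
  obtain ⟨γ', δ', e4⟩ := hwx'
  by_cases hp : α * β' = α' * β
  · exact eq_or_eq_neg_of_onLine hv hw e1 e3 hp
  exfalso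
  have hp := sub_ne_zero.2 hp
  have hx : lift x = ((α * β' - α' * β)⁻¹ * (β' * γ - β * γ')) • lift x' +
      ((α * β' - α' * β)⁻¹ * (β' * δ - β * δ')) • lift y' := by
    have : (α * β' - α' * β) • lift x = β' • v - β • w := by rw [e1, e3]; module
    rw [← inv_smul_smul₀ hp (lift x), this, e2, e4]; module
  have hy : lift y = ((α * β' - α' * β)⁻¹ * (α * γ' - α' * γ)) • lift x' +
      ((α * β' - α' * β)⁻¹ * (α * δ' - α' * δ)) • lift y' := by
    have : (α * β' - α' * β) • lift y = α • w - α' • v := by rw [e1, e3]; module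
    rw [← inv_smul_smul₀ hp (lift y), this, e2, e4]; module
  rcases eq_or_eq_of_lift_eq hx hq with rfl | rfl <;>
    rcases eq_or_eq_of_lift_eq hy hq with rfl | rfl
  · exact hxy rfl
  · exact h1 rfl
  · exact h2 rfl
  · exact hxy rfl

/-- The pairs `(x, y)` and `(s, t)` are concyclic, and the half-turn exchanging them does not carry
`a` to `b`. -/
structure Meets (a b : MvPolynomial (Fin 2) ℂ) (x y s t : ℂ × ℂ) : Prop where
  fst_mem : ev2 a s = 0
  snd_mem : ev2 b t = 0
  ne : s ≠ t
  ne' : x ≠ y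
  exists_onLine : ∃ v, qB v v = 2 ∧ OnLine v x y ∧ OnLine v s t ∧ ¬ Conical a b v

lemma exists_card_meets_le_of_orthogonal (D : ℕ) : ∃ B : ℕ, ∀ (a b : MvPolynomial (Fin 2) ℂ)
    (x y x' y' : ℂ × ℂ) (u : Fin 4 → ℂ), IsCurve D a → IsCurve D b → (x', y') ≠ (x, y) →
    (x', y') ≠ (y, x) → u ≠ 0 → qB u (lift x) = 0 → qB u (lift y) = 0 → qB u (lift x') = 0 →
    qB u (lift y') = 0 →
      ∃ T : Finset (ℂ × ℂ), T.card ≤ B ∧ ∀ s t, Meets a b x y s t → Meets a b x' y' s t → s ∈ T := by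
  classical
  obtain ⟨B₁, hB₁⟩ := exists_card_section_le D
  obtain ⟨B₂, hB₂⟩ := hits_dichotomy D 2
  refine ⟨B₁ + B₂, fun a b x y x' y' u ha hb h1 h2 hu hx hy hx' hy' => ?_⟩
  obtain ⟨T₁, hT₁, hT₁s⟩ := hB₁ a u ha hu
  have common : ∀ s t, Meets a b x y s t → Meets a b x' y' s t → s ∉ T₁ → ∃ v, qB v v = 2 ∧
      OnLine v x y ∧ OnLine v x' y' ∧ OnLine v s t ∧ ¬ Conical a b v := by
    rintro s t m m' hs
    have hs : qB u (lift s) ≠ 0 := fun h0 => hs (hT₁s s m.fst_mem h0)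
    obtain ⟨v, hv, hvx, hvs, hvc⟩ := m.exists_onLine
    obtain ⟨w, hw, hwx, hws, -⟩ := m'.exists_onLine
    have huv : qB u v = 0 := by obtain ⟨α, β, rfl⟩ := hvx; simp [hx, hy]
    have huw : qB u w = 0 := by obtain ⟨α, β, rfl⟩ := hwx; simp [hx', hy']
    have hvs' := hvs
    obtain ⟨γ, δ, e1⟩ := hvs
    obtain ⟨γ', δ', e2⟩ := hws
    rw [e1] at huv
    rw [e2] at huw
    simp only [qB_add_right, qB_smul_right] at huv huw
    have hp : γ * δ' = γ' * δ := by
      refine mul_right_cancel₀ hs ?_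
      linear_combination δ' * huv - δ * huw
    rcases eq_or_eq_neg_of_onLine hv hw e1 e2 hp with rfl | rfl
    · exact ⟨w, hv, hvx, hwx, hvs', hvc⟩
    · exact ⟨v, hv, hvx, by simpa using hwx.neg, hvs', hvc⟩
  by_cases hex : ∃ s t, Meets a b x y s t ∧ Meets a b x' y' s t ∧ s ∉ T₁
  · obtain ⟨s₀, t₀, m, m', hs₀⟩ := hex
    obtain ⟨v, hv, hvx, hvx', -, hvc⟩ := common s₀ t₀ m m' hs₀
    obtain ⟨T₂, hT₂, hT₂s⟩ := (hB₂ a b (fun p => reflect v (lift p)) ha hb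
      (isPolyMap_reflect_lift v) (fun p => by rw [qB_reflect_reflect hv, qB_lift_self])).1
      (by by_contra hinf; exact hvc ⟨hv, hinf⟩)
    refine ⟨T₁ ∪ T₂, (Finset.card_union_le _ _).trans (add_le_add hT₁ hT₂), fun s t n n' => ?_⟩
    by_cases hs : s ∈ T₁
    · simp [hs]
    refine Finset.mem_union_right _ (hT₂s s n.fst_mem ?_)
    obtain ⟨w, hw, hwx, hwx', hws, -⟩ := common s t n n' hs
    obtain ⟨κ, hκ, e⟩ := hws.reflect_eq hw
    refine ⟨t, n.snd_mem, κ, hκ, ?_⟩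
    rcases eq_or_eq_neg_of_onLine_onLine hv hw m.ne' h1 h2 hvx hvx' hwx hwx' with rfl | rfl
    · exact e
    · rwa [reflect_neg_left] at e
  · push Not at hex
    exact ⟨T₁, by omega, fun s t m n => hex s t m n⟩

/-- For a generic isotropic `ŝ`, the vector `swing` is the other point of the quadric on the
transversal from `ŝ` composed through both lines. -/
def swing (x y x' y' : ℂ × ℂ) (A B A' B' : Fin 4 → ℂ) (s : ℂ × ℂ) : Fin 4 → ℂ :=
  (qB A' (lift s) * qB B' (lift s) * qB (lift x') (lift y')) •
      (qB A (lift s) • lift x + qB B (lift s) • lift y) +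
    (qB A (lift s) * qB B (lift s) * qB (lift x) (lift y)) •
      (qB A' (lift s) • lift x' + qB B' (lift s) • lift y')

variable {A B A' B' : Fin 4 → ℂ}

lemma IsDual.isotropic (h : IsDual (lift x) (lift y) (lift x') (lift y') A B A' B') (s : ℂ × ℂ) :
    qB A (lift s) * qB B (lift s) * qB (lift x) (lift y) +
      qB A' (lift s) * qB B' (lift s) * qB (lift x') (lift y') +
      qB (qB A (lift s) • lift x + qB B (lift s) • lift y)
        (qB A' (lift s) • lift x' + qB B' (lift s) • lift y') = 0 := by
  have h0 := qB_lift_self s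
  set w := lift s
  rw [← h.expand w] at h0
  simp only [qB_add_left, qB_add_right, qB_smul_left, qB_smul_right, qB_lift_self,
    qB_comm (lift y) (lift x), qB_comm (lift y') (lift x'), qB_comm (lift x') (lift x),
    qB_comm (lift x') (lift y), qB_comm (lift y') (lift x), qB_comm (lift y') (lift y)] at h0 ⊢
  generalize qB A w = α at h0 ⊢
  generalize qB B w = β at h0 ⊢
  generalize qB A' w = α' at h0 ⊢
  generalize qB B' w = β' at h0 ⊢
  linear_combination h0 / 2

lemma qB_swing_self (h : IsDual (lift x) (lift y) (lift x') (lift y') A B A' B') (s : ℂ × ℂ) :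
    qB (swing x y x' y' A B A' B' s) (swing x y x' y' A B A' B' s) = 0 := by
  have h0 := h.isotropic s
  simp only [swing, qB_add_left, qB_add_right, qB_smul_left, qB_smul_right, qB_lift_self,
    qB_comm (lift y) (lift x), qB_comm (lift y') (lift x'), qB_comm (lift x') (lift x),
    qB_comm (lift x') (lift y), qB_comm (lift y') (lift x), qB_comm (lift y') (lift y)] at h0 ⊢
  linear_combination (2 * (qB A (lift s) * qB B (lift s) * qB (lift x) (lift y)) *
    (qB A' (lift s) * qB B' (lift s) * qB (lift x') (lift y'))) * h0

lemma isPolyMap_swing (i : Fin 4) : IsPolyMap 6 fun s => swing x y x' y' A B A' B' s i := by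
  have h1 : ∀ (U V W : Fin 4 → ℂ) (c e : ℂ), IsPolyMap 6 fun s =>
      qB U (lift s) * qB V (lift s) * c * (qB W (lift s) * e) := fun U V W c e => by
    have h := (((isPolyMap_qB_lift U).mul (isPolyMap_qB_lift V)).mul (isPolyMap_const c)).mul
      ((isPolyMap_qB_lift W).mul (isPolyMap_const e))
    exact h
  have := ((h1 A' B' A (qB (lift x') (lift y')) (lift x i)).add
    (h1 A' B' B (qB (lift x') (lift y')) (lift y i))).add
    ((h1 A B A' (qB (lift x) (lift y)) (lift x' i)).add (h1 A B B' (qB (lift x) (lift y)) (lift y' i)))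
  convert this using 2
  simp [swing]

lemma IsDual.left_ne_zero (h : IsDual (lift x) (lift y) (lift x') (lift y') A B A' B') : A ≠ 0 := by
  rintro rfl
  simpa using h.Ax

lemma IsDual.right_ne_zero (h : IsDual (lift x) (lift y) (lift x') (lift y') A B A' B') :
    B ≠ 0 := by
  rintro rfl
  simpa using h.By

/-- A point reflected to the same point along two skew lines is sent there by `swing`. -/
lemma hits_swing (h : IsDual (lift x) (lift y) (lift x') (lift y') A B A' B')
    (m : Meets a b x y s t) (m' : Meets a b x' y' s t)
    (hA : qB A (lift s) ≠ 0) (hB : qB B (lift s) ≠ 0) :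
    Hits b (swing x y x' y' A B A' B' s) := by
  obtain ⟨v, hv, hvx, hvs, -⟩ := m.exists_onLine
  obtain ⟨v', hv', hvx', hvs', -⟩ := m'.exists_onLine
  have hq := hvx.qB_ne_zero hv
  obtain ⟨κ, hκ, e⟩ := hvs.reflect_eq hv
  obtain ⟨κ', hκ', e'⟩ := hvs'.reflect_eq hv'
  have hAprime_v : qB A' v = 0 := by obtain ⟨α, β, rfl⟩ := hvx; simp [h.prime_A_x, h.prime_A_y]
  have hBprime_v : qB B' v = 0 := by obtain ⟨α, β, rfl⟩ := hvx; simp [h.prime_B_x, h.prime_B_y]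
  have hAv' : qB A v' = 0 := by obtain ⟨α, β, rfl⟩ := hvx'; simp [h.Ax', h.Ay']
  have hBv' : qB B v' = 0 := by obtain ⟨α, β, rfl⟩ := hvx'; simp [h.Bx', h.By']
  have f1 := congrArg (qB A') e
  have f2 := congrArg (qB B') e
  have f3 := congrArg (qB A) e'
  have f4 := congrArg (qB B) e'
  simp only [reflect, qB_sub_right, qB_smul_right, hAprime_v, hBprime_v, hAv', hBv', mul_zero,
    zero_sub]
    at f1 f2 f3 f4
  have is := h.isotropic s
  have it := h.isotropic t
  have hst : κ ≠ κ' := by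
    rintro rfl
    refine m.ne (lift_eq_smul (c := -κ) ?_)
    rw [← h.expand (lift s), ← h.expand (lift t)]
    rw [← neg_inj, neg_neg] at f1 f2 f3 f4
    rw [f1, f2, f3, f4]
    module
  have key : qB A (lift s) * qB B (lift s) * qB (lift x) (lift y) * κ =
      qB A' (lift s) * qB B' (lift s) * qB (lift x') (lift y') * κ' := by
    refine mul_left_cancel₀ (sub_ne_zero.2 hst) ?_
    rw [← neg_inj, neg_neg] at f1 f2 f3 f4
    rw [f1, f2, f3, f4] at is ⊢
    simp only [qB_add_left, qB_add_right, qB_smul_left, qB_smul_right] at is it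
    linear_combination κ * κ' * (κ * κ' * it - is)
  refine ⟨t, m.snd_mem, -κ * (qB A (lift s) * qB B (lift s) * qB (lift x) (lift y)),
    mul_ne_zero (neg_ne_zero.2 hκ) (mul_ne_zero (mul_ne_zero hA hB) hq), ?_⟩
  rw [← neg_inj, neg_neg] at f1 f2 f3 f4
  have e1 : κ' • lift t = -(qB A (lift s) • lift x + qB B (lift s) • lift y) +
      κ' • (qB A' (lift t) • lift x' + qB B' (lift t) • lift y') := by
    conv_lhs => rw [← h.expand (lift t)]
    rw [f3, f4]; module
  have e2 : κ • (qB A' (lift t) • lift x' + qB B' (lift t) • lift y') =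
      -(qB A' (lift s) • lift x' + qB B' (lift s) • lift y') := by
    rw [f1, f2]; module
  have e3 : (κ' * κ) • lift t = -(κ • (qB A (lift s) • lift x + qB B (lift s) • lift y)) -
      κ' • (qB A' (lift s) • lift x' + qB B' (lift s) • lift y') := by
    rw [mul_comm, mul_smul, e1, smul_add, smul_comm κ κ', e2]; module
  refine smul_right_injective _ hκ' ?_
  simp only [swing]
  rw [smul_add, smul_smul κ', mul_comm κ', ← key]
  rw [smul_smul κ' (-κ * _), show κ' * (-κ * (qB A (lift s) * qB B (lift s) * qB (lift x) (lift y))) =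
    -(qB A (lift s) * qB B (lift s) * qB (lift x) (lift y)) * (κ' * κ) by ring, mul_smul _ (κ' * κ), e3]
  module

/-- The pairs whose `swing` carries `a` to `b`. -/
def Exceptional (a b : MvPolynomial (Fin 2) ℂ) (x y x' y' : ℂ × ℂ) : Prop :=
  qB (lift x) (lift y) ≠ 0 ∧ qB (lift x') (lift y') ≠ 0 ∧ ∃ A B A' B',
    IsDual (lift x) (lift y) (lift x') (lift y') A B A' B' ∧
      {s | ev2 a s = 0 ∧ Hits b (swing x y x' y' A B A' B' s)}.Infinite

lemma exists_card_meets_le (D : ℕ) : ∃ N : ℕ, ∀ (a b : MvPolynomial (Fin 2) ℂ)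
    (x y x' y' : ℂ × ℂ), IsCurve D a → IsCurve D b → (x', y') ≠ (x, y) →
    (x', y') ≠ (y, x) → ¬ Exceptional a b x y x' y' →
      ∃ T : Finset (ℂ × ℂ), T.card ≤ N ∧ ∀ s t, Meets a b x y s t → Meets a b x' y' s t → s ∈ T := by
  classical
  obtain ⟨B₀, hB₀⟩ := exists_card_meets_le_of_orthogonal D
  obtain ⟨B₁, hB₁⟩ := exists_card_section_le D
  obtain ⟨B₂, hB₂⟩ := hits_dichotomy D 6
  refine ⟨B₀ + (B₁ + B₁ + B₂), fun a b x y x' y' ha hb h1 h2 hex => ?_⟩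
  rcases exists_orthogonal_or_isDual (lift x) (lift y) (lift x') (lift y') with
    ⟨u, hu, hx, hy, hx', hy'⟩ | ⟨A, B, A', B', hd⟩
  · obtain ⟨T, hT, hTs⟩ := hB₀ a b x y x' y' u ha hb h1 h2 hu hx hy hx' hy'
    exact ⟨T, by omega, hTs⟩
  by_cases hq : qB (lift x) (lift y) ≠ 0 ∧ qB (lift x') (lift y') ≠ 0
  swap
  · refine ⟨∅, by simp, fun s t m m' => (hq ?_).elim⟩
    obtain ⟨v, hv, hvx, -, -⟩ := m.exists_onLine
    obtain ⟨v', hv', hvx', -, -⟩ := m'.exists_onLine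
    exact ⟨hvx.qB_ne_zero hv, hvx'.qB_ne_zero hv'⟩
  obtain ⟨T₁, hT₁, hT₁s⟩ := hB₁ a A ha hd.left_ne_zero
  obtain ⟨T₂, hT₂, hT₂s⟩ := hB₁ a B ha hd.right_ne_zero
  obtain ⟨T₃, hT₃, hT₃s⟩ := (hB₂ a b (swing x y x' y' A B A' B') ha hb isPolyMap_swing
    (qB_swing_self hd)).1 (by by_contra hinf; exact hex ⟨hq.1, hq.2, A, B, A', B', hd, hinf⟩)
  refine ⟨T₁ ∪ T₂ ∪ T₃, ?_, fun s t m m' => ?_⟩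
  · have := Finset.card_union_le (T₁ ∪ T₂) T₃
    have := Finset.card_union_le T₁ T₂
    omega
  by_cases hA : qB A (lift s) = 0
  · simp [hT₁s s m.fst_mem hA]
  by_cases hB : qB B (lift s) = 0
  · simp [hT₂s s m.fst_mem hB]
  · simp [hT₃s s m.fst_mem (hits_swing hd m m' hA hB)]

end Transversals

section ExceptionalPairs

variable {D : ℕ} {a b : MvPolynomial (Fin 2) ℂ} {x y x' y' z z' s t : ℂ × ℂ}
  {A B A' B' A₂ B₂ A₂' B₂' : Fin 4 → ℂ}

lemma ne_of_qB_lift_ne_zero (h : qB (lift x) (lift y) ≠ 0) : x ≠ y := by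
  rintro rfl
  simp at h

lemma IsDual.balanced_finite (h : IsDual (lift x) (lift y) (lift x') (lift y') A B A' B')
    (hq : qB (lift x) (lift y) ≠ 0) (hq' : qB (lift x') (lift y') ≠ 0) (ha : IsCurve D a) :
    {s | ev2 a s = 0 ∧ qB (qB (lift x) (lift y) • A) (lift s) * qB B (lift s) -
      qB (qB (lift x') (lift y') • A') (lift s) * qB B' (lift s) = 0}.Finite := by
  by_contra hinf
  obtain ⟨c, hc⟩ := exists_eq_mul_qB (ha.forall_eq_zero
    (((isPolyMap_qB_lift _).mul (isPolyMap_qB_lift _)).sub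
      ((isPolyMap_qB_lift _).mul (isPolyMap_qB_lift _))) hinf)
  have h1 := hc (lift x + lift y)
  have h2 := hc (lift x' + lift y')
  simp only [qB_smul_left, qB_add_left, qB_add_right, h.Ax, h.Ay, h.Ax', h.Ay', h.Bx, h.By, h.Bx',
    h.By', h.prime_A_x, h.prime_A_y, h.prime_A_x', h.prime_A_y', h.prime_B_x, h.prime_B_y,
    h.prime_B_x', h.prime_B_y', qB_lift_self,
    qB_comm (lift y) (lift x), qB_comm (lift y') (lift x')] at h1 h2
  have e1 : c = 1 / 2 := mul_right_cancel₀ hq (by linear_combination -h1 / 2)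
  have e2 : c = -(1 / 2) := mul_right_cancel₀ hq' (by linear_combination -h2 / 2)
  rw [e1] at e2
  norm_num at e2

lemma IsDual.proportional_finite (h : IsDual (lift x) (lift y) (lift x') (lift y') A B A' B')
    (h₂ : IsDual (lift x) (lift y) (lift z) (lift z') A₂ B₂ A₂' B₂')
    (hq : qB (lift x) (lift y) ≠ 0) (hq' : qB (lift x') (lift y') ≠ 0) (ha : IsCurve D a)
    (hzz' : z ≠ z') (h1 : (z, z') ≠ (x', y')) (h2 : (z, z') ≠ (y', x')) :
    {s | ev2 a s = 0 ∧ qB A (lift s) * qB B₂ (lift s) - qB B (lift s) * qB A₂ (lift s) = 0}.Finite := by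
  by_contra hinf
  obtain ⟨c, hc⟩ := exists_eq_mul_qB (ha.forall_eq_zero
    (((isPolyMap_qB_lift _).mul (isPolyMap_qB_lift _)).sub
      ((isPolyMap_qB_lift _).mul (isPolyMap_qB_lift _))) hinf)
  have hc0 : c = 0 := by
    have h0 := hc (lift x + lift y)
    simp only [qB_add_left, qB_add_right, h.Ax, h.Ay, h.Bx, h.By, h₂.Ax, h₂.Ay, h₂.Bx, h₂.By,
      qB_lift_self, qB_comm (lift y) (lift x)] at h0
    exact mul_right_cancel₀ hq (by linear_combination -h0 / 2)
  have key : ∀ w, qB A₂ (lift w) = 0 → qB B₂ (lift w) = 0 → w = x' ∨ w = y' := by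
    intro w hA hB
    have e1 := hc (lift x + lift w)
    have e2 := hc (lift y + lift w)
    simp only [qB_add_right, h.Ax, h.Ay, h.Bx, h.By, h₂.Ax, h₂.Ay, h₂.Bx, h₂.By, hA, hB, hc0] at e1 e2
    have f1 : qB B (lift w) = 0 := by linear_combination -e1
    have f2 : qB A (lift w) = 0 := by linear_combination e2
    have e := (h.expand (lift w)).symm
    rw [f1, f2] at e
    exact eq_or_eq_of_lift_eq (by simpa using e) hq'
  rcases key z h₂.Ax' h₂.Bx' with rfl | rfl <;> rcases key z' h₂.Ay' h₂.By' with rfl | rfl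
  · exact hzz' rfl
  · exact h1 rfl
  · exact h2 rfl
  · exact hzz' rfl

lemma IsDual.swing_eq (h : IsDual (lift x) (lift y) (lift x') (lift y') A B A' B') (s : ℂ × ℂ) :
    swing x y x' y' A B A' B' s =
      (qB A (lift s) * qB B (lift s) * qB (lift x) (lift y)) • lift s -
      (qB (qB (lift x) (lift y) • A) (lift s) * qB B (lift s) -
        qB (qB (lift x') (lift y') • A') (lift s) * qB B' (lift s)) •
        (qB A (lift s) • lift x + qB B (lift s) • lift y) := by
  have e : qB A' (lift s) • lift x' + qB B' (lift s) • lift y' =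
      lift s - (qB A (lift s) • lift x + qB B (lift s) • lift y) :=
    eq_sub_of_add_eq' (h.expand (lift s))
  rw [swing, e]
  simp only [qB_smul_left]
  module

/-- Outside a line of the quadric, the points of that line are independent of a lifted point. -/
lemma eq_zero_of_combination {c α β : ℂ} (hq : qB (lift x) (lift y) ≠ 0) (hx : s ≠ x) (hy : s ≠ y)
    (h : c • lift s + (α • lift x + β • lift y) = 0) : α = 0 ∧ β = 0 := by
  have hc : c = 0 := by
    by_contra hc
    have e : lift s = (-c⁻¹ * α) • lift x + (-c⁻¹ * β) • lift y := by
      have h1 : c • lift s = -(α • lift x + β • lift y) := eq_neg_of_add_eq_zero_left h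
      rw [← inv_smul_smul₀ hc (lift s), h1]; module
    rcases eq_or_eq_of_lift_eq e hq with h1 | h1
    · exact hx h1
    · exact hy h1
  subst hc
  have h1 := congrArg (qB (lift x)) h
  have h2 := congrArg (fun w => qB w (lift y)) h
  simp at h1 h2
  exact ⟨h2.resolve_right hq, h1.resolve_right hq⟩

lemma exists_card_exceptional_le (D : ℕ) : ∃ N : ℕ, ∀ (a b : MvPolynomial (Fin 2) ℂ)
    (x y : ℂ × ℂ) (F : Finset ((ℂ × ℂ) × (ℂ × ℂ))), IsCurve D a → IsCurve D b →
      (∀ p ∈ F, Exceptional a b x y p.1 p.2) → F.card ≤ N := by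
  classical
  obtain ⟨N, hN⟩ := exists_card_section_le D
  obtain ⟨N', hN'⟩ := hits_dichotomy D 6
  refine ⟨2 * N, fun a b x y F ha hb hF => ?_⟩
  rcases F.eq_empty_or_nonempty with rfl | ⟨p₀, hp₀⟩
  · simp
  have hq := (hF p₀ hp₀).1
  have hq' : ∀ p ∈ F, qB (lift p.1) (lift p.2) ≠ 0 := fun p hp => (hF p hp).2.1
  have hF' := fun p hp => (hF p hp).2.2
  choose! A B A' B' hd hinf using hF'
  have hbad : ({x, y} ∪ ⋃ p ∈ F,
      ({s | ev2 a s = 0 ∧ ¬ Hits b (swing x y p.1 p.2 (A p) (B p) (A' p) (B' p) s)} ∪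
      {s | ev2 a s = 0 ∧ qB (qB (lift x) (lift y) • A p) (lift s) * qB (B p) (lift s) -
        qB (qB (lift p.1) (lift p.2) • A' p) (lift s) * qB (B' p) (lift s) = 0} ∪
      ⋃ q ∈ F.filter fun q => q ≠ p ∧ q ≠ p.swap,
        {s | ev2 a s = 0 ∧
          qB (A p) (lift s) * qB (B q) (lift s) - qB (B p) (lift s) * qB (A q) (lift s) = 0}) :
      Set (ℂ × ℂ)).Finite := by
    refine (Set.toFinite _).union (Set.Finite.biUnion F.finite_toSet fun p hp => ?_)
    refine (Set.Finite.union ?_ ((hd p hp).balanced_finite hq (hq' p hp) ha)).union ?_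
    · exact (hN' a b _ ha hb isPolyMap_swing (qB_swing_self (hd p hp))).2 (hinf p hp)
    · refine Set.Finite.biUnion (Finset.finite_toSet _) fun q hqm => ?_
      rw [Finset.mem_coe, Finset.mem_filter] at hqm
      exact (hd p hp).proportional_finite (hd q hqm.1) hq (hq' p hp) ha
        (ne_of_qB_lift_ne_zero (hq' q hqm.1)) hqm.2.1 hqm.2.2
  obtain ⟨s, hs, hs'⟩ := (ha.zeros_infinite.sdiff hbad).nonempty
  simp only [Set.mem_union, Set.mem_iUnion, not_or, not_exists, Set.mem_insert_iff,
    Set.mem_singleton_iff] at hs'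
  obtain ⟨⟨hsx, hsy⟩, hs'⟩ := hs'
  have hhit : ∀ p ∈ F, Hits b (swing x y p.1 p.2 (A p) (B p) (A' p) (B' p) s) := fun p hp => by
    by_contra h0
    exact (hs' p hp).1.1 ⟨hs, h0⟩
  have hbal := fun p hp h0 => (hs' p hp).1.2 ⟨hs, h0⟩
  choose! t ht κ hκ htκ using hhit
  obtain ⟨u, hu, hux, huy, hus⟩ := exists_orthogonal_three (lift x) (lift y) (lift s)
  obtain ⟨T, hT, hTs⟩ := hN b u hb hu
  have hmaps : ∀ p ∈ F, t p ∈ T := fun p hp => by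
    refine hTs _ (ht p hp) ?_
    have h1 := congrArg (qB u) (htκ p hp)
    rw [(hd p hp).swing_eq] at h1
    simp only [qB_sub_right, qB_add_right, qB_smul_right, hux, huy, hus, mul_zero, sub_zero,
      add_zero] at h1
    exact (mul_eq_zero.1 h1.symm).resolve_left (hκ p hp)
  refine (Finset.card_le_mul_card_image_of_maps_to hmaps 2 fun r _ => ?_).trans
    (Nat.mul_le_mul_left _ hT)
  rcases (F.filter fun p => t p = r).eq_empty_or_nonempty with h0 | ⟨p, hp⟩
  · simp [h0]
  refine (Finset.card_le_card (t := {p, p.swap}) fun q hqm => ?_).trans Finset.card_le_two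
  rw [Finset.mem_filter] at hp hqm
  obtain ⟨hp, rfl⟩ := hp
  obtain ⟨hqF, htt⟩ := hqm
  by_contra hne
  simp only [Finset.mem_insert, Finset.mem_singleton, not_or] at hne
  refine (hs' p hp).2 q (Finset.mem_filter.2 ⟨hqF, hne⟩) ⟨hs, ?_⟩
  have e : κ q • swing x y p.1 p.2 (A p) (B p) (A' p) (B' p) s -
      κ p • swing x y q.1 q.2 (A q) (B q) (A' q) (B' q) s = 0 := by
    rw [htκ p hp, htκ q hqF, htt]; module
  rw [(hd p hp).swing_eq, (hd q hqF).swing_eq] at e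
  have hbp := hbal p hp
  generalize qB (qB (lift x) (lift y) • A p) (lift s) * qB (B p) (lift s) -
    qB (qB (lift p.1) (lift p.2) • A' p) (lift s) * qB (B' p) (lift s) = m at e hbp
  generalize qB (qB (lift x) (lift y) • A q) (lift s) * qB (B q) (lift s) -
    qB (qB (lift q.1) (lift q.2) • A' q) (lift s) * qB (B' q) (lift s) = n at e
  obtain ⟨e1, e2⟩ := eq_zero_of_combination (s := s)
    (c := κ q * (qB (A p) (lift s) * qB (B p) (lift s) * qB (lift x) (lift y)) -
      κ p * (qB (A q) (lift s) * qB (B q) (lift s) * qB (lift x) (lift y)))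
    (α := κ p * n * qB (A q) (lift s) - κ q * m * qB (A p) (lift s))
    (β := κ p * n * qB (B q) (lift s) - κ q * m * qB (B p) (lift s)) hq hsx hsy
    (by rw [← e]; module)
  refine mul_left_cancel₀ (mul_ne_zero (hκ q hqF) hbp) ?_
  linear_combination qB (A q) (lift s) * e2 - qB (B q) (lift s) * e1

end ExceptionalPairs

section Incidences

/-- The pairs `p` and `q` of distinct points span concyclic quadruples, and the half-turn
exchanging the points of each pair carries no component in `I` to another. -/
structure Inc (I : Finset (MvPolynomial (Fin 2) ℂ)) (p q : (ℂ × ℂ) × (ℂ × ℂ)) : Prop where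
  ne_left : p.1 ≠ p.2
  ne_right : q.1 ≠ q.2
  fst_ne_fst : p.1 ≠ q.1
  fst_ne_snd : p.1 ≠ q.2
  snd_ne_fst : p.2 ≠ q.1
  snd_ne_snd : p.2 ≠ q.2
  exists_onLine : ∃ v, qB v v = 2 ∧ OnLine v p.1 p.2 ∧ OnLine v q.1 q.2 ∧
    ∀ a ∈ I, ∀ b ∈ I, ¬ Conical a b v

/-- The pairs `p'` that may be incident to unboundedly many pairs in common with `p`. -/
def Confused (I : Finset (MvPolynomial (Fin 2) ℂ)) (p p' : (ℂ × ℂ) × (ℂ × ℂ)) : Prop :=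
  p' = p ∨ p' = p.swap ∨ ∃ a ∈ I, ∃ b ∈ I, Exceptional a b p.1 p.2 p'.1 p'.2

open Classical in
lemma exists_card_confused_le (d : ℕ) : ∃ Δ : ℕ, ∀ (I : Finset (MvPolynomial (Fin 2) ℂ))
    (p : (ℂ × ℂ) × (ℂ × ℂ)) (P : Finset ((ℂ × ℂ) × (ℂ × ℂ))), I.card ≤ d →
      (∀ h ∈ I, IsCurve d h) → (P.filter (Confused I p)).card ≤ Δ := by
  obtain ⟨N, hN⟩ := exists_card_exceptional_le d
  refine ⟨2 + d * (d * N), fun I p P hI hc => ?_⟩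
  have hsub : P.filter (Confused I p) ⊆ {p, p.swap} ∪ I.biUnion fun a => I.biUnion fun b =>
      P.filter fun p' => Exceptional a b p.1 p.2 p'.1 p'.2 := by
    intro p' hp'
    rw [Finset.mem_filter] at hp'
    obtain ⟨hP, h | h | ⟨a, ha, b, hb, h⟩⟩ := hp'
    · simp [h]
    · simp [h]
    · refine Finset.mem_union_right _ ?_
      simp only [Finset.mem_biUnion, Finset.mem_filter]
      exact ⟨a, ha, b, hb, hP, h⟩
  refine (Finset.card_le_card hsub).trans ((Finset.card_union_le _ _).trans
    (add_le_add Finset.card_le_two ?_))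
  refine (Finset.card_biUnion_le_card_mul _ _ (d * N) fun a ha => ?_).trans
    (Nat.mul_le_mul_right _ hI)
  refine (Finset.card_biUnion_le_card_mul _ _ N fun b hb => ?_).trans (Nat.mul_le_mul_right _ hI)
  exact hN a b p.1 p.2 _ (hc a ha) (hc b hb) fun p' hp' => (Finset.mem_filter.1 hp').2

open Classical in
lemma exists_card_inc_inc_le (d : ℕ) : ∃ M : ℕ, ∀ (I : Finset (MvPolynomial (Fin 2) ℂ))
    (S : Finset (ℂ × ℂ)) (p p' : (ℂ × ℂ) × (ℂ × ℂ)), I.card ≤ d → (∀ h ∈ I, IsCurve d h) →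
      (∀ s ∈ S, ∃ h ∈ I, ev2 h s = 0) → ¬ Confused I p p' →
        ((S ×ˢ S).filter fun q => Inc I p q ∧ Inc I p' q).card ≤ M := by
  obtain ⟨N, hN⟩ := exists_card_meets_le d
  obtain ⟨L, hL⟩ := exists_card_section_le d
  refine ⟨d * (d * (N * L)), fun I S p p' hI hc hS hE => ?_⟩
  simp only [Confused, not_or, not_exists, not_and] at hE
  obtain ⟨hE1, hE2, hE3⟩ := hE
  have hT : ∀ a ∈ I, ∀ b ∈ I, ∃ T : Finset (ℂ × ℂ), T.card ≤ N ∧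
      ∀ s t, Meets a b p.1 p.2 s t → Meets a b p'.1 p'.2 s t → s ∈ T := fun a ha b hb =>
    hN a b p.1 p.2 p'.1 p'.2 (hc a ha) (hc b hb) hE1 hE2 (hE3 a ha b hb)
  choose! T hT hTs using hT
  choose u hu hu1 hu2 hu3 using fun s => exists_orthogonal_three (lift p.1) (lift p.2) (lift s)
  have hU : ∀ b ∈ I, ∀ s, ∃ U : Finset (ℂ × ℂ), U.card ≤ L ∧
      ∀ t, ev2 b t = 0 → qB (u s) (lift t) = 0 → t ∈ U := fun b hb s => hL b (u s) (hc b hb) (hu s)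
  choose! U hU hUs using hU
  have hsub : ((S ×ˢ S).filter fun q => Inc I p q ∧ Inc I p' q) ⊆ I.biUnion fun a =>
      I.biUnion fun b => (T a b).biUnion fun s => (U b s).image fun t => (s, t) := by
    rintro ⟨s, t⟩ hq
    rw [Finset.mem_filter, Finset.mem_product] at hq
    obtain ⟨⟨hs, ht⟩, i, i'⟩ := hq
    obtain ⟨a, ha, has⟩ := hS s hs
    obtain ⟨b, hb, hbt⟩ := hS t ht
    simp only [Finset.mem_biUnion, Finset.mem_image]
    obtain ⟨v, hv, hvp, hvq, hvc⟩ := i.exists_onLine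
    obtain ⟨v', hv', hvp', hvq', hvc'⟩ := i'.exists_onLine
    refine ⟨a, ha, b, hb, s, hTs a ha b hb s t
      ⟨has, hbt, i.ne_right, i.ne_left, v, hv, hvp, hvq, hvc a ha b hb⟩
      ⟨has, hbt, i'.ne_right, i'.ne_left, v', hv', hvp', hvq', hvc' a ha b hb⟩,
      t, hUs b hb s t hbt ?_, rfl⟩
    have huv : qB (u s) v = 0 := by obtain ⟨α, β, rfl⟩ := hvp; simp [hu1, hu2]
    obtain ⟨γ, δ, e⟩ := hvq
    have hδ : δ ≠ 0 := by
      rintro rfl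
      simpa using mul_mul_qB_eq_one hv e
    simpa [e, hu3, hδ] using huv
  refine (Finset.card_le_card hsub).trans ?_
  refine (Finset.card_biUnion_le_card_mul _ _ (d * (N * L)) fun a ha => ?_).trans
    (Nat.mul_le_mul_right _ hI)
  refine (Finset.card_biUnion_le_card_mul _ _ (N * L) fun b hb => ?_).trans
    (Nat.mul_le_mul_right _ hI)
  refine (Finset.card_biUnion_le_card_mul _ _ L fun s _ => ?_).trans
    (Nat.mul_le_mul_right _ (hT a ha b hb))
  exact Finset.card_image_le.trans (hU b hb s)

end Incidences

section Elimination

/-- If `z` is a root of `∑ cⱼ Zʲ`, then `P - z Q` divides its homogenisation at `(P, Q)`. -/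
lemma sum_mul_pow_mul_pow_eq {R : Type*} [CommRing R] (P Q z : R) (N : ℕ) (c : ℕ → R)
    (h : ∑ j ∈ Finset.range (N + 2), c j * z ^ j = 0) :
    ∑ j ∈ Finset.range (N + 2), c j * P ^ j * Q ^ (N + 1 - j) =
      (P - z * Q) * ∑ i ∈ Finset.range (N + 1),
        (∑ j ∈ Finset.Ioc i (N + 1), c j * z ^ (j - 1 - i)) * P ^ i * Q ^ (N - i) := by
  have h1 : ∑ j ∈ Finset.range (N + 2), c j * P ^ j * Q ^ (N + 1 - j) =
      ∑ j ∈ Finset.range (N + 2), c j * Q ^ (N + 1 - j) * (P ^ j - (z * Q) ^ j) := by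
    have : ∑ j ∈ Finset.range (N + 2), c j * Q ^ (N + 1 - j) * (z * Q) ^ j = 0 := by
      have : ∀ j ∈ Finset.range (N + 2), c j * Q ^ (N + 1 - j) * (z * Q) ^ j =
          c j * z ^ j * Q ^ (N + 1) := fun j hj => by
        have hj : j ≤ N + 1 := by simpa [Nat.lt_succ_iff] using hj
        rw [mul_pow, ← Nat.sub_add_cancel hj, pow_add, Nat.add_sub_cancel]
        ring
      rw [Finset.sum_congr rfl this, ← Finset.sum_mul, h, zero_mul]
    simp only [mul_sub, Finset.sum_sub_distrib, this, sub_zero]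
    exact Finset.sum_congr rfl fun j _ => by ring
  have h2 : ∀ j ∈ Finset.range (N + 2), c j * Q ^ (N + 1 - j) * (P ^ j - (z * Q) ^ j) =
      (P - z * Q) * ∑ i ∈ Finset.range j, c j * z ^ (j - 1 - i) * P ^ i * Q ^ (N - i) := fun j hj => by
    have hj : j ≤ N + 1 := by simpa [Nat.lt_succ_iff] using hj
    rw [← (Commute.all P (z * Q)).geom_sum₂_mul j, mul_comm _ (P - z * Q), mul_left_comm,
      Finset.mul_sum]
    congr 1
    refine Finset.sum_congr rfl fun i hi => ?_
    rw [Finset.mem_range] at hi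
    rw [mul_pow, show N - i = (N + 1 - j) + (j - 1 - i) by omega, pow_add]
    ring
  rw [h1, Finset.sum_congr rfl h2, ← Finset.mul_sum]
  congr 1
  simp only [Finset.sum_mul]
  refine Finset.sum_comm' fun j i => ?_
  simp only [Finset.mem_range, Finset.mem_Ioc]
  omega

/-- The algebraic relation between the first coordinate and a fraction of quadratic polynomials on
a curve can be chosen without constant roots. -/
lemma exists_reduced_relation (D : ℕ) : ∃ K : ℕ, ∀ h P Q : MvPolynomial (Fin 2) ℂ, IsCurve D h →
    P.totalDegree ≤ 2 → Q.totalDegree ≤ 2 → Q ≠ 0 → (∀ z, P - C z * Q ≠ 0) →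
    ∃ N ≤ D * 2, ∃ c : ℕ → Polynomial ℂ, (∀ j, (c j).natDegree ≤ K) ∧ c N ≠ 0 ∧
      (∀ z, ∑ j ∈ Finset.range (N + 1), c j * Polynomial.C z ^ j ≠ 0) ∧
      h ∣ ∑ j ∈ Finset.range (N + 1), Polynomial.aeval (X 0) (c j) * P ^ j * Q ^ (N - j) := by
  classical
  refine ⟨(D * (2 + D) + D) ^ 2, fun h P Q hh hP hQ hQ0 hPQ => ?_⟩
  set K := (D * (2 + D) + D) ^ 2
  have hprime : Prime h := hh.irreducible.prime
  have hex : ∃ N, ∃ c : ℕ → Polynomial ℂ, (∃ j ≤ N, c j ≠ 0) ∧ (∀ j, (c j).natDegree ≤ K) ∧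
      h ∣ ∑ j ∈ Finset.range (N + 1), Polynomial.aeval (X 0) (c j) * P ^ j * Q ^ (N - j) :=
    ⟨D * 2, exists_algebraic_relation hh.irreducible.ne_zero hh.le (by simp) hP hQ⟩
  have hle : Nat.find hex ≤ D * 2 := Nat.find_min' hex
    (exists_algebraic_relation hh.irreducible.ne_zero hh.le (by simp) hP hQ)
  obtain ⟨c, ⟨j₀, hj₀, hcj₀⟩, hK, hdvd⟩ := Nat.find_spec hex
  have hmin := fun m => Nat.find_min hex (m := m)
  generalize Nat.find hex = N at *
  have hcN : c N ≠ 0 := by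
    intro h0
    obtain _ | N := N
    · obtain rfl : j₀ = 0 := by omega
      exact hcj₀ h0
    refine hmin N (by omega) ⟨c, ⟨j₀, ?_, hcj₀⟩, hK, ?_⟩
    · have : j₀ ≠ N + 1 := fun e => hcj₀ (e ▸ h0)
      omega
    · rw [Finset.sum_range_succ, h0, map_zero, zero_mul, zero_mul, add_zero] at hdvd
      have : ∑ j ∈ Finset.range (N + 1), Polynomial.aeval (X 0) (c j) * P ^ j * Q ^ (N + 1 - j) =
          Q * ∑ j ∈ Finset.range (N + 1), Polynomial.aeval (X 0) (c j) * P ^ j * Q ^ (N - j) := by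
        rw [Finset.mul_sum]
        refine Finset.sum_congr rfl fun j hj => ?_
        rw [Finset.mem_range] at hj
        rw [show N + 1 - j = (N - j) + 1 by omega, pow_succ]
        ring
      rw [this] at hdvd
      exact (hprime.dvd_or_dvd hdvd).resolve_left (hh.not_dvd hQ0 (by omega))
  refine ⟨N, hle, c, hK, hcN, fun z hz => ?_, hdvd⟩
  obtain _ | N := N
  · simp at hz
    exact hcN hz
  have hz' : ∑ j ∈ Finset.range (N + 2), Polynomial.aeval (X 0 : MvPolynomial (Fin 2) ℂ) (c j) *
      (C z) ^ j = 0 := by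
    have := congrArg (Polynomial.aeval (X 0 : MvPolynomial (Fin 2) ℂ)) hz
    simpa [map_sum, algebraMap_eq] using this
  rw [sum_mul_pow_mul_pow_eq P Q (C z) N _ hz'] at hdvd
  refine hmin N (by omega) ⟨fun i => ∑ j ∈ Finset.Ioc i (N + 1), c j * Polynomial.C z ^ (j - 1 - i),
    ⟨N, le_rfl, by simpa using hcN⟩, fun i => ?_, ?_⟩
  · refine Polynomial.natDegree_sum_le_of_forall_le _ _ fun j _ => ?_
    refine Polynomial.natDegree_mul_le.trans ?_
    rw [← Polynomial.C_pow, Polynomial.natDegree_C, add_zero]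
    exact hK j
  · have := (hprime.dvd_or_dvd hdvd).resolve_left (hh.not_dvd (hPQ z)
      (((totalDegree_sub _ _).trans (max_le hP ((totalDegree_mul _ _).trans
        (by simpa using hQ)))).trans (by norm_num)))
    simpa [map_sum, algebraMap_eq] using this

/-- A polynomial in `Z` whose coefficients are polynomials in a single variable `X i`. -/
def stack (i : Fin 2) (N : ℕ) (c : ℕ → Polynomial ℂ) : Polynomial (MvPolynomial (Fin 2) ℂ) :=
  ∑ j ∈ Finset.range (N + 1), Polynomial.monomial j (Polynomial.aeval (X i) (c j))

lemma stack_coeff (i : Fin 2) (N : ℕ) (c : ℕ → Polynomial ℂ) (j : ℕ) :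
    (stack i N c).coeff j = if j ≤ N then Polynomial.aeval (X i) (c j) else 0 := by
  simp [stack, Polynomial.finsetSum_coeff, Polynomial.coeff_monomial]

lemma stack_natDegree_le (i : Fin 2) (N : ℕ) (c : ℕ → Polynomial ℂ) :
    (stack i N c).natDegree ≤ N :=
  Polynomial.natDegree_sum_le_of_forall_le _ _ fun j hj =>
    (Polynomial.natDegree_monomial_le _).trans (by simpa [Nat.lt_succ_iff] using hj)

lemma totalDegree_det_le {n K : ℕ} {M : Matrix (Fin n) (Fin n) (MvPolynomial (Fin 2) ℂ)}
    (h : ∀ i j, (M i j).totalDegree ≤ K) : M.det.totalDegree ≤ n * K := by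
  rw [Matrix.det_apply]
  refine totalDegree_finsetSum_le fun σ _ => ?_
  have h1 : (∏ i, M (σ i) i).totalDegree ≤ n * K := by
    refine (totalDegree_finsetProd _ _).trans ((Finset.sum_le_card_nsmul _ _ K fun i _ => h _ _).trans ?_)
    simp
  rcases Int.units_eq_one_or (Equiv.Perm.sign σ) with e | e
  · simpa [e] using h1
  · simpa [e, Units.neg_smul] using h1

lemma exists_eliminant (N N' K : ℕ) (c c' : ℕ → Polynomial ℂ)
    (hK : ∀ j, (c j).natDegree ≤ K) (hK' : ∀ j, (c' j).natDegree ≤ K) (hN : c N ≠ 0)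
    (hN' : c' N' ≠ 0) (hroot : ∀ z, ∑ j ∈ Finset.range (N' + 1), c' j * Polynomial.C z ^ j ≠ 0) :
    ∃ G : MvPolynomial (Fin 2) ℂ, G ≠ 0 ∧ G.totalDegree ≤ (N + N') * K + K ∧ ∀ ξ ξ' z : ℂ,
      ∑ j ∈ Finset.range (N + 1), (c j).eval ξ * z ^ j = 0 →
      ∑ j ∈ Finset.range (N' + 1), (c' j).eval ξ' * z ^ j = 0 → ev2 G (ξ, ξ') = 0 := by
  classical
  have hcoeff : ∀ (i : Fin 2) (N : ℕ) (c : ℕ → Polynomial ℂ), (∀ j, (c j).natDegree ≤ K) →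
      ∀ j, ((stack i N c).coeff j).totalDegree ≤ K := fun i N c hK j => by
    rw [stack_coeff]
    split_ifs
    · simpa using totalDegree_aeval_polynomial_le _ _ (hK j) (totalDegree_X (R := ℂ) i).le
    · simp
  have heval : ∀ (i : Fin 2) (N : ℕ) (c : ℕ → Polynomial ℂ) (v : Fin 2 → ℂ) (z : ℂ),
      (stack i N c).eval₂ (eval v) z = ∑ j ∈ Finset.range (N + 1), (c j).eval (v i) * z ^ j := by
    intro i N c v z
    have hv : v = ![v 0, v 1] := by ext i; fin_cases i <;> rfl
    rw [stack, Polynomial.eval₂_finsetSum]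
    refine Finset.sum_congr rfl fun j _ => ?_
    rw [Polynomial.eval₂_monomial]
    congr 1
    have := ev2_aeval_polynomial (c j) (X i) (v 0, v 1)
    simp only [ev2] at this
    rw [← hv] at this
    simpa using this
  refine ⟨(stack 0 N c).resultant (stack 1 N' c') N N' * Polynomial.aeval (X 0) (c N),
    mul_ne_zero ?_ ?_, ?_, ?_⟩
  · obtain ⟨ξ, hξ⟩ : ∃ ξ, (c N).eval ξ ≠ 0 := by
      by_contra! h0
      exact hN (Polynomial.funext (by simpa using h0))
    set f : Polynomial ℂ := ∑ j ∈ Finset.range (N + 1), Polynomial.monomial j ((c j).eval ξ) with hf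
    have hfN : f.coeff N = (c N).eval ξ := by
      simp [hf, Polynomial.finsetSum_coeff, Polynomial.coeff_monomial]
    have hf0 : f ≠ 0 := fun h0 => hξ (by rw [← hfN, h0, Polynomial.coeff_zero])
    have hbad : (c' N' * ∏ z ∈ f.roots.toFinset,
        ∑ j ∈ Finset.range (N' + 1), c' j * Polynomial.C z ^ j) ≠ 0 :=
      mul_ne_zero hN' (Finset.prod_ne_zero_iff.2 fun z _ => hroot z)
    obtain ⟨ξ', hξ'⟩ : ∃ ξ', (c' N' * ∏ z ∈ f.roots.toFinset,
        ∑ j ∈ Finset.range (N' + 1), c' j * Polynomial.C z ^ j).eval ξ' ≠ 0 := by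
      by_contra! h0
      exact hbad (Polynomial.funext (by simpa using h0))
    rw [Polynomial.eval_mul, Polynomial.eval_prod] at hξ'
    have hr := Finset.prod_ne_zero_iff.1 (right_ne_zero_of_mul hξ')
    have hξ' := left_ne_zero_of_mul hξ'
    intro hres
    have h1 := Polynomial.resultant_map_map (stack 0 N c) (stack 1 N' c') N N' (eval ![ξ, ξ'])
    rw [hres, map_zero] at h1
    have hdeg : ∀ (i : Fin 2) (N : ℕ) (c : ℕ → Polynomial ℂ) (v : Fin 2 → ℂ),
        (c N).eval (v i) ≠ 0 → ((stack i N c).map (eval v)).natDegree = N := by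
      intro i N c v hv
      refine le_antisymm (Polynomial.natDegree_map_le.trans (stack_natDegree_le _ _ _))
        (Polynomial.le_natDegree_of_ne_zero ?_)
      have hv' : v = ![v 0, v 1] := by ext i; fin_cases i <;> rfl
      have := ev2_aeval_polynomial (c N) (X i) (v 0, v 1)
      simp only [ev2] at this
      rw [← hv'] at this
      rw [Polynomial.coeff_map, stack_coeff, if_pos le_rfl, this]
      simpa using hv
    have d1 := hdeg 0 N c ![ξ, ξ'] (by simpa using hξ)
    have d2 := hdeg 1 N' c' ![ξ, ξ'] (by simpa using hξ')
    refine Polynomial.resultant_ne_zero _ _ ?_ ((congrArg₂ _ d1 d2).trans h1)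
    rw [Polynomial.isCoprime_iff_aeval_ne_zero_of_isAlgClosed ℂ ℂ]
    intro z
    by_contra! h0
    obtain ⟨h2, h3⟩ := h0
    rw [Polynomial.coe_aeval_eq_eval, Polynomial.eval_map, heval] at h2 h3
    refine hr z ?_ ?_
    · rw [Multiset.mem_toFinset, Polynomial.mem_roots hf0, Polynomial.IsRoot, hf,
        Polynomial.eval_finsetSum]
      simpa using h2
    · rw [Polynomial.eval_finsetSum]
      simpa using h3
  · intro h0
    apply hN
    refine Polynomial.funext fun ξ => ?_
    have := ev2_aeval_polynomial (c N) (X 0) (ξ, 0)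
    rw [h0] at this
    simpa using this.symm
  · refine (totalDegree_mul _ _).trans (add_le_add (totalDegree_det_le fun i j => ?_) ?_)
    · rw [Polynomial.sylvester, Matrix.of_apply]
      refine Fin.addCases (fun j => ?_) (fun j => ?_) j
      · rw [Fin.addCases_left]
        split_ifs
        · exact hcoeff _ _ _ hK' _
        · simp
      · rw [Fin.addCases_right]
        split_ifs
        · exact hcoeff _ _ _ hK _
        · simp
    · simpa using totalDegree_aeval_polynomial_le _ _ (hK N) (totalDegree_X (R := ℂ) (0 : Fin 2)).le
  · intro ξ ξ' z h1 h2
    rw [ev2_mul]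
    rcases Nat.eq_zero_or_pos N with rfl | hN0
    · rw [ev2_aeval_polynomial]
      simp at h1
      simp [h1]
    · obtain ⟨p, q, -, -, e⟩ := Polynomial.exists_mul_add_mul_eq_C_resultant
        (stack 0 N c) (stack 1 N' c') (stack_natDegree_le _ _ _) (stack_natDegree_le _ _ _)
        (Or.inl hN0.ne')
      have e := congrArg (Polynomial.eval₂ (eval ![ξ, ξ']) z) e
      rw [Polynomial.eval₂_add, Polynomial.eval₂_mul, Polynomial.eval₂_mul, heval, heval,
        Polynomial.eval₂_C] at e
      have e' : ev2 ((stack 0 N c).resultant (stack 1 N' c') N N') (ξ, ξ') = 0 := by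
        rw [ev2]
        refine e.symm.trans ?_
        simp [h1, h2]
      rw [e', zero_mul]

end Elimination

section AuxiliaryCurves

/-- The linear form cutting out the line through `s` and `t`. -/
def chord (s t : ℂ × ℂ) : Fin 4 → ℂ :=
  ![(t.1 - s.1) * s.2 - (t.2 - s.2) * s.1, -(t.2 - s.2) / 2, (t.1 - s.1) / 2, 0]

/-- The linear form cutting out the circle with diameter `s t`. -/
def diameterCircle (s t : ℂ × ℂ) : Fin 4 → ℂ :=
  ![s.1 * t.1 + s.2 * t.2, (s.1 + t.1) / 2, (s.2 + t.2) / 2, 1]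

lemma qB_chord_lift (s t p : ℂ × ℂ) :
    qB (chord s t) (lift p) = (t.2 - s.2) * (p.1 - s.1) - (t.1 - s.1) * (p.2 - s.2) := by
  simp [qB, chord]; ring

lemma qB_diameterCircle_lift (s t p : ℂ × ℂ) : qB (diameterCircle s t) (lift p) =
    (p.1 - s.1) * (p.1 - t.1) + (p.2 - s.2) * (p.2 - t.2) := by
  simp [qB, diameterCircle]; ring

lemma eq_or_eq_of_chord_of_diameterCircle {s t p : ℂ × ℂ} (hst : qB (lift s) (lift t) ≠ 0)
    (h₁ : qB (chord s t) (lift p) = 0) (h₂ : qB (diameterCircle s t) (lift p) = 0) :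
    p = s ∨ p = t := by
  rw [qB_chord_lift] at h₁
  rw [qB_diameterCircle_lift] at h₂
  rw [qB_lift_lift] at hst
  obtain ⟨x, y⟩ := p
  obtain ⟨a, b⟩ := s
  obtain ⟨a', b'⟩ := t
  simp only [Prod.mk.injEq] at *
  obtain ⟨k, hk⟩ : ∃ k, k * ((a - a') ^ 2 + (b - b') ^ 2) = (x - a) * (a' - a) + (y - b) * (b' - b) :=
    ⟨_, div_mul_cancel₀ _ hst⟩
  have hx : x - a = k * (a' - a) :=
    mul_right_cancel₀ hst (by linear_combination (b' - b) * h₁ - (a' - a) * hk)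
  have hy : y - b = k * (b' - b) :=
    mul_right_cancel₀ hst (by linear_combination -(a' - a) * h₁ - (b' - b) * hk)
  have hx' : x - a' = (k - 1) * (a' - a) := by linear_combination hx
  have hy' : y - b' = (k - 1) * (b' - b) := by linear_combination hy
  rw [hx, hx', hy, hy'] at h₂
  have : k * (k - 1) = 0 := by
    refine (mul_eq_zero.1 ?_).resolve_right hst
    linear_combination h₂
  rcases mul_eq_zero.1 this with h | h
  · left
    rw [h] at hx hy
    exact ⟨by linear_combination hx, by linear_combination hy⟩
  · right
    rw [h] at hx' hy'
    exact ⟨by linear_combination hx', by linear_combination hy'⟩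

lemma exists_qB_diameterCircle_add_smul_chord_ne_zero (S : Finset (ℂ × ℂ)) {s t : ℂ × ℂ}
    (hst : qB (lift s) (lift t) ≠ 0) : ∃ l : ℂ, ∀ x ∈ S, x ≠ s → x ≠ t →
      qB (diameterCircle s t + l • chord s t) (lift x) ≠ 0 := by
  classical
  obtain ⟨l, hl⟩ := Infinite.exists_notMem_finset
    (S.image fun x => -qB (diameterCircle s t) (lift x) / qB (chord s t) (lift x))
  refine ⟨l, fun x hx hs ht h => ?_⟩
  rw [qB_add_left, qB_smul_left] at h
  by_cases h₁ : qB (chord s t) (lift x) = 0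
  · rw [h₁, mul_zero, add_zero] at h
    exact (eq_or_eq_of_chord_of_diameterCircle hst h₁ h).elim hs ht
  · refine hl (Finset.mem_image.2 ⟨x, hx, ?_⟩)
    rw [div_eq_iff h₁]
    linear_combination -h

/-- Pencils of sections through `s` and `t` take the same value at the two points of a pair that is
concyclic with `s` and `t`. -/
lemma qB_mul_qB_eq_of_onLine {v u u' : Fin 4 → ℂ} {x y s t : ℂ × ℂ} (hv : qB v v = 2)
    (hxy : OnLine v x y) (hst : OnLine v s t) (hs : qB u (lift s) = 0) (ht : qB u (lift t) = 0)
    (hs' : qB u' (lift s) = 0) (ht' : qB u' (lift t) = 0) :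
    qB u (lift x) * qB u' (lift y) = qB u (lift y) * qB u' (lift x) := by
  obtain ⟨α, β, h⟩ := hxy
  obtain ⟨γ, δ, h'⟩ := hst
  have hne := mul_mul_qB_eq_one hv h
  have key : ∀ w, qB w (lift s) = 0 → qB w (lift t) = 0 →
      α * qB w (lift x) + β * qB w (lift y) = 0 := fun w h₁ h₂ => by
    have := congrArg (qB w) (h.symm.trans h')
    simpa [h₁, h₂] using this
  have hα : α ≠ 0 := by rintro rfl; simp at hne
  refine mul_left_cancel₀ hα ?_
  linear_combination -(qB u (lift y) * key u' hs' ht') + qB u' (lift y) * key u hs ht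

/-- Evaluating a homogeneous relation in `P` and `Q` at a point where `Q` does not vanish. -/
lemma sum_eval_mul_pow_eq_zero {h P Q : MvPolynomial (Fin 2) ℂ} {N : ℕ} {c : ℕ → Polynomial ℂ}
    (hdvd : h ∣ ∑ j ∈ Finset.range (N + 1), Polynomial.aeval (X 0) (c j) * P ^ j * Q ^ (N - j))
    {x : ℂ × ℂ} (hx : ev2 h x = 0) (hQ : ev2 Q x ≠ 0) :
    ∑ j ∈ Finset.range (N + 1), (c j).eval x.1 * (ev2 P x / ev2 Q x) ^ j = 0 := by
  have h0 := ev2_eq_zero_of_dvd hdvd hx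
  rw [ev2_sum] at h0
  refine (mul_eq_zero.1 ?_).resolve_right (pow_ne_zero N hQ)
  rw [← h0, Finset.sum_mul]
  refine Finset.sum_congr rfl fun j hj => ?_
  have hjN : j ≤ N := Nat.lt_succ_iff.1 (Finset.mem_range.1 hj)
  obtain ⟨k, rfl⟩ := Nat.exists_eq_add_of_le hjN
  rw [ev2_mul, ev2_mul, ev2_pow, ev2_pow, ev2_aeval_polynomial, ev2_X_zero, div_pow, pow_add,
    Nat.add_sub_cancel_left]
  field_simp

/-- The pairs incident to a fixed pair lie, in first coordinates, on a curve of bounded degree. -/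
lemma exists_auxiliary_curve (d : ℕ) : ∃ K : ℕ, ∀ (I : Finset (MvPolynomial (Fin 2) ℂ))
    (S : Finset (ℂ × ℂ)) (q : (ℂ × ℂ) × (ℂ × ℂ)), I.card ≤ d → (∀ h ∈ I, IsCurve d h) →
      (∀ s ∈ S, ∃ h ∈ I, ev2 h s = 0) → ∃ G : MvPolynomial (Fin 2) ℂ, G ≠ 0 ∧ G.totalDegree ≤ K ∧
        ∀ p ∈ S ×ˢ S, Inc I p q → ev2 G (p.1.1, p.2.1) = 0 := by
  classical
  obtain ⟨K, hK⟩ := exists_reduced_relation d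
  refine ⟨d * (d * ((d * 2 + d * 2) * K + K)), ?_⟩
  rintro I S ⟨s, t⟩ hI hc hS
  by_cases hst : qB (lift s) (lift t) = 0
  · refine ⟨1, one_ne_zero, by simp, fun p _ hp => ?_⟩
    obtain ⟨v, hv, -, hq, -⟩ := hp.exists_onLine
    exact absurd hst (hq.qB_ne_zero hv)
  obtain ⟨l, hl⟩ := exists_qB_diameterCircle_add_smul_chord_ne_zero S hst
  set u := chord s t with hu
  set u' := diameterCircle s t + l • chord s t with hu'
  have hs : qB u (lift s) = 0 := by rw [hu, qB_chord_lift]; ring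
  have ht : qB u (lift t) = 0 := by rw [hu, qB_chord_lift]; ring
  have hs' : qB u' (lift s) = 0 := by
    rw [hu', qB_add_left, qB_smul_left, hs, qB_diameterCircle_lift]; ring
  have ht' : qB u' (lift t) = 0 := by
    rw [hu', qB_add_left, qB_smul_left, ht, qB_diameterCircle_lift]; ring
  obtain ⟨P, hP, hPe⟩ := isPolyMap_qB_lift u
  obtain ⟨Q, hQ, hQe⟩ := isPolyMap_qB_lift u'
  have hu'3 : u' 3 = 1 := by simp [hu', chord, diameterCircle]
  have hQ0 : Q ≠ 0 := by
    rintro rfl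
    have := eq_zero_of_qB_lift (u := u') fun p => by simpa using (hQe p).symm
    simp [this] at hu'3
  have hPQ : ∀ z, P - C z * Q ≠ 0 := fun z h => by
    have h0 := eq_zero_of_qB_lift (u := u - z • u') fun p => by
      have := congrArg (fun f => ev2 f p) h
      simpa [hPe, hQe] using this
    have h3 := congrFun h0 3
    simp only [Pi.sub_apply, Pi.smul_apply, hu'3, smul_eq_mul, mul_one, Pi.zero_apply] at h3
    have hz : z = 0 := by simpa [hu, chord] using h3
    rw [hz, zero_smul, sub_zero] at h0
    have h1 := congrFun h0 1
    have h2 := congrFun h0 2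
    simp [hu, chord] at h1 h2
    refine hst ?_
    rw [qB_lift_lift]
    linear_combination (t.1 - s.1) * h2 - (t.2 - s.2) * h1
  choose! N hN c hcK hcN hroot hdvd using fun h (hh : h ∈ I) => hK h P Q (hc h hh) hP hQ hQ0 hPQ
  choose! G hG0 hGd hG using fun a (ha : a ∈ I) b (hb : b ∈ I) =>
    exists_eliminant (N a) (N b) K (c a) (c b) (hcK a ha) (hcK b hb) (hcN a ha) (hcN b hb)
      (hroot b hb)
  refine ⟨∏ a ∈ I, ∏ b ∈ I, G a b, ?_, ?_, ?_⟩
  · exact Finset.prod_ne_zero_iff.2 fun a ha => Finset.prod_ne_zero_iff.2 fun b hb => hG0 a ha b hb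
  · refine (totalDegree_finsetProd _ _).trans ((Finset.sum_le_card_nsmul _ _
      (d * ((d * 2 + d * 2) * K + K)) fun a ha => ?_).trans (Nat.mul_le_mul_right _ hI))
    refine (totalDegree_finsetProd _ _).trans ((Finset.sum_le_card_nsmul _ _
      ((d * 2 + d * 2) * K + K) fun b hb => ?_).trans (Nat.mul_le_mul_right _ hI))
    refine (hGd a ha b hb).trans ?_
    gcongr
    · exact hN a ha
    · exact hN b hb
  · rintro ⟨x, y⟩ hp hinc
    obtain ⟨hxS, hyS⟩ := Finset.mem_product.1 hp
    obtain ⟨a, ha, hxa⟩ := hS x hxS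
    obtain ⟨b, hb, hyb⟩ := hS y hyS
    obtain ⟨v, hv, hvxy, hvst, -⟩ := hinc.exists_onLine
    have hQx : ev2 Q x ≠ 0 := by
      rw [hQe]; exact hl x hxS hinc.fst_ne_fst hinc.fst_ne_snd
    have hQy : ev2 Q y ≠ 0 := by
      rw [hQe]; exact hl y hyS hinc.snd_ne_fst hinc.snd_ne_snd
    have hz : ev2 P x / ev2 Q x = ev2 P y / ev2 Q y := by
      rw [div_eq_div_iff hQx hQy, hPe, hQe, hPe, hQe]
      exact qB_mul_qB_eq_of_onLine hv hvxy hvst hs ht hs' ht'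
    have h1 := sum_eval_mul_pow_eq_zero (hdvd a ha) hxa hQx
    have h2 := sum_eval_mul_pow_eq_zero (hdvd b hb) hyb hQy
    rw [← hz] at h2
    refine ev2_eq_zero_of_dvd ((Finset.dvd_prod_of_mem (G a) hb).trans
      (Finset.dvd_prod_of_mem (fun a => ∏ b ∈ I, G a b) ha)) (hG a ha b hb _ _ _ h1 h2)

lemma exists_card_abscissa_le (d : ℕ) : ∃ μ : ℕ, ∀ (I : Finset (MvPolynomial (Fin 2) ℂ))
    (S : Finset (ℂ × ℂ)) (z : ℂ), I.card ≤ d → (∀ h ∈ I, IsCurve d h) →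
      (∀ s ∈ S, ∃ h ∈ I, ev2 h s = 0) → (S.filter fun x => x.1 = z).card ≤ μ := by
  classical
  obtain ⟨B, hB⟩ := exists_card_section_le d
  refine ⟨d * B, fun I S z hI hc hS => ?_⟩
  have hu : (![-z, -1 / 2, 0, 0] : Fin 4 → ℂ) ≠ 0 := fun h => by simpa using congrFun h 1
  choose! T hT hmem using fun h (hh : h ∈ I) => hB h _ (hc h hh) hu
  refine (Finset.card_le_card (t := I.biUnion T) fun x hx => ?_).trans
    ((Finset.card_biUnion_le_card_mul _ _ B hT).trans (Nat.mul_le_mul_right _ hI))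
  obtain ⟨hxS, hxz⟩ := Finset.mem_filter.1 hx
  obtain ⟨h, hh, h0⟩ := hS x hxS
  exact Finset.mem_biUnion.2 ⟨h, hh, hmem h hh x h0 (by simp [qB, hxz]; ring)⟩

end AuxiliaryCurves

section CountingCircles

/-- The union of the nondegenerate circles through three points. -/
def circleThrough (x y s : ℂ × ℂ) : Set (ℂ × ℂ) :=
  {p | ∃ a b c : ℂ, Irreducible (circlePoly a b c) ∧ ∀ r ∈ ({x, y, s, p} : Set (ℂ × ℂ)),
    ev2 (circlePoly a b c) r = 0}

lemma circleThrough_eq {a b c : ℂ} (h : Irreducible (circlePoly a b c)) {x y s : ℂ × ℂ}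
    (hx : ev2 (circlePoly a b c) x = 0) (hy : ev2 (circlePoly a b c) y = 0)
    (hs : ev2 (circlePoly a b c) s = 0) (hxy : x ≠ y) (hxs : x ≠ s) (hys : y ≠ s) :
    circleThrough x y s = {p | ev2 (circlePoly a b c) p = 0} := by
  ext p
  constructor
  · rintro ⟨a', b', c', h', hr⟩
    have := circle_eq_of_three h hxy hxs hys hx hy hs (hr x (by simp)) (hr y (by simp))
      (hr s (by simp))
    change ev2 (circlePoly a b c) p = 0
    rw [this]
    exact hr p (by simp)
  · intro hp
    refine ⟨a, b, c, h, fun r hr => ?_⟩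
    rcases hr with rfl | rfl | rfl | rfl
    exacts [hx, hy, hs, hp]

lemma OnLine.unique {v : Fin 4 → ℂ} {x y y' : ℂ × ℂ} (hv : qB v v = 2) (h : OnLine v x y)
    (h' : OnLine v x y') : y = y' := by
  obtain ⟨κ, hκ, e⟩ := h.reflect_eq hv
  obtain ⟨κ', -, e'⟩ := h'.reflect_eq hv
  exact eq_of_smul_lift_eq hκ (e.symm.trans e')

lemma exists_four_of_four_le_ncard {S : Finset (ℂ × ℂ)} {γ : Set (ℂ × ℂ)}
    (h : 4 ≤ ((↑S : Set (ℂ × ℂ)) ∩ γ).ncard) : ∃ x ∈ S, ∃ y ∈ S, ∃ s ∈ S, ∃ t ∈ S,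
      (x ∈ γ ∧ y ∈ γ ∧ s ∈ γ ∧ t ∈ γ) ∧ x ≠ y ∧ x ≠ s ∧ x ≠ t ∧ y ≠ s ∧ y ≠ t ∧ s ≠ t := by
  have hfin : ((↑S : Set (ℂ × ℂ)) ∩ γ).Finite := S.finite_toSet.inter_of_left _
  have : Finite ↥((↑S : Set (ℂ × ℂ)) ∩ γ) := hfin
  rw [← Nat.card_coe_set_eq] at h
  let e := (Finite.equivFin ↥((↑S : Set (ℂ × ℂ)) ∩ γ)).symm
  let f : Fin 4 → ℂ × ℂ := fun i => e (Fin.castLE h i)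
  have hf : Function.Injective f :=
    Subtype.val_injective.comp (e.injective.comp (Fin.castLE_injective h))
  have hm : ∀ i, f i ∈ (↑S : Set (ℂ × ℂ)) ∩ γ := fun i => (e (Fin.castLE h i)).2
  refine ⟨f 0, (hm 0).1, f 1, (hm 1).1, f 2, (hm 2).1, f 3, (hm 3).1,
    ⟨(hm 0).2, (hm 1).2, (hm 2).2, (hm 3).2⟩, ?_, ?_, ?_, ?_, ?_, ?_⟩ <;>
  exact hf.ne (by decide)

/-- Points on a union of at most `d` irreducible curves of degree between five and `d` span few
four-point circles. -/
lemma exists_card_four_point_circles_le (d : ℕ) : ∃ c : ℝ, 0 < c ∧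
    ∀ (I : Finset (MvPolynomial (Fin 2) ℂ)) (S : Finset (ℂ × ℂ)), I.card ≤ d →
      (∀ h ∈ I, IsCurve d h) → (∀ s ∈ S, ∃ h ∈ I, ev2 h s = 0) → ∃ F : Finset (Set (ℂ × ℂ)),
        {γ : Set (ℂ × ℂ) | IsCircle γ ∧ 4 ≤ ((↑S : Set (ℂ × ℂ)) ∩ γ).ncard} ⊆ ↑F ∧
          (F.card : ℝ) ≤ c * (S.card : ℝ) ^ ((8:ℝ)/3) := by
  classical
  obtain ⟨Δ, hΔ⟩ := exists_card_confused_le d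
  obtain ⟨M, hM⟩ := exists_card_inc_inc_le d
  obtain ⟨K, hK⟩ := exists_auxiliary_curve d
  obtain ⟨μ, hμ⟩ := exists_card_abscissa_le d
  obtain ⟨L, hL⟩ := exists_conical_finset d
  obtain ⟨c, hc0, hc⟩ := card_incidences_le K Δ M μ
  refine ⟨c + d * (d * L) + 1, by positivity, fun I S hI hcu hS => ?_⟩
  choose! G hG0 hGd hG using fun q => hK I S q hI hcu hS
  choose! V hV hVmem using fun a (ha : a ∈ I) b (hb : b ∈ I) => hL a b (hcu a ha) (hcu b hb)
  have hinc := hc S Prod.fst (S ×ˢ S) G (Inc I) (Confused I) (by simp [sq])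
    (fun z => hμ I S z hI hcu hS) (fun q _ => ⟨hG0 q, hGd q⟩) (fun q _ p hp h => hG q p hp h)
    (fun p _ => hΔ I p _ hI hcu) (fun p _ p' _ h => hM I S p p' hI hcu hS h)
  let F₁ : Finset (Set (ℂ × ℂ)) := (S ×ˢ S).biUnion fun q =>
    ((S ×ˢ S).filter fun p => Inc I p q).image fun p => circleThrough p.1 p.2 q.1
  let W : Finset (Fin 4 → ℂ) := I.biUnion fun a => I.biUnion fun b => V a b
  let F₂ : Finset (Set (ℂ × ℂ)) := (W ×ˢ (S ×ˢ S)).image fun w =>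
    {p | ∃ y, OnLine w.1 w.2.1 y ∧ p ∈ circleThrough w.2.1 y w.2.2}
  have hF₁ : F₁.card ≤ ∑ q ∈ S ×ˢ S, ((S ×ˢ S).filter fun p => Inc I p q).card :=
    Finset.card_biUnion_le.trans (Finset.sum_le_sum fun q _ => Finset.card_image_le)
  have hW : W.card ≤ d * (d * L) :=
    (Finset.card_biUnion_le_card_mul _ _ (d * L) fun a ha =>
      (Finset.card_biUnion_le_card_mul _ _ L fun b hb => hV a ha b hb).trans
        (Nat.mul_le_mul_right _ hI)).trans (Nat.mul_le_mul_right _ hI)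
  have hF₂ : F₂.card ≤ d * (d * L) * S.card ^ 2 := by
    refine Finset.card_image_le.trans ?_
    rw [Finset.card_product, Finset.card_product, sq]
    exact Nat.mul_le_mul_right _ hW
  refine ⟨F₁ ∪ F₂, ?_, ?_⟩
  · rintro γ ⟨⟨a, b, c, hirr, rfl⟩, h4⟩
    obtain ⟨x, hxS, y, hyS, s, hsS, t, htS, ⟨hx, hy, hs, ht⟩, hxy, hxs, hxt, hys, hyt, hst⟩ :=
      exists_four_of_four_le_ncard h4
    obtain ⟨v, hv, hvxy, hvst⟩ := exists_onLine_of_circle hirr hx hy hs ht hxy hxs hxt hys hyt hst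
    have hγ := circleThrough_eq hirr hx hy hs hxy hxs hys
    rw [Finset.coe_union]
    by_cases hcon : ∃ a ∈ I, ∃ b ∈ I, Conical a b v
    · obtain ⟨a', ha', b', hb', hvab⟩ := hcon
      refine Or.inr (Finset.mem_image.2 ⟨(v, x, s), ?_, ?_⟩)
      · refine Finset.mem_product.2 ⟨?_, Finset.mem_product.2 ⟨hxS, hsS⟩⟩
        exact Finset.mem_biUnion.2 ⟨a', ha', Finset.mem_biUnion.2
          ⟨b', hb', hVmem a' ha' b' hb' v hvab⟩⟩
      · rw [← hγ]
        ext p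
        constructor
        · rintro ⟨y', hy', hp⟩
          rwa [hvxy.unique hv hy']
        · exact fun hp => ⟨y, hvxy, hp⟩
    · push Not at hcon
      refine Or.inl (Finset.mem_biUnion.2 ⟨(s, t), Finset.mk_mem_product hsS htS,
        Finset.mem_image.2 ⟨(x, y), Finset.mem_filter.2 ⟨Finset.mk_mem_product hxS hyS, ?_⟩, hγ⟩⟩)
      exact ⟨hxy, hst, hxs, hxt, hys, hyt, v, hv, hvxy, hvst, hcon⟩
  · have hn : (S.card : ℝ) ^ 2 ≤ (S.card : ℝ) ^ ((8:ℝ)/3) := by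
      rcases Nat.eq_zero_or_pos S.card with h | h
      · rw [h, Nat.cast_zero, Real.zero_rpow (by norm_num)]; norm_num
      · rw [← Real.rpow_natCast]
        exact Real.rpow_le_rpow_of_exponent_le (by exact_mod_cast h) (by norm_num)
    have h₁ : (F₁.card : ℝ) ≤ c * (S.card : ℝ) ^ ((8:ℝ)/3) := le_trans (by exact_mod_cast hF₁) hinc
    have h₂ : (F₂.card : ℝ) ≤ d * (d * L) * (S.card : ℝ) ^ ((8:ℝ)/3) :=
      le_trans (by exact_mod_cast hF₂) (mul_le_mul_of_nonneg_left hn (by positivity))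
    have h₃ : ((F₁ ∪ F₂).card : ℝ) ≤ F₁.card + F₂.card := by
      exact_mod_cast Finset.card_union_le F₁ F₂
    have h₄ : (0 : ℝ) ≤ (S.card : ℝ) ^ ((8:ℝ)/3) := by positivity
    linarith

end CountingCircles

/-- **Corollary 4.2.** If `C` is a plane algebraic curve of degree `d` and `S ⊆ C` has `n`
points, then the number of circles containing at least four points of `S` is at most
`c·n^{8/3}` with `c = c(d)`, unless `C` contains an irreducible algebraic curve of degree
at most four. -/
theorem four_point_circles_on_curve (d : ℕ) :
    ∃ c : ℝ, 0 < c ∧ ∀ g : MvPolynomial (Fin 2) ℂ, g ≠ 0 → g.totalDegree = d →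
      ∀ S : Finset (ℂ × ℂ), (↑S : Set (ℂ × ℂ)) ⊆ {p : ℂ × ℂ | ev2 g p = 0} →
      (({γ : Set (ℂ × ℂ) | IsCircle γ ∧ 4 ≤ ((↑S : Set (ℂ × ℂ)) ∩ γ).ncard}).Finite ∧
        (({γ : Set (ℂ × ℂ) | IsCircle γ ∧ 4 ≤ ((↑S : Set (ℂ × ℂ)) ∩ γ).ncard}).ncard : ℝ) ≤
          c * (S.card : ℝ) ^ ((8:ℝ)/3))
      ∨ ∃ h : MvPolynomial (Fin 2) ℂ, Irreducible h ∧ h.totalDegree ≤ 4 ∧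
          {p : ℂ × ℂ | ev2 h p = 0} ⊆ {p : ℂ × ℂ | ev2 g p = 0} := by
  obtain ⟨c, hc, hcount⟩ := exists_card_four_point_circles_le d
  refine ⟨c, hc, fun g hg hd S hS => ?_⟩
  obtain ⟨I, hI, hI1, hI2⟩ := exists_irreducible_factors hg
  rw [hd] at hI hI1
  by_cases hlow : ∃ h ∈ I, h.totalDegree ≤ 4
  · obtain ⟨h, hh, h4⟩ := hlow
    exact Or.inr ⟨h, (hI1 h hh).1, h4, fun p hp => ev2_eq_zero_of_dvd (hI1 h hh).2.1 hp⟩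
  · push Not at hlow
    obtain ⟨F, hF, hFc⟩ := hcount I S hI (fun h hh => ⟨(hI1 h hh).1, (hI1 h hh).2.2, hlow h hh⟩)
      fun s hs => hI2 s (hS hs)
    refine Or.inl ⟨F.finite_toSet.subset hF, le_trans ?_ hFc⟩
    rw [← Set.ncard_coe_finset F]
    exact_mod_cast Set.ncard_le_ncard hF F.finite_toSet
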